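/- arXiv:2503.18685 — 2 statements merged into one kernel-verified Lean document; each statement's English description precedes it below -/
import Mathlib

section
/- The number of off-diagonally symmetric alternating sign matrices of order 2n equals ∏_{i=1}^{n} (6i-2)!/(2n+2i)!. -/
open Finset

/-- An alternating sign matrix: entries in {-1,0,1}, all row/column prefix sums in {0,1}
(equivalent to the nonzero entries alternating in sign starting and ending with 1),
and all row and column sums equal to 1. -/
def IsASM {n : ℕ} (A : Matrix (Fin n) (Fin n) ℤ) : Prop :=
  (∀ i j, A i j = -1 ∨ A i j = 0 ∨ A i j = 1) ∧
  (∀ i k : Fin n, (∑ j ∈ Finset.univ.filter (fun j => j ≤ k), A i j) = 0 ∨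
                  (∑ j ∈ Finset.univ.filter (fun j => j ≤ k), A i j) = 1) ∧
  (∀ j k : Fin n, (∑ i ∈ Finset.univ.filter (fun i => i ≤ k), A i j) = 0 ∨
                  (∑ i ∈ Finset.univ.filter (fun i => i ≤ k), A i j) = 1) ∧
  (∀ i, ∑ j, A i j = 1) ∧
  (∀ j, ∑ i, A i j = 1)

/-- A diagonally symmetric ASM. -/
def IsDSASM {n : ℕ} (A : Matrix (Fin n) (Fin n) ℤ) : Prop :=
  IsASM A ∧ A.IsSymm

/-- An even-order off-diagonally symmetric ASM: a DSASM with all diagonal entries zero. -/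
def IsOSASMeven {n : ℕ} (A : Matrix (Fin n) (Fin n) ℤ) : Prop :=
  IsDSASM A ∧ ∀ i, A i i = 0

/-- An odd-order off-diagonally symmetric ASM: a DSASM with exactly one nonzero diagonal entry. -/
def IsOSASModd {n : ℕ} (A : Matrix (Fin n) (Fin n) ℤ) : Prop :=
  IsDSASM A ∧ (Finset.univ.filter (fun i => A i i ≠ 0)).card = 1

/-- R(A): the number of nonzero entries strictly above the diagonal. -/
def Rstat {n : ℕ} (A : Matrix (Fin n) (Fin n) ℤ) : ℕ :=
  ∑ p ∈ Finset.univ.filter (fun p : Fin n × Fin n => p.1 < p.2), (A p.1 p.2).natAbs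

/-- S(A): the number of nonzero diagonal entries. -/
def Sstat {n : ℕ} (A : Matrix (Fin n) (Fin n) ℤ) : ℕ :=
  ∑ i, (A i i).natAbs

/-- T(A): the (1-based) column index of the unique 1 in the first row
(for an ASM, the first row has a single nonzero entry, which equals 1). -/
def Tstat {n : ℕ} (A : Matrix (Fin n) (Fin n) ℤ) : ℕ :=
  ∑ p ∈ Finset.univ.filter (fun p : Fin n × Fin n => p.1.1 = 0),
    (p.2.1 + 1) * (A p.1 p.2).natAbs

section Lattice

variable {ι K : Type*} [DecidableEq ι] [Field K]

/-- The state obtained from `s` by negating the labels of the lines `i` and `j`. -/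
def flipPair (s : ι → Bool) (i j : ι) : ι → Bool :=
  Function.update (Function.update s i (!s i)) j (!s j)

/-- The six-vertex crossing of the lines `i` and `j`, with spectral parameter `u i * u j`,
normalized so that all weights are `1` when `u i * u j = 1`. -/
def crossOp (ω : K) (u : ι → K) (i j : ι) : Module.End K ((ι → Bool) → K) where
  toFun f s :=
    if s i = s j then
      (ω * (u i * u j) - 1) * (ω - 1)⁻¹ * f s +
        (if s i then u i * u j else 1) * f (flipPair s i j)
    else (ω - u i * u j) * (ω - 1)⁻¹ * f s
  map_add' f g := by
    ext s
    simp only [Pi.add_apply]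
    split_ifs <;> ring
  map_smul' c f := by
    ext s
    simp only [Pi.smul_apply, smul_eq_mul, RingHom.id_apply]
    split_ifs <;> ring

/-- The crossing that exchanges the neighbouring lines `i` and `j`. -/
def exchangeOp (ω : K) (u : ι → K) (i j : ι) : Module.End K ((ι → Bool) → K) where
  toFun f s :=
    if s i = s j then (ω * u i - u j) * f s
    else (1 + ω) * (u i - u j) * f s +
      (ω - 1) * (if s i then u i else u j) * f (flipPair s i j)
  map_add' f g := by
    ext s
    simp only [Pi.add_apply]
    split_ifs <;> ring
  map_smul' c f := by
    ext s
    simp only [Pi.smul_apply, smul_eq_mul, RingHom.id_apply]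
    split_ifs <;> ring

lemma crossOp_apply (ω : K) (u : ι → K) (i j : ι) (f : (ι → Bool) → K) (s : ι → Bool) :
    crossOp ω u i j f s = if s i = s j then
      (ω * (u i * u j) - 1) * (ω - 1)⁻¹ * f s +
        (if s i then u i * u j else 1) * f (flipPair s i j)
    else (ω - u i * u j) * (ω - 1)⁻¹ * f s := rfl

lemma exchangeOp_apply (ω : K) (u : ι → K) (i j : ι) (f : (ι → Bool) → K) (s : ι → Bool) :
    exchangeOp ω u i j f s = if s i = s j then (ω * u i - u j) * f s
    else (1 + ω) * (u i - u j) * f s +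
      (ω - 1) * (if s i then u i else u j) * f (flipPair s i j) := rfl

lemma flipPair_left {i j : ι} (hij : i ≠ j) (s : ι → Bool) : flipPair s i j i = !s i := by
  simp [flipPair, hij]

lemma flipPair_right (i j : ι) (s : ι → Bool) : flipPair s i j j = !s j := by
  simp [flipPair]

lemma flipPair_of_ne {i j k : ι} (hi : k ≠ i) (hj : k ≠ j) (s : ι → Bool) :
    flipPair s i j k = s k := by
  simp [flipPair, hi, hj]

lemma flipPair_comm (s : ι → Bool) (i j : ι) : flipPair s i j = flipPair s j i := by
  by_cases h : i = j
  · rw [h]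
  · exact Function.update_comm h _ _ _

lemma flipPair_flipPair_comm {i j k l : ι} (hik : i ≠ k) (hil : i ≠ l) (hjk : j ≠ k)
    (hjl : j ≠ l) (s : ι → Bool) :
    flipPair (flipPair s i j) k l = flipPair (flipPair s k l) i j := by
  ext m
  simp only [flipPair, Function.update_apply]
  split_ifs <;> simp_all

lemma flipPair_self {i j : ι} (hij : i ≠ j) (s : ι → Bool) :
    flipPair (flipPair s i j) i j = s := by
  ext m
  simp only [flipPair, Function.update_apply]
  split_ifs <;> simp_all

lemma commute_crossOp_crossOp (ω : K) (u : ι → K) {i j k l : ι} (hik : i ≠ k) (hil : i ≠ l)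
    (hjk : j ≠ k) (hjl : j ≠ l) : Commute (crossOp ω u i j) (crossOp ω u k l) := by
  ext f s
  simp only [Module.End.mul_apply, crossOp_apply, flipPair_of_ne hik hil, flipPair_of_ne hjk hjl,
    flipPair_of_ne hik.symm hjk.symm, flipPair_of_ne hil.symm hjl.symm,
    flipPair_flipPair_comm hik hil hjk hjl s]
  split_ifs <;> ring

lemma commute_exchangeOp_crossOp (ω : K) (u : ι → K) {i j k l : ι} (hik : i ≠ k) (hil : i ≠ l)
    (hjk : j ≠ k) (hjl : j ≠ l) : Commute (exchangeOp ω u i j) (crossOp ω u k l) := by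
  ext f s
  simp only [Module.End.mul_apply, crossOp_apply, exchangeOp_apply, flipPair_of_ne hik hil,
    flipPair_of_ne hjk hjl,
    flipPair_of_ne hik.symm hjk.symm, flipPair_of_ne hil.symm hjl.symm,
    flipPair_flipPair_comm hik hil hjk hjl s]
  split_ifs <;> ring

lemma crossOp_symm (ω : K) (u : ι → K) (i j : ι) : crossOp ω u i j = crossOp ω u j i := by
  ext f s
  simp only [crossOp_apply, flipPair_comm s j i, mul_comm (u j) (u i)]
  by_cases h : s i = s j
  · simp [h]
  · simp [h, Ne.symm h]

/-- The reflection equation. -/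
lemma exchangeOp_mul_crossOp_same (ω : K) (u : ι → K) {i j : ι} (hij : i ≠ j) :
    exchangeOp ω u i j * crossOp ω u i j = crossOp ω u i j * exchangeOp ω u i j := by
  ext f s
  simp only [Module.End.mul_apply, crossOp_apply, exchangeOp_apply, flipPair_left hij,
    flipPair_right, flipPair_self hij]
  cases s i <;> cases s j <;> simp <;> ring

lemma flipPair_flipPair_shared {i j k : ι} (hij : i ≠ j) (hik : i ≠ k) (hjk : j ≠ k)
    (s : ι → Bool) : flipPair (flipPair s i k) j k = flipPair s i j := by
  ext m
  simp only [flipPair, Function.update_apply]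
  split_ifs <;> simp_all

/-- The Yang–Baxter equation. -/
lemma exchangeOp_yangBaxter {ω : K} (hω : ω ^ 2 + ω + 1 = 0) (hω1 : ω ≠ 1) (u : ι → K)
    {i j k : ι} (hij : i ≠ j) (hik : i ≠ k) (hjk : j ≠ k) :
    exchangeOp ω u i j * (crossOp ω u i k * crossOp ω u j k) =
      crossOp ω u j k * crossOp ω u i k * exchangeOp ω u i j := by
  ext f s
  have e1 := flipPair_flipPair_shared hij hik hjk s
  have e2 : flipPair (flipPair s j k) i k = flipPair s i j := by
    rw [flipPair_flipPair_shared hij.symm hjk hik, flipPair_comm]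
  have e3 : flipPair (flipPair s i j) i k = flipPair s j k := by
    rw [flipPair_comm s i j, flipPair_comm _ i k, flipPair_flipPair_shared hjk hij.symm hik.symm]
  have e4 : flipPair (flipPair s i j) j k = flipPair s i k := by
    rw [flipPair_comm _ j k, flipPair_flipPair_shared hik hij hjk.symm]
  have e5 : flipPair (flipPair s i k) i j = flipPair s j k := by
    rw [flipPair_comm s i k, flipPair_comm _ i j, flipPair_flipPair_shared hjk.symm hik.symm
      hij.symm, flipPair_comm]
  have e6 : flipPair (flipPair s j k) i j = flipPair s i k := by
    rw [flipPair_comm s j k, flipPair_flipPair_shared hik.symm hjk.symm hij, flipPair_comm]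
  have n1 := flipPair_left hij s
  have n2 := flipPair_left hik s
  have n3 := flipPair_left hjk s
  have n4 := flipPair_of_ne hik.symm hjk.symm s
  have n5 := flipPair_of_ne hij.symm hjk s
  have n6 := flipPair_of_ne hij hik s
  have hne : ω - 1 ≠ 0 := sub_ne_zero.2 hω1
  simp only [Module.End.mul_apply, crossOp_apply, exchangeOp_apply, flipPair_right, e1, e2, e3, e4,
    e5, e6, n1, n2, n3, n4, n5, n6, flipPair_self hij, flipPair_self hjk]
  generalize f s = f0
  generalize f (flipPair s i j) = f1
  generalize f (flipPair s i k) = f2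
  generalize f (flipPair s j k) = f3
  generalize u i = x
  generalize u j = y
  generalize u k = z
  clear e1 e2 e3 e4 e5 e6 n1 n2 n3 n4 n5 n6
  cases s i <;> cases s j <;> cases s k <;> simp <;> field_simp <;> grind

/-- The line `i` crosses the lines of `l` one after the other. -/
def rowOp (ω : K) (u : ι → K) (i : ι) (l : List ι) : Module.End K ((ι → Bool) → K) :=
  (l.map (crossOp ω u i)).prod

/-- All crossings of the triangle formed by the lines of `l`, row by row. -/
def triangleOp (ω : K) (u : ι → K) : List ι → Module.End K ((ι → Bool) → K)
  | [] => 1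
  | i :: l => rowOp ω u i l * triangleOp ω u l

/-- The indicator function of the states in which all lines of `l` have label `1`. -/
def onesOn (K : Type*) [Field K] (l : List ι) (s : ι → Bool) : K := if ∀ i ∈ l, s i then 1 else 0

/-- The partition function of the triangle formed by the lines of `l`, all of them starting
with label `0` and ending with label `1`. -/
def trianglePF (ω : K) (u : ι → K) (l : List ι) : K :=
  triangleOp ω u l (onesOn K l) fun _ => false

lemma rowOp_cons (ω : K) (u : ι → K) (i j : ι) (l : List ι) :
    rowOp ω u i (j :: l) = crossOp ω u i j * rowOp ω u i l := by
  simp [rowOp]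

lemma rowOp_append (ω : K) (u : ι → K) (i : ι) (l l' : List ι) :
    rowOp ω u i (l ++ l') = rowOp ω u i l * rowOp ω u i l' := by
  simp [rowOp]

lemma commute_rowOp {ω : K} {u : ι → K} {i : ι} {l : List ι}
    {X : Module.End K ((ι → Bool) → K)} (h : ∀ j ∈ l, Commute X (crossOp ω u i j)) :
    Commute X (rowOp ω u i l) := by
  apply Commute.list_prod_right
  simpa using h

lemma exchangeOp_mul_rowOp_rowOp {ω : K} (hω : ω ^ 2 + ω + 1 = 0) (hω1 : ω ≠ 1) (u : ι → K)
    {i j : ι} (hij : i ≠ j) {l : List ι} (hi : i ∉ l) (hj : j ∉ l) (hl : l.Nodup) :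
    exchangeOp ω u i j * (rowOp ω u i l * rowOp ω u j l) =
      rowOp ω u j l * rowOp ω u i l * exchangeOp ω u i j := by
  induction l with
  | nil => simp [rowOp]
  | cons k l ih =>
    simp only [List.mem_cons, not_or] at hi hj
    rw [List.nodup_cons] at hl
    have hk : ∀ m ∈ l, k ≠ m := fun m hm h => hl.1 (h ▸ hm)
    have hi' : ∀ m ∈ l, i ≠ m := fun m hm h => hi.2 (h ▸ hm)
    have hj' : ∀ m ∈ l, j ≠ m := fun m hm h => hj.2 (h ▸ hm)
    have c1 : Commute (crossOp ω u j k) (rowOp ω u i l) := commute_rowOp fun m hm =>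
      commute_crossOp_crossOp _ _ hij.symm (hj' m hm) (Ne.symm hi.1) (hk m hm)
    have c2 : Commute (crossOp ω u i k) (rowOp ω u j l) := commute_rowOp fun m hm =>
      commute_crossOp_crossOp _ _ hij (hi' m hm) (Ne.symm hj.1) (hk m hm)
    have yb := exchangeOp_yangBaxter hω hω1 u hij hi.1 hj.1
    have ih' := ih hi.2 hj.2 hl.2
    simp only [rowOp_cons]
    calc _ = exchangeOp ω u i j * (crossOp ω u i k * (rowOp ω u i l * crossOp ω u j k) *
          rowOp ω u j l) := by simp only [mul_assoc]
      _ = exchangeOp ω u i j * (crossOp ω u i k * crossOp ω u j k) *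
          (rowOp ω u i l * rowOp ω u j l) := by rw [← c1.eq]; simp only [mul_assoc]
      _ = crossOp ω u j k * crossOp ω u i k *
          (exchangeOp ω u i j * (rowOp ω u i l * rowOp ω u j l)) := by
        rw [yb]; simp only [mul_assoc]
      _ = crossOp ω u j k * (crossOp ω u i k * rowOp ω u j l) *
          (rowOp ω u i l * exchangeOp ω u i j) := by rw [ih']; simp only [mul_assoc]
      _ = _ := by rw [c2.eq]; simp only [mul_assoc]

lemma exchangeOp_mul_rowOp {ω : K} (hω : ω ^ 2 + ω + 1 = 0) (hω1 : ω ≠ 1) (u : ι → K)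
    {i j k : ι} {A B : List ι} (h : (k :: (A ++ i :: j :: B)).Nodup) :
    exchangeOp ω u i j * rowOp ω u k (A ++ i :: j :: B) =
      rowOp ω u k (A ++ j :: i :: B) * exchangeOp ω u i j := by
  have hA : ∀ a ∈ A, ¬a = i ∧ ¬a = j ∧ ∀ b ∈ B, ¬a = b := by
    simp only [List.nodup_cons, List.nodup_append, List.mem_cons, forall_eq_or_imp] at h
    exact h.2.2.2
  have hij : i ≠ j := by simp_all [List.nodup_append]
  have hik : i ≠ k := by rintro rfl; simp_all [List.nodup_append]
  have hjk : j ≠ k := by rintro rfl; simp_all [List.nodup_append]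
  have cA : Commute (exchangeOp ω u i j) (rowOp ω u k A) := commute_rowOp fun m hm =>
    commute_exchangeOp_crossOp _ _ hik (by rintro rfl; exact (hA _ hm).1 rfl)
      hjk (by rintro rfl; exact (hA _ hm).2.1 rfl)
  have cB : Commute (exchangeOp ω u i j) (rowOp ω u k B) := commute_rowOp fun m hm =>
    commute_exchangeOp_crossOp _ _ hik (by rintro rfl; simp_all [List.nodup_append])
      hjk (by rintro rfl; simp_all [List.nodup_append])
  have yb := exchangeOp_yangBaxter hω hω1 u hij hik hjk
  rw [crossOp_symm ω u i k, crossOp_symm ω u j k] at yb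
  simp only [rowOp_append, rowOp_cons]
  calc _ = exchangeOp ω u i j * rowOp ω u k A * (crossOp ω u k i * crossOp ω u k j) *
        rowOp ω u k B := by simp only [mul_assoc]
    _ = rowOp ω u k A * (exchangeOp ω u i j * (crossOp ω u k i * crossOp ω u k j)) *
        rowOp ω u k B := by rw [cA.eq]; simp only [mul_assoc]
    _ = rowOp ω u k A * (crossOp ω u k j * crossOp ω u k i) *
        (exchangeOp ω u i j * rowOp ω u k B) := by rw [yb]; simp only [mul_assoc]
    _ = _ := by rw [cB.eq]; simp only [mul_assoc]

lemma commute_exchangeOp_triangleOp (ω : K) (u : ι → K) {i j : ι} {l : List ι} (hi : i ∉ l)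
    (hj : j ∉ l) : Commute (exchangeOp ω u i j) (triangleOp ω u l) := by
  induction l with
  | nil => exact Commute.one_right _
  | cons k l ih =>
    simp only [List.mem_cons, not_or] at hi hj
    refine Commute.mul_right (commute_rowOp fun m hm => ?_) (ih hi.2 hj.2)
    exact commute_exchangeOp_crossOp _ _ hi.1 (by rintro rfl; exact hi.2 hm) hj.1
      (by rintro rfl; exact hj.2 hm)

lemma exchangeOp_mul_triangleOp {ω : K} (hω : ω ^ 2 + ω + 1 = 0) (hω1 : ω ≠ 1) (u : ι → K)
    {i j : ι} {A B : List ι} (h : (A ++ i :: j :: B).Nodup) :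
    exchangeOp ω u i j * triangleOp ω u (A ++ i :: j :: B) =
      triangleOp ω u (A ++ j :: i :: B) * exchangeOp ω u i j := by
  induction A with
  | nil =>
    simp only [List.nil_append, List.nodup_cons, List.mem_cons, not_or] at h
    simp only [List.nil_append, triangleOp, rowOp_cons]
    have hr := exchangeOp_mul_crossOp_same ω u h.1.1
    have hrow := exchangeOp_mul_rowOp_rowOp hω hω1 u h.1.1 h.1.2 h.2.1 h.2.2
    have hc := commute_exchangeOp_triangleOp ω u h.1.2 h.2.1
    rw [crossOp_symm ω u j i]
    calc _ = exchangeOp ω u i j * crossOp ω u i j * (rowOp ω u i B * rowOp ω u j B) *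
          triangleOp ω u B := by simp only [mul_assoc]
      _ = crossOp ω u i j * (exchangeOp ω u i j * (rowOp ω u i B * rowOp ω u j B)) *
          triangleOp ω u B := by rw [hr]; simp only [mul_assoc]
      _ = crossOp ω u i j * (rowOp ω u j B * rowOp ω u i B) *
          (exchangeOp ω u i j * triangleOp ω u B) := by rw [hrow]; simp only [mul_assoc]
      _ = _ := by rw [hc.eq]; simp only [mul_assoc]
  | cons k A ih =>
    rw [List.cons_append, triangleOp, ← mul_assoc, exchangeOp_mul_rowOp hω hω1 u h, mul_assoc,
      ih (List.nodup_cons.1 h).2, ← mul_assoc]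
    rfl

lemma onesOn_congr {ι K : Type*} [Field K] {l l' : List ι} (h : l.Perm l') :
    onesOn K l = onesOn K l' := by
  ext s
  simp [onesOn, h.mem_iff]

lemma trianglePF_swap {ω : K} (hω : ω ^ 2 + ω + 1 = 0) (hω1 : ω ≠ 1) (u : ι → K)
    {i j : ι} {A B : List ι} (h : (A ++ i :: j :: B).Nodup) (hu : ω * u i ≠ u j) :
    trianglePF ω u (A ++ i :: j :: B) = trianglePF ω u (A ++ j :: i :: B) := by
  have hij : i ≠ j := by simp_all [List.nodup_append]
  have key := congrFun (LinearMap.congr_fun (exchangeOp_mul_triangleOp hω hω1 u h)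
    (onesOn K (A ++ i :: j :: B))) fun _ => false
  have hones : exchangeOp ω u i j (onesOn K (A ++ i :: j :: B)) =
      (ω * u i - u j) • onesOn K (A ++ i :: j :: B) := by
    ext s
    simp only [exchangeOp_apply, Pi.smul_apply, smul_eq_mul]
    split_ifs with h1 h2
    · rfl
    all_goals
      have h3 : onesOn K (A ++ i :: j :: B) s = 0 :=
        if_neg fun h => h1 ((h i (by simp)).trans (h j (by simp)).symm)
      have h4 : onesOn K (A ++ i :: j :: B) (flipPair s i j) = 0 := by
        refine if_neg fun h => h1 ?_
        have e1 := h i (by simp)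
        have e2 := h j (by simp)
        rw [flipPair_left hij] at e1
        rw [flipPair_right] at e2
        rw [← Bool.not_inj_iff, e1, e2]
      rw [h3, h4]
      ring
  simp only [Module.End.mul_apply, hones, map_smul, Pi.smul_apply, smul_eq_mul] at key
  rw [exchangeOp_apply, if_pos rfl] at key
  rw [trianglePF, trianglePF, mul_left_cancel₀ (sub_ne_zero.2 hu) key]
  rw [onesOn_congr ((List.Perm.swap j i B).append_left A)]

lemma trianglePF_perm {ω : K} (hω : ω ^ 2 + ω + 1 = 0) (hω1 : ω ≠ 1) (u : ι → K)
    (A : List ι) {l l' : List ι} (h : l.Perm l') (hl : (A ++ l).Nodup)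
    (hu : ∀ i ∈ l, ∀ j ∈ l, ω * u i ≠ u j) :
    trianglePF ω u (A ++ l) = trianglePF ω u (A ++ l') := by
  induction h generalizing A with
  | nil => rfl
  | cons x _ ih =>
    rename_i l₁ l₂ _
    rw [List.append_cons A x l₁, List.append_cons A x l₂]
    exact ih _ (by simpa using hl) fun i hi j hj => hu _ (by simp [hi]) _ (by simp [hj])
  | swap x y l => exact trianglePF_swap hω hω1 u hl (hu _ (by simp) _ (by simp))
  | trans h1 _ ih1 ih2 =>
    rw [ih1 A hl hu, ih2 A ((h1.append_left A).nodup_iff.1 hl)]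
    intro i hi j hj
    exact hu i (h1.mem_iff.2 hi) j (h1.mem_iff.2 hj)

end Lattice

section Lattice

variable {ι K : Type*} [DecidableEq ι] [Field K]

lemma crossOp_rel {ι' : Type*} [DecidableEq ι'] {ω : K} {u : ι → K} {u' : ι' → K}
    {Rel : (ι → Bool) → (ι' → Bool) → Prop} {j k : ι} {j' k' : ι'}
    (hlab : ∀ s s', Rel s s' → s j = s' j' ∧ s k = s' k')
    (hflip : ∀ s s', Rel s s' → Rel (flipPair s j k) (flipPair s' j' k'))
    (huj : u j = u' j') (huk : u k = u' k')
    {f : (ι → Bool) → K} {g : (ι' → Bool) → K} (hfg : ∀ s s', Rel s s' → f s = g s')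
    (s : ι → Bool) (s' : ι' → Bool) (hs : Rel s s') :
    crossOp ω u j k f s = crossOp ω u' j' k' g s' := by
  simp only [crossOp_apply, hlab s s' hs, hfg s s' hs, hfg _ _ (hflip s s' hs), huj, huk]

lemma rowOp_rel {ι' : Type*} [DecidableEq ι'] (φ : ι → ι') {ω : K} {u : ι → K} {u' : ι' → K}
    {Rel : (ι → Bool) → (ι' → Bool) → Prop} {i : ι} {l : List ι}
    (hlab : ∀ s s', Rel s s' → ∀ j ∈ i :: l, s j = s' (φ j))
    (hflip : ∀ s s', Rel s s' → ∀ j ∈ i :: l, ∀ k ∈ i :: l,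
      Rel (flipPair s j k) (flipPair s' (φ j) (φ k)))
    (hu : ∀ j ∈ i :: l, u j = u' (φ j))
    {f : (ι → Bool) → K} {g : (ι' → Bool) → K} (hfg : ∀ s s', Rel s s' → f s = g s') :
    ∀ s s', Rel s s' → rowOp ω u i l f s = rowOp ω u' (φ i) (l.map φ) g s' := by
  induction l with
  | nil => simpa [rowOp] using hfg
  | cons k l ih =>
    rw [List.map_cons, rowOp_cons, rowOp_cons]
    refine crossOp_rel (fun s s' h => ⟨?_, ?_⟩) (fun s s' h => ?_) ?_ ?_ (ih ?_ ?_ ?_)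
    · exact hlab s s' h i (by simp)
    · exact hlab s s' h k (by simp)
    · exact hflip s s' h i (by simp) k (by simp)
    · exact hu i (by simp)
    · exact hu k (by simp)
    · exact fun s s' h j hj => hlab s s' h j (by simp at hj ⊢; tauto)
    · exact fun s s' h j hj k hk => hflip s s' h j (by simp at hj ⊢; tauto) k
        (by simp at hk ⊢; tauto)
    · exact fun j hj => hu j (by simp at hj ⊢; tauto)

lemma triangleOp_rel {ι' : Type*} [DecidableEq ι'] (φ : ι → ι') {ω : K} {u : ι → K}
    {u' : ι' → K} {Rel : (ι → Bool) → (ι' → Bool) → Prop} {l : List ι}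
    (hlab : ∀ s s', Rel s s' → ∀ j ∈ l, s j = s' (φ j))
    (hflip : ∀ s s', Rel s s' → ∀ j ∈ l, ∀ k ∈ l,
      Rel (flipPair s j k) (flipPair s' (φ j) (φ k)))
    (hu : ∀ j ∈ l, u j = u' (φ j))
    {f : (ι → Bool) → K} {g : (ι' → Bool) → K} (hfg : ∀ s s', Rel s s' → f s = g s') :
    ∀ s s', Rel s s' → triangleOp ω u l f s = triangleOp ω u' (l.map φ) g s' := by
  induction l with
  | nil => simpa [triangleOp] using hfg
  | cons i l ih =>
    refine rowOp_rel φ hlab hflip hu (ih ?_ ?_ ?_)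
    · exact fun s s' h j hj => hlab s s' h j (by simp [hj])
    · exact fun s s' h j hj k hk => hflip s s' h j (by simp [hj]) k (by simp [hk])
    · exact fun j hj => hu j (by simp [hj])

lemma trianglePF_map {ι' : Type*} [DecidableEq ι'] {φ : ι → ι'} (hφ : Function.Injective φ)
    (ω : K) (u : ι' → K) (l : List ι) :
    trianglePF ω u (l.map φ) = trianglePF ω (u ∘ φ) l := by
  refine (triangleOp_rel φ (Rel := fun s s' => ∀ j ∈ l, s j = s' (φ j)) (fun s s' h => h) ?_
    (fun _ _ => rfl) ?_ _ _ fun _ _ => rfl).symm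
  · intro s s' h j hj k hk m hm
    simp only [flipPair, Function.update_apply, hφ.eq_iff, h j hj, h k hk, h m hm]
  · intro s s' h
    simp only [onesOn, List.forall_mem_map]
    congr 1
    exact propext (forall₂_congr fun j hj => by rw [h j hj])

lemma rowOp_of_true (ω : K) (u : ι → K) {i : ι} {l : List ι} {s : ι → Bool}
    (hi : s i = true) (hl : ∀ j ∈ l, s j = false) (f : (ι → Bool) → K) :
    rowOp ω u i l f s = (l.map fun j => (ω - u i * u j) * (ω - 1)⁻¹).prod * f s := by
  induction l with
  | nil => simp [rowOp]
  | cons j l ih =>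
    have hj := hl j (by simp)
    rw [rowOp_cons, Module.End.mul_apply, crossOp_apply, if_neg (by simp [hi, hj]),
      ih fun k hk => hl k (by simp [hk])]
    simp [mul_assoc]

lemma triangleOp_onesOn_eq_zero (ω : K) (u : ι → K) {i : ι} {l : List ι} (hi : i ∉ l)
    {s : ι → Bool} (hs : s i = false) : triangleOp ω u l (onesOn K (i :: l)) s = 0 := by
  have h := triangleOp_rel (u := u) (u' := u) (ω := ω) (l := l) id
    (Rel := fun s s' => s = s' ∧ s i = false)
    (f := onesOn K (i :: l)) (g := 0) (fun s s' h j hj => by rw [h.1]; rfl)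
    (fun s s' h j hj k hk => ⟨by rw [h.1]; rfl, ?_⟩) (fun _ _ => rfl)
    (fun s s' h => if_neg fun h' => by simp [h.2] at h') s s ⟨rfl, hs⟩
  · simpa using h
  · rw [flipPair_of_ne (by rintro rfl; exact hi hj) (by rintro rfl; exact hi hk), h.2]

lemma triangleOp_congr {ω : K} {u u' : ι → K} {l : List ι} (h : ∀ i ∈ l, u i = u' i) :
    triangleOp ω u l = triangleOp ω u' l := by
  ext f s
  simpa using triangleOp_rel (ω := ω) id (Rel := Eq) (fun s s' h j hj => by rw [h]; rfl)
    (fun s s' h j hj k hk => by rw [h]; rfl) h (f := f) (g := f) (fun s s' h => by rw [h]) s s rfl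

lemma trianglePF_of_mul_eq_one {ω : K} {u : ι → K} {i j : ι} {l : List ι}
    (hl : (i :: j :: l).Nodup) (h : ω * (u i * u j) = 1) :
    trianglePF ω u (i :: j :: l) =
      (l.map fun k => (ω - u i * u k) * (ω - 1)⁻¹).prod *
      (l.map fun k => (ω - u j * u k) * (ω - 1)⁻¹).prod * trianglePF ω u l := by
  simp only [List.nodup_cons, List.mem_cons, not_or] at hl
  obtain ⟨⟨hij, hil⟩, hjl, hl⟩ := hl
  set s : ι → Bool := flipPair (fun _ => false) i j with hs
  have si : s i = true := by simp [hs, flipPair_left hij]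
  have sj : s j = true := by simp [hs, flipPair_right]
  have sl : ∀ k ∈ l, s k = false := fun k hk => by
    rw [hs, flipPair_of_ne (by rintro rfl; exact hil hk) (by rintro rfl; exact hjl hk)]
  rw [trianglePF, triangleOp, rowOp_cons, Module.End.mul_apply, Module.End.mul_apply,
    crossOp_apply, if_pos rfl, h, sub_self, zero_mul, zero_mul, zero_add, ← hs,
    rowOp_of_true ω u si sl, triangleOp, Module.End.mul_apply, rowOp_of_true ω u sj sl]
  simp only [Bool.false_eq_true, if_false, one_mul, mul_assoc]
  congr 2
  have key := triangleOp_rel (u := u) (u' := u) (ω := ω) (l := l) id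
    (Rel := fun s s' => s i = true ∧ s j = true ∧ ∀ k ∈ l, s k = s' k)
    (f := onesOn K (i :: j :: l)) (g := onesOn K l) (fun s s' h k hk => h.2.2 k hk)
    (fun s s' h k hk m hm => ⟨?_, ?_, fun t ht => ?_⟩) (fun _ _ => rfl)
    (fun s s' h => ?_) s (fun _ => false) ⟨si, sj, sl⟩
  · rw [List.map_id] at key
    exact key
  · rw [flipPair_of_ne (by rintro rfl; exact hil hk) (by rintro rfl; exact hil hm), h.1]
  · rw [flipPair_of_ne (by rintro rfl; exact hjl hk) (by rintro rfl; exact hjl hm), h.2.1]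
  · simp only [flipPair, Function.update_apply, id, h.2.2 k hk, h.2.2 m hm, h.2.2 t ht]
  · simp only [onesOn, List.forall_mem_cons, h.1, h.2.1, true_and]
    congr 1
    exact propext (forall₂_congr fun k hk => by rw [h.2.2 k hk])

open Polynomial in
lemma degree_list_prod_map_le {α R : Type*} [CommSemiring R] (l : List α) (g : α → R[X])
    (hg : ∀ k, (g k).degree ≤ (1 : ℕ)) : (l.map g).prod.degree ≤ (l.length : WithBot ℕ) := by
  induction l with
  | nil => simp
  | cons k l ih =>
    rw [List.map_cons, List.prod_cons, List.length_cons, Nat.cast_add, add_comm]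
    exact (degree_mul_le _ _).trans (add_le_add (hg k) ih)

open Polynomial in
lemma exists_polynomial_rowOp (ω : K) (u : ι → K) {i : ι} {l : List ι} (hl : l.Nodup)
    (hi : i ∉ l) {f : (ι → Bool) → K} (hf : ∀ s, s i = false → f s = 0) {s : ι → Bool}
    (hs : s i = false) (hsl : ∀ j ∈ l, s j = false) :
    ∃ p : K[X], p.degree < l.length ∧
      ∀ x, rowOp ω (Function.update u i x) i l f s = p.eval x := by
  induction l with
  | nil => exact ⟨0, by simp, fun x => by simp [rowOp, hf s hs]⟩
  | cons j l ih =>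
    simp only [List.mem_cons, not_or] at hi
    rw [List.nodup_cons] at hl
    obtain ⟨p, hp, hpe⟩ := ih hl.2 hi.2 fun k hk => hsl k (by simp [hk])
    set t := flipPair s i j with ht
    have ti : t i = true := by rw [ht, flipPair_left hi.1, hs]; rfl
    have tl : ∀ k ∈ l, t k = false := fun k hk => by
      rw [ht, flipPair_of_ne (by rintro rfl; exact hi.2 hk) (by rintro rfl; exact hl.1 hk),
        hsl k (by simp [hk])]
    refine ⟨C (ω - 1)⁻¹ * (C (ω * u j) * X - 1) * p +
      (l.map fun k => C (ω - 1)⁻¹ * (C ω - C (u k) * X)).prod * C (f t), ?_, fun x => ?_⟩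
    · have h1 : (C (ω - 1)⁻¹ * (C (ω * u j) * X - 1) : K[X]).degree ≤ (1 : ℕ) :=
        degree_le_of_natDegree_le (by compute_degree)
      have h2 := degree_list_prod_map_le l (fun k => C (ω - 1)⁻¹ * (C ω - C (u k) * X))
        fun k => degree_le_of_natDegree_le (by compute_degree)
      have h3 : (l.length : WithBot ℕ) < ((j :: l).length : ℕ) := by
        rw [List.length_cons]
        exact_mod_cast Nat.lt_succ_self _
      refine (degree_add_le _ _).trans_lt (max_lt ?_ ?_)
      · by_cases hp0 : p = 0
        · simp [hp0]
        · refine (degree_mul_le _ _).trans_lt ?_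
          rw [degree_eq_natDegree hp0] at hp ⊢
          rw [List.length_cons, Nat.cast_add, Nat.cast_one, add_comm (l.length : WithBot ℕ)]
          refine (add_le_add h1 le_rfl).trans_lt ?_
          norm_cast at hp ⊢
          omega
      · rw [mul_comm]
        refine ((degree_mul_le _ _).trans (add_le_add degree_C_le h2)).trans_lt ?_
        rwa [zero_add]
    · rw [rowOp_cons, Module.End.mul_apply, crossOp_apply, if_pos (by rw [hs, hsl j (by simp)]),
        hpe, ← ht, rowOp_of_true _ _ ti tl, Function.update_self,
        Function.update_of_ne (Ne.symm hi.1), hs]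
      have : (l.map fun k => C (ω - 1)⁻¹ * (C ω - C (u k) * X)).prod.eval x =
          (l.map fun k => (ω - x * Function.update u i x k) * (ω - 1)⁻¹).prod := by
        rw [Polynomial.eval_list_prod, List.map_map]
        congr 1
        refine List.map_congr_left fun k hk => ?_
        rw [Function.update_of_ne (by rintro rfl; exact hi.2 hk)]
        simp
        ring
      rw [eval_add, eval_mul, eval_mul, eval_mul, this]
      simp only [eval_C, eval_sub, eval_mul, eval_X, eval_one, Bool.false_eq_true, if_false]
      ring

open Polynomial in
lemma exists_polynomial_trianglePF (ω : K) (u : ι → K) {i : ι} {l : List ι}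
    (hl : (i :: l).Nodup) : ∃ p : K[X], p.degree < l.length ∧
      ∀ x, trianglePF ω (Function.update u i x) (i :: l) = p.eval x := by
  rw [List.nodup_cons] at hl
  obtain ⟨p, hp, hpe⟩ := exists_polynomial_rowOp ω u hl.2 hl.1
    (f := triangleOp ω u l (onesOn K (i :: l)))
    (fun s hs => triangleOp_onesOn_eq_zero ω u hl.1 hs) (s := fun _ => false) rfl
    (fun _ _ => rfl)
  refine ⟨p, hp, fun x => ?_⟩
  rw [← hpe, trianglePF, triangleOp, Module.End.mul_apply]
  rw [triangleOp_congr (u := Function.update u i x) (u' := u)]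
  exact fun j hj => Function.update_of_ne (by rintro rfl; exact hl.1 hj) _ _

/-- The partition function of the triangle with spectral parameters `v`. -/
def offDiagPF (ω : K) {N : ℕ} (v : Fin N → K) : K := trianglePF ω v (List.finRange N)

lemma offDiagPF_comp_perm {ω : K} (hω : ω ^ 2 + ω + 1 = 0) (hω1 : ω ≠ 1) {N : ℕ} (x : K)
    (w : Fin N → K) (hw : ∀ i j, ω * w i ≠ w j) (σ : Equiv.Perm (Fin N)) :
    offDiagPF ω (Fin.cons x (w ∘ σ) : Fin (N + 1) → K) =
      offDiagPF ω (Fin.cons x w : Fin (N + 1) → K) := by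
  let φ : Fin (N + 1) → Fin (N + 1) := Fin.cons 0 (Fin.succ ∘ σ)
  have hφ : Function.Injective φ := Fin.cons_injective_iff.2
    ⟨by simp, (Fin.succ_injective N).comp σ.injective⟩
  have hcomp : (Fin.cons x (w ∘ σ) : Fin (N + 1) → K) = (Fin.cons x w : Fin (N + 1) → K) ∘ φ := by
    ext i
    refine Fin.cases ?_ (fun i => ?_) i <;> simp [φ]
  rw [offDiagPF, hcomp, ← trianglePF_map hφ, offDiagPF, List.finRange_succ, List.map_cons,
    List.map_map]
  have hperm : ((List.finRange N).map Fin.succ).Perm ((List.finRange N).map (φ ∘ Fin.succ)) := by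
    have : φ ∘ Fin.succ = Fin.succ ∘ σ := by ext i; simp [φ]
    rw [this, ← List.map_map]
    exact (Equiv.Perm.map_finRange_perm σ).symm.map _
  refine (trianglePF_perm hω hω1 _ [0] hperm ?_ ?_).symm
  · have := List.nodup_finRange (N + 1)
    rwa [List.finRange_succ] at this
  · simp only [List.mem_map, List.mem_finRange, true_and, forall_exists_index,
      forall_apply_eq_imp_iff, Fin.cons_succ]
    exact hw

lemma offDiagPF_of_mul_eq_one {ω : K} {N : ℕ} {x y : K} (h : ω * (x * y) = 1) (w : Fin N → K) :
    offDiagPF ω (Fin.cons x (Fin.cons y w : Fin (N + 1) → K) : Fin (N + 2) → K) =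
      (∏ k, (ω - x * w k) * (ω - 1)⁻¹) * (∏ k, (ω - y * w k) * (ω - 1)⁻¹) * offDiagPF ω w := by
  have hfin : List.finRange (N + 2) =
      0 :: 1 :: (List.finRange N).map (Fin.succ ∘ Fin.succ) := by
    rw [List.finRange_succ, List.finRange_succ, List.map_cons, List.map_map]
    rfl
  have hnd := List.nodup_finRange (N + 2)
  rw [hfin] at hnd
  rw [offDiagPF, hfin, trianglePF_of_mul_eq_one hnd (by simpa using h), trianglePF_map
    ((Fin.succ_injective _).comp (Fin.succ_injective _)), List.map_map, List.map_map,
    ← List.ofFn_eq_map, ← List.ofFn_eq_map, List.prod_ofFn, List.prod_ofFn]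
  rfl

open Polynomial in
lemma exists_polynomial_offDiagPF (ω : K) {N : ℕ} (w : Fin N → K) : ∃ p : K[X],
    p.degree < N ∧ ∀ x, offDiagPF ω (Fin.cons x w : Fin (N + 1) → K) = p.eval x := by
  have hnd := List.nodup_finRange (N + 1)
  rw [List.finRange_succ] at hnd
  obtain ⟨p, hp, hpe⟩ := exists_polynomial_trianglePF ω (Fin.cons 0 w : Fin (N + 1) → K) hnd
  refine ⟨p, by simpa using hp, fun x => ?_⟩
  rw [← hpe, offDiagPF, List.finRange_succ]
  congr 1
  rw [Fin.update_cons_zero]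

end Lattice

section Determinants

variable {K : Type*} [Field K]

/-- The odd Laurent polynomial `x ^ a - x ^ (-a)`. -/
def oddPow (x : K) (a : ℕ) : K := x ^ a - x⁻¹ ^ a

/-- The `k`-th positive integer that is not divisible by `3`. -/
def nonMultipleThree (k : ℕ) : ℕ := 3 * (k / 2) + k % 2 + 1

/-- The matrix whose determinant is the numerator of the symplectic character at a cube root
of unity. -/
def oddPowMatrix {N : ℕ} (v : Fin N → K) : Matrix (Fin N) (Fin N) K :=
  Matrix.of fun i k => oddPow (v i) (nonMultipleThree k)

/-- The Weyl denominator of the symplectic group. -/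
def weylDenom {N : ℕ} (v : Fin N → K) : K :=
  (∏ i, (v i - (v i)⁻¹)) * (Matrix.vandermonde fun i => v i + (v i)⁻¹).det

lemma oddPow_inv (x : K) (a : ℕ) : oddPow x⁻¹ a = -oddPow x a := by
  simp [oddPow]

lemma nonMultipleThree_add_two (k : ℕ) : nonMultipleThree (k + 2) = nonMultipleThree k + 3 := by
  simp only [nonMultipleThree]
  omega

lemma oddPow_add_three_add {x : K} (hx : x ≠ 0) (a : ℕ) :
    oddPow x (a + 6) + oddPow x a = oddPow x (a + 3) * (x ^ 3 + x⁻¹ ^ 3) := by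
  simp only [oddPow, pow_add, inv_pow]
  field_simp
  ring

lemma oddPow_four {x : K} (hx : x ≠ 0) :
    oddPow x 4 - oddPow x 2 = oddPow x 1 * (x ^ 3 + x⁻¹ ^ 3) := by
  simp only [oddPow]
  field_simp
  ring

lemma oddPow_five {x : K} (hx : x ≠ 0) :
    oddPow x 5 - oddPow x 1 = oddPow x 2 * (x ^ 3 + x⁻¹ ^ 3) := by
  simp only [oddPow]
  field_simp
  ring

lemma det_eq_of_col_add_lt {N : ℕ} {M M' : Matrix (Fin N) (Fin N) K} (c : Fin N → Fin N → K)
    (hc : ∀ j k, k ≤ j → c j k = 0) (h : ∀ i k, M' i k = M i k + ∑ j, M i j * c j k) :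
    M'.det = M.det := by
  have hM : M' = M * (1 + Matrix.of c) := by
    ext i k
    rw [Matrix.mul_add, Matrix.mul_one, Matrix.add_apply, Matrix.mul_apply, h]
    rfl
  have hU : (1 + Matrix.of c).det = 1 := by
    rw [Matrix.det_of_isUpperTriangular]
    · simp [hc]
    · intro i j hij
      have hij' : j < i := hij
      simp [hc i j hij'.le, hij'.ne']
  rw [hM, Matrix.det_mul, hU, mul_one]

/-- The block decomposition of an index type into the first two elements and the others. -/
def finTwoSum (N : ℕ) : Fin 2 ⊕ Fin N ≃ Fin (N + 2) :=
  finSumFinEquiv.trans (finCongr (Nat.add_comm 2 N))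

lemma det_oddPowMatrix_cons_cons {N : ℕ} {x y : K} (hx : x ≠ 0) (hy : y ≠ 0)
    (hxy : x ^ 3 + x⁻¹ ^ 3 = y ^ 3 + y⁻¹ ^ 3) {w : Fin N → K} (hw : ∀ k, w k ≠ 0) :
    (oddPowMatrix (Fin.cons x (Fin.cons y w : Fin (N + 1) → K) : Fin (N + 2) → K)).det =
      (oddPow x 1 * oddPow y 2 - oddPow x 2 * oddPow y 1) *
        (∏ k, (w k ^ 3 + (w k)⁻¹ ^ 3 - (y ^ 3 + y⁻¹ ^ 3))) * (oddPowMatrix w).det := by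
  set v : Fin (N + 2) → K := Fin.cons x (Fin.cons y w : Fin (N + 1) → K) with hv
  set s := y ^ 3 + y⁻¹ ^ 3 with hs
  have hv0 : ∀ i, v i ≠ 0 := by
    rw [hv]
    refine Fin.cases hx (Fin.cases hy hw)
  let g : K → ℕ → K := fun z k => match k with
    | 0 => oddPow z 1
    | 1 => oddPow z 2
    | k + 2 => oddPow z (nonMultipleThree k) * (z ^ 3 + z⁻¹ ^ 3 - s)
  let c : ℕ → ℕ → K := fun j k => (if j + 2 = k then -s else 0) +
    (if k = 2 ∧ j = 1 ∨ k = 3 ∧ j = 0 then -1 else 0) + (if j + 4 = k then 1 else 0)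
  have hdet : (Matrix.of fun i k : Fin (N + 2) => g (v i) k).det = (oddPowMatrix v).det := by
    refine det_eq_of_col_add_lt (fun j k => c j k) (fun j k hjk => ?_) (fun i k => ?_)
    · have : (k : ℕ) ≤ j := hjk
      simp only [c]
      rw [if_neg (by omega), if_neg (by omega), if_neg (by omega)]
      simp
    · have hvi := hv0 i
      simp only [oddPowMatrix, Matrix.of_apply]
      rw [Fin.sum_univ_eq_sum_range (fun j => oddPow (v i) (nonMultipleThree j) * c j k)]
      generalize v i = z at hvi
      obtain ⟨k, hk⟩ := k
      match k with
      | 0 => simp [g, c, nonMultipleThree]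
      | 1 => simp [g, c, nonMultipleThree]
      | 2 =>
        have hz := oddPow_four hvi
        have hc : ∀ j, c j 2 = (if j = 0 then -s else 0) + (if j = 1 then -1 else 0) := by
          intro j
          simp [c]
        simp only [hc, mul_add, Finset.sum_add_distrib, mul_ite, mul_zero, Finset.sum_ite_eq',
          Finset.mem_range]
        rw [if_pos (by omega), if_pos (by omega)]
        simp only [g, nonMultipleThree, Nat.reduceDiv, Nat.reduceMod, Nat.reduceMul,
          Nat.reduceAdd]
        linear_combination -hz
      | 3 =>
        have hz := oddPow_five hvi
        have hc : ∀ j, c j 3 = (if j = 1 then -s else 0) + (if j = 0 then -1 else 0) := by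
          intro j
          simp [c]
        simp only [hc, mul_add, Finset.sum_add_distrib, mul_ite, mul_zero, Finset.sum_ite_eq',
          Finset.mem_range]
        rw [if_pos (by omega), if_pos (by omega)]
        simp only [g, nonMultipleThree, Nat.reduceDiv, Nat.reduceMod, Nat.reduceMul,
          Nat.reduceAdd]
        linear_combination -hz
      | m + 4 =>
        have hz := oddPow_add_three_add hvi (nonMultipleThree m)
        have hc : ∀ j, c j (m + 4) = (if j = m + 2 then -s else 0) +
            (if j = m then 1 else 0) := by
          intro j
          simp [c]
        simp only [hc, mul_add, Finset.sum_add_distrib, mul_ite, mul_zero, Finset.sum_ite_eq',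
          Finset.mem_range]
        rw [if_pos (by omega), if_pos (by omega)]
        have h2 := nonMultipleThree_add_two m
        have h4 : nonMultipleThree (m + 4) = nonMultipleThree m + 6 := by
          rw [nonMultipleThree_add_two (m + 2), h2]
        simp only [g, h2, h4]
        linear_combination -hz
  rw [← hdet, ← Matrix.det_submatrix_equiv_self (finTwoSum N)]
  have hblock : (Matrix.of fun i k : Fin (N + 2) => g (v i) k).submatrix (finTwoSum N)
      (finTwoSum N) = Matrix.fromBlocks !![oddPow x 1, oddPow x 2; oddPow y 1, oddPow y 2] 0
        (Matrix.of fun i k => g (w i) k)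
        (Matrix.of fun i k => (w i ^ 3 + (w i)⁻¹ ^ 3 - s) * oddPowMatrix w i k) := by
    have e0 : finTwoSum N (Sum.inl 0) = 0 := rfl
    have e1 : finTwoSum N (Sum.inl 1) = 1 := by ext; simp [finTwoSum]
    have e2 : ∀ k, finTwoSum N (Sum.inr k) = k.succ.succ := fun k => by
      ext
      simp [finTwoSum]
    have v1 : v 1 = y := rfl
    ext (i | i) (k | k)
    · fin_cases i <;> fin_cases k <;> simp [e0, e1, g, hv]
    · fin_cases i
      · simp [e0, e2, g, hv, -inv_pow, hxy]
      · simp [e1, e2, g, hv, -inv_pow, ← hs]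
    · fin_cases k <;> simp [e0, e1, e2, g, hv]
    · simp [e2, g, hv, oddPowMatrix, mul_comm]
  rw [hblock, Matrix.det_fromBlocks_zero₁₂, Matrix.det_fin_two_of, Matrix.det_mul_column]
  ring

lemma weylDenom_cons {N : ℕ} (z : K) (w : Fin N → K) :
    weylDenom (Fin.cons z w : Fin (N + 1) → K) =
      (z - z⁻¹) * (∏ k, (w k + (w k)⁻¹ - (z + z⁻¹))) * weylDenom w := by
  simp only [weylDenom, Matrix.det_vandermonde, Fin.prod_univ_succ, Fin.cons_zero, Fin.cons_succ,
    Fin.prod_Ioi_zero, Fin.prod_Ioi_succ]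
  ring

lemma weylDenom_comp_perm {N : ℕ} (v : Fin N → K) (σ : Equiv.Perm (Fin N)) :
    weylDenom (v ∘ σ) = (Equiv.Perm.sign σ : K) * weylDenom v := by
  have h : (Matrix.vandermonde fun i => (v ∘ σ) i + ((v ∘ σ) i)⁻¹) =
      (Matrix.vandermonde fun i => v i + (v i)⁻¹).submatrix σ id := rfl
  rw [weylDenom, h, Matrix.det_permute, weylDenom,
    ← Equiv.prod_comp σ fun i => v i - (v i)⁻¹]
  simp only [Function.comp]
  ring

lemma det_oddPowMatrix_comp_perm {N : ℕ} (v : Fin N → K) (σ : Equiv.Perm (Fin N)) :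
    (oddPowMatrix (v ∘ σ)).det = (Equiv.Perm.sign σ : K) * (oddPowMatrix v).det := by
  have h : oddPowMatrix (v ∘ σ) = (oddPowMatrix v).submatrix σ id := rfl
  rw [h, Matrix.det_permute]

lemma exists_det_oddPowMatrix_cons {N : ℕ} (w : Fin N → K) : ∃ γ : Fin (N + 1) → K, ∀ z,
    (oddPowMatrix (Fin.cons z w : Fin (N + 1) → K)).det =
      ∑ k : Fin (N + 1), oddPow z (nonMultipleThree k) * γ k := by
  refine ⟨fun k => (-1) ^ (k : ℕ) *
    ((oddPowMatrix (Fin.cons 0 w : Fin (N + 1) → K)).submatrix Fin.succ k.succAbove).det,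
    fun z => ?_⟩
  rw [Matrix.det_succ_row_zero]
  refine Finset.sum_congr rfl fun k _ => ?_
  have h : (oddPowMatrix (Fin.cons z w : Fin (N + 1) → K)).submatrix Fin.succ k.succAbove =
      (oddPowMatrix (Fin.cons 0 w : Fin (N + 1) → K)).submatrix Fin.succ k.succAbove := by
    ext i j
    simp [oddPowMatrix]
  rw [h]
  simp only [oddPowMatrix, Matrix.of_apply, Fin.cons_zero]
  ring

end Determinants

section Identity

variable {K : Type*} [Field K]

lemma crossWeight_mul_weylFactor {ω y z w : K} (hω : ω ^ 2 + ω + 1 = 0) (hω1 : ω ≠ 1)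
    (h3 : (3 : K) ≠ 0) (hw : w ≠ 0) (hzy : ω * (z * y) = 1) :
    (ω - z * w) * (ω - 1)⁻¹ * ((ω - y * w) * (ω - 1)⁻¹) * ((w + w⁻¹ - (z + z⁻¹)) *
      (w + w⁻¹ - (y + y⁻¹))) = -(ω / 3) * w * (w ^ 3 + w⁻¹ ^ 3 - (y ^ 3 + y⁻¹ ^ 3)) := by
  have hω3 : ω ^ 3 = 1 := by linear_combination (ω - 1) * hω
  have hy : y ≠ 0 := by rintro rfl; simp at hzy
  obtain ⟨i, hi⟩ : ∃ i, i = y⁻¹ := ⟨_, rfl⟩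
  obtain ⟨t, ht⟩ : ∃ t, t = w⁻¹ := ⟨_, rfl⟩
  have hyi : y * i = 1 := by rw [hi, mul_inv_cancel₀ hy]
  have hwt : w * t = 1 := by rw [ht, mul_inv_cancel₀ hw]
  have hz : z = ω ^ 2 * i := by
    linear_combination ω ^ 2 * i * hzy - z * i * y * hω3 - z * hyi
  have hz' : z⁻¹ = ω * y := by
    refine inv_eq_of_mul_eq_one_right ?_
    linear_combination hzy
  have h1 : (ω - 1)⁻¹ * (ω - 1)⁻¹ = -ω ^ 2 / 3 := by
    have : ω - 1 ≠ 0 := sub_ne_zero.2 hω1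
    field_simp
    linear_combination (ω ^ 2 - 3 * ω + 3) * hω
  have hsum : (z + z⁻¹) + (ω ^ 2 * y + ω * i) = -(y + i) := by
    rw [hz', hz]
    linear_combination (y + i) * hω
  have hprod : (z + z⁻¹) * (ω ^ 2 * y + ω * i) = (y + i) ^ 2 - 3 := by
    rw [hz', hz]
    linear_combination (ω * y * i + y ^ 2 + i ^ 2) * hω3 + hω + (ω ^ 2 + ω - 2) * hyi
  have hcross : (ω - z * w) * (ω - y * w) * ω = w * (w + t - (ω ^ 2 * y + ω * i)) := by
    rw [hz]
    linear_combination (1 - i * w * ω + w ^ 2 * (y * i)) * hω3 + w ^ 2 * hyi - hwt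
  have hcubic : (w + t - (z + z⁻¹)) * (w + t - (y + i)) * (w + t - (ω ^ 2 * y + ω * i)) =
      w ^ 3 + t ^ 3 - (y ^ 3 + i ^ 3) := by
    linear_combination (w + t - (y + i)) * (hprod - (w + t) * hsum) +
      3 * (w + t) * hwt - 3 * (y + i) * hyi
  rw [← ht, ← hi]
  linear_combination ((ω - z * w) * (ω - y * w) * ((w + t - (z + z⁻¹)) *
    (w + t - (y + i)))) * h1 - ω / 3 * ((w + t - (z + z⁻¹)) * (w + t - (y + i))) * hcross
    - ω / 3 * w * hcubic

lemma offDiagPF_mul_weylDenom_of_mul_eq_one {ω y z : K} (hω : ω ^ 2 + ω + 1 = 0) (hω1 : ω ≠ 1)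
    (h3 : (3 : K) ≠ 0) (hzy : ω * (z * y) = 1) {n : ℕ} {w : Fin (2 * n) → K}
    (hw : ∀ k, w k ≠ 0)
    (ih : 3 ^ (n * (n - 1)) * (offDiagPF ω w * weylDenom w * ∏ k, w k) =
      (∏ k, w k) ^ n * (oddPowMatrix w).det) :
    3 ^ (n * (n + 1)) * (offDiagPF ω (Fin.cons z (Fin.cons y w : Fin (2 * n + 1) → K) :
      Fin (2 * n + 2) → K) * weylDenom (Fin.cons z (Fin.cons y w : Fin (2 * n + 1) → K) :
      Fin (2 * n + 2) → K) * (z * (y * ∏ k, w k))) =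
      (z * (y * ∏ k, w k)) ^ (n + 1) *
        (oddPowMatrix (Fin.cons z (Fin.cons y w : Fin (2 * n + 1) → K) :
          Fin (2 * n + 2) → K)).det := by
  have hω3 : ω ^ 3 = 1 := by linear_combination (ω - 1) * hω
  have hz : z ≠ 0 := by rintro rfl; simp at hzy
  have hy : y ≠ 0 := by rintro rfl; simp at hzy
  have hzy' : z * y = ω ^ 2 := by linear_combination ω ^ 2 * hzy - z * y * hω3
  have hz3 : z ^ 3 = y⁻¹ ^ 3 := by
    rw [inv_pow]
    refine eq_inv_of_mul_eq_one_left ?_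
    rw [← mul_pow, hzy']
    linear_combination (ω ^ 3 + 1) * hω3
  have hcube : z ^ 3 + z⁻¹ ^ 3 = y ^ 3 + y⁻¹ ^ 3 := by
    rw [inv_pow, hz3, inv_pow, inv_inv, add_comm]
  have hodd : oddPow z 1 * oddPow y 2 - oddPow z 2 * oddPow y 1 =
      (z - z⁻¹) * (y - y⁻¹) * (y + y⁻¹ - (z + z⁻¹)) := by
    simp only [oddPow]
    ring
  have hfac := Finset.prod_congr (rfl : (univ : Finset (Fin (2 * n))) = univ)
    fun k _ => crossWeight_mul_weylFactor hω hω1 h3 (hw k) hzy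
  simp only [Finset.prod_mul_distrib, Finset.prod_const, Finset.card_univ, Fintype.card_fin] at hfac
  have h3pow : (3 : K) ^ (n * (n + 1)) = 3 ^ (n * (n - 1)) * 3 ^ (2 * n) := by
    rw [← pow_add]
    congr 1
    cases n with
    | zero => rfl
    | succ m => simp only [Nat.add_sub_cancel]; ring
  have hconst : (3 : K) ^ (2 * n) * (-(ω / 3)) ^ (2 * n) = (z * y) ^ n := by
    rw [← mul_pow, hzy', pow_mul]
    congr 1
    field_simp
  rw [offDiagPF_of_mul_eq_one hzy, weylDenom_cons, weylDenom_cons,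
    det_oddPowMatrix_cons_cons hz hy hcube hw, hodd, Fin.prod_univ_succ, h3pow]
  simp only [Fin.cons_zero, Fin.cons_succ, Finset.prod_mul_distrib]
  generalize (∏ k, w k) = P at *
  generalize (oddPowMatrix w).det = D at *
  generalize (∏ k, (w k ^ 3 + (w k)⁻¹ ^ 3 - (y ^ 3 + y⁻¹ ^ 3))) = Q at *
  generalize (3 : K) ^ (n * (n - 1)) = c at *
  generalize (3 : K) ^ (2 * n) = d at *
  generalize (-(ω / 3)) ^ (2 * n) = e at *
  have key : c * d * (((∏ k, (ω - z * w k)) * (∏ k : Fin (2 * n), (ω - 1)⁻¹) *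
      ((∏ k, (ω - y * w k)) *
      (∏ k : Fin (2 * n), (ω - 1)⁻¹)) * ((∏ k, (w k + (w k)⁻¹ - (z + z⁻¹))) *
      (∏ k, (w k + (w k)⁻¹ - (y + y⁻¹))))) * (offDiagPF ω w * weylDenom w)) =
      (z * y) ^ n * P ^ n * Q * D := by
    simp only [Finset.prod_const, Finset.card_univ, Fintype.card_fin]
    linear_combination c * d * (offDiagPF ω w * weylDenom w) * hfac + d * e * Q * ih +
      P ^ n * Q * D * hconst
  linear_combination z * y * P * (z - z⁻¹) * (y - y⁻¹) * (y + y⁻¹ - (z + z⁻¹)) * key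

end Identity

section Interpolation

open Polynomial

variable {K : Type*} [Field K]

lemma exists_polynomial_weylDenom_cons {M : ℕ} (w : Fin M → K) : ∃ p : K[X],
    p.natDegree ≤ 2 * M + 2 ∧ ∀ z, z ≠ 0 →
      z ^ (M + 1) * weylDenom (Fin.cons z w : Fin (M + 1) → K) = p.eval z := by
  refine ⟨(X ^ 2 - 1) * (∏ k, (C (w k + (w k)⁻¹) * X - (X ^ 2 + 1))) * C (weylDenom w),
    ?_, fun z hz => ?_⟩
  · have h1 : (X ^ 2 - 1 : K[X]).natDegree ≤ 2 := by compute_degree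
    have h2 : (∏ k, (C (w k + (w k)⁻¹) * X - (X ^ 2 + 1))).natDegree ≤ M * 2 := by
      refine (natDegree_prod_le _ _).trans ?_
      refine (Finset.sum_le_card_nsmul _ _ 2 fun k _ => ?_).trans_eq (by simp)
      show natDegree (C (w k + (w k)⁻¹) * X - (X ^ 2 + 1)) ≤ 2
      compute_degree
    have h3 := natDegree_mul_le (p := (X ^ 2 - 1 : K[X]))
      (q := ∏ k, (C (w k + (w k)⁻¹) * X - (X ^ 2 + 1)))
    refine (natDegree_mul_C_le _ _).trans ?_
    omega
  · have hprod : z ^ M * ∏ k, (w k + (w k)⁻¹ - (z + z⁻¹)) =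
        ∏ k, ((w k + (w k)⁻¹) * z - (z ^ 2 + 1)) := by
      have : z ^ M = ∏ _k : Fin M, z := by simp
      rw [this, ← Finset.prod_mul_distrib]
      refine Finset.prod_congr rfl fun k _ => ?_
      linear_combination -mul_inv_cancel₀ hz
    have hz2 : z * (z - z⁻¹) = z ^ 2 - 1 := by linear_combination -mul_inv_cancel₀ hz
    rw [weylDenom_cons]
    simp only [eval_mul, eval_prod, eval_sub, eval_pow, eval_X, eval_one, eval_C, eval_add]
    rw [← hprod, ← hz2]
    ring

lemma exists_polynomial_det_oddPowMatrix_cons {n : ℕ} (w : Fin (2 * n + 1) → K) : ∃ p : K[X],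
    p.natDegree ≤ 6 * n + 4 ∧ ∀ z, z ≠ 0 →
      z ^ (3 * n + 2) * (oddPowMatrix (Fin.cons z w : Fin (2 * n + 2) → K)).det = p.eval z := by
  obtain ⟨γ, hγ⟩ := exists_det_oddPowMatrix_cons w
  have hk : ∀ k : Fin (2 * n + 2), nonMultipleThree k ≤ 3 * n + 2 := fun k => by
    have := k.2
    simp only [nonMultipleThree]
    omega
  refine ⟨∑ k : Fin (2 * n + 2), C (γ k) * (X ^ (3 * n + 2 + nonMultipleThree k) -
    X ^ (3 * n + 2 - nonMultipleThree k)), ?_, fun z hz => ?_⟩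
  · refine natDegree_sum_le_of_forall_le _ _ fun k _ => (natDegree_C_mul_le _ _).trans ?_
    have := hk k
    refine (natDegree_sub_le _ _).trans (max_le ?_ ?_) <;>
    · refine (natDegree_X_pow_le _).trans ?_
      omega
  · rw [hγ, Finset.mul_sum, eval_finsetSum]
    refine Finset.sum_congr rfl fun k _ => ?_
    simp only [eval_mul, eval_C, eval_sub, eval_pow, eval_X, oddPow]
    rw [pow_add z (3 * n + 2) (nonMultipleThree k),
      pow_sub₀ z hz (hk k), inv_pow]
    ring

lemma det_oddPowMatrix_cons_inv {N : ℕ} (z : K) (w : Fin N → K) :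
    (oddPowMatrix (Fin.cons z⁻¹ w : Fin (N + 1) → K)).det =
      -(oddPowMatrix (Fin.cons z w : Fin (N + 1) → K)).det := by
  obtain ⟨γ, hγ⟩ := exists_det_oddPowMatrix_cons w
  simp [hγ, oddPow_inv]

lemma det_oddPowMatrix_cons_self {N : ℕ} (w : Fin N → K) (j : Fin N) :
    (oddPowMatrix (Fin.cons (w j) w : Fin (N + 1) → K)).det = 0 := by
  refine Matrix.det_zero_of_row_eq (i := 0) (j := j.succ) (Fin.succ_ne_zero j).symm ?_
  ext k
  simp [oddPowMatrix]

lemma det_oddPowMatrix_cons_of_inv_eq {N : ℕ} {z : K} (hz : z⁻¹ = z) (w : Fin N → K) :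
    (oddPowMatrix (Fin.cons z w : Fin (N + 1) → K)).det = 0 := by
  obtain ⟨γ, hγ⟩ := exists_det_oddPowMatrix_cons w
  simp [hγ, oddPow, hz]

lemma im_ne_zero_of_sq_add_add_one_eq_zero {ω : ℂ} (hω : ω ^ 2 + ω + 1 = 0) : ω.im ≠ 0 := by
  intro h
  have hre := congrArg Complex.re hω
  simp [pow_two, h] at hre
  nlinarith [sq_nonneg (2 * ω.re + 1)]

lemma mul_ofReal_ne_ofReal {ω : ℂ} (hω : ω.im ≠ 0) {a : ℝ} (ha : a ≠ 0) (b : ℝ) :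
    ω * a ≠ b := by
  intro h
  have him := congrArg Complex.im h
  simp [hω, ha] at him

/-- The points at which the two sides of the determinant formula are compared. -/
noncomputable def nodes (ω : ℂ) {M : ℕ} (r : Fin M → ℝ) : (Bool ⊕ Fin M ⊕ Fin M) ⊕ Fin M → ℂ :=
  Sum.elim (fun t => (Sum.elim (fun b => if b then 1 else -1)
    (Sum.elim r fun j => (r j)⁻¹) t : ℝ)) fun j => ω ^ 2 * ((r j)⁻¹ : ℝ)

lemma nodes_injective {ω : ℂ} (hω : ω ^ 2 + ω + 1 = 0) {M : ℕ} {r : Fin M → ℝ}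
    (hr : Function.Injective r) (h1 : ∀ j, 1 < r j) : Function.Injective (nodes ω r) := by
  have him : (ω ^ 2).im ≠ 0 := by
    have h : ω ^ 2 = -1 - ω := by linear_combination hω
    rw [h]
    simpa using im_ne_zero_of_sq_add_add_one_eq_zero hω
  have hinv : ∀ j, (r j)⁻¹ < 1 := fun j => inv_lt_one_of_one_lt₀ (h1 j)
  have hpos : ∀ j, 0 < (r j)⁻¹ := fun j => inv_pos.2 (one_pos.trans (h1 j))
  refine Function.Injective.sumElim (Complex.ofReal_injective.comp
    (Function.Injective.sumElim ?_ (hr.sumElim (inv_injective.comp hr) ?_) ?_)) ?_ ?_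
  · intro a b
    cases a <;> cases b <;> norm_num
  · intro i j h
    linarith [h1 i, hinv j]
  · rintro a (j | j) h <;> cases a <;> simp at h <;> linarith [h1 j, hinv j, hpos j]
  · intro i j h
    have hω0 : ω ^ 2 ≠ 0 := fun h0 => him (by simp [h0])
    exact hr (inv_injective (Complex.ofReal_injective (mul_left_cancel₀ hω0 h)))
  · intro a j h
    exact mul_ofReal_ne_ofReal him (hpos j).ne' _ h.symm

lemma offDiagPF_mul_weylDenom_cons {ω : ℂ} (hω : ω ^ 2 + ω + 1 = 0) {n : ℕ}
    {r : Fin (2 * n + 1) → ℝ} (hr : Function.Injective r) (h1 : ∀ j, 1 < r j)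
    {w : Fin (2 * n + 1) → ℂ} (hw : ∀ j, w j = r j) {c d : ℂ}
    (h : ∀ j, c * (offDiagPF ω (Fin.cons (ω ^ 2 * (w j)⁻¹) w : Fin (2 * n + 2) → ℂ) *
      weylDenom (Fin.cons (ω ^ 2 * (w j)⁻¹) w : Fin (2 * n + 2) → ℂ)) =
      d * (ω ^ 2 * (w j)⁻¹) ^ n *
        (oddPowMatrix (Fin.cons (ω ^ 2 * (w j)⁻¹) w : Fin (2 * n + 2) → ℂ)).det)
    {z : ℂ} (hz : z ≠ 0) :
    c * (offDiagPF ω (Fin.cons z w : Fin (2 * n + 2) → ℂ) *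
      weylDenom (Fin.cons z w : Fin (2 * n + 2) → ℂ)) =
      d * z ^ n * (oddPowMatrix (Fin.cons z w : Fin (2 * n + 2) → ℂ)).det := by
  obtain ⟨p, hp, hpe⟩ := exists_polynomial_offDiagPF ω w
  obtain ⟨q, hq, hqe⟩ := exists_polynomial_weylDenom_cons w
  obtain ⟨s, hs, hse⟩ := exists_polynomial_det_oddPowMatrix_cons w
  have hp' : p.natDegree ≤ 2 * n := by
    rcases eq_or_ne p 0 with rfl | hp0
    · simp
    · exact Nat.lt_succ_iff.1 ((natDegree_lt_iff_degree_lt hp0).2 hp)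
  have heval : ∀ z, z ≠ 0 → (C c * (p * q) - C d * s).eval z = z ^ (2 * n + 2) *
      (c * (offDiagPF ω (Fin.cons z w : Fin (2 * n + 2) → ℂ) *
      weylDenom (Fin.cons z w : Fin (2 * n + 2) → ℂ)) -
      d * z ^ n * (oddPowMatrix (Fin.cons z w : Fin (2 * n + 2) → ℂ)).det) := by
    intro z hz
    simp only [eval_sub, eval_mul, eval_C, ← hpe, ← hqe z hz, ← hse z hz]
    ring
  have hzero : C c * (p * q) - C d * s = 0 := by
    refine Polynomial.eq_zero_of_natDegree_lt_card_of_eval_eq_zero _ (nodes_injective hω hr h1)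
      ?_ ?_
    · have hw0 : ∀ j, w j ≠ 0 := fun j => by
        rw [hw]
        exact Complex.ofReal_ne_zero.2 (one_pos.trans (h1 j)).ne'
      have hω0 : ω ≠ 0 := by rintro rfl; simp at hω
      rintro ((b | j | j) | j)
      · have hz : (nodes ω r (Sum.inl (Sum.inl b)))⁻¹ = nodes ω r (Sum.inl (Sum.inl b)) := by
          cases b <;> norm_num [nodes]
        have hz0 : nodes ω r (Sum.inl (Sum.inl b)) ≠ 0 := by cases b <;> norm_num [nodes]
        rw [heval _ hz0, det_oddPowMatrix_cons_of_inv_eq hz, weylDenom_cons, hz]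
        simp
      · have hz : nodes ω r (Sum.inl (Sum.inr (Sum.inl j))) = w j := by simp [nodes, hw]
        rw [hz, heval _ (hw0 j), det_oddPowMatrix_cons_self, weylDenom_cons,
          Finset.prod_eq_zero (Finset.mem_univ j) (sub_self _)]
        simp
      · have hz : nodes ω r (Sum.inl (Sum.inr (Sum.inr j))) = (w j)⁻¹ := by simp [nodes, hw]
        rw [hz, heval _ (inv_ne_zero (hw0 j)), det_oddPowMatrix_cons_inv,
          det_oddPowMatrix_cons_self, weylDenom_cons,
          Finset.prod_eq_zero (Finset.mem_univ j) (by rw [inv_inv, add_comm, sub_self])]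
        simp
      · have hz : nodes ω r (Sum.inr j) = ω ^ 2 * (w j)⁻¹ := by simp [nodes, hw]
        rw [hz, heval _ (mul_ne_zero (pow_ne_zero _ hω0) (inv_ne_zero (hw0 j))), h j, sub_self,
          mul_zero]
    · refine (natDegree_sub_le _ _).trans_lt (max_lt ?_ ?_)
      · refine (natDegree_C_mul_le _ _).trans_lt (natDegree_mul_le.trans_lt ?_)
        simp
        omega
      · refine (natDegree_C_mul_le _ _).trans_lt ?_
        simp
        omega
  have := heval z hz
  rw [hzero, eval_zero, eq_comm, mul_eq_zero] at this
  exact sub_eq_zero.1 (this.resolve_left (pow_ne_zero _ hz))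


lemma weylDenom_cons_comp_perm {N : ℕ} (z : K) (w : Fin N → K) (σ : Equiv.Perm (Fin N)) :
    weylDenom (Fin.cons z (w ∘ σ) : Fin (N + 1) → K) =
      (Equiv.Perm.sign σ : K) * weylDenom (Fin.cons z w : Fin (N + 1) → K) := by
  rw [weylDenom_cons, weylDenom_cons, weylDenom_comp_perm,
    ← Equiv.prod_comp σ fun k => w k + (w k)⁻¹ - (z + z⁻¹)]
  simp only [Function.comp]
  ring

lemma det_oddPowMatrix_cons_comp_perm {N : ℕ} (z : K) (w : Fin N → K)
    (σ : Equiv.Perm (Fin N)) :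
    (oddPowMatrix (Fin.cons z (w ∘ σ) : Fin (N + 1) → K)).det =
      (Equiv.Perm.sign σ : K) * (oddPowMatrix (Fin.cons z w : Fin (N + 1) → K)).det := by
  have h : (Fin.cons z (w ∘ σ) : Fin (N + 1) → K) =
      (Fin.cons z w : Fin (N + 1) → K) ∘ Equiv.Perm.decomposeFin.symm (0, σ) := by
    funext i
    refine Fin.cases ?_ (fun i => ?_) i <;> simp
  rw [h, det_oddPowMatrix_comp_perm, Equiv.Perm.decomposeFin.symm_sign]
  simp

lemma offDiagPF_mul_weylDenom_succ {ω : ℂ} (hω : ω ^ 2 + ω + 1 = 0) (hω1 : ω ≠ 1) {n : ℕ}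
    (ih : ∀ r : Fin (2 * n) → ℝ, Function.Injective r → (∀ j, 1 < r j) →
      ∀ w : Fin (2 * n) → ℂ, (∀ j, w j = r j) →
        3 ^ (n * (n - 1)) * (offDiagPF ω w * weylDenom w * ∏ k, w k) =
          (∏ k, w k) ^ n * (oddPowMatrix w).det)
    {r : Fin (2 * n + 2) → ℝ} (hr : Function.Injective r) (h1 : ∀ j, 1 < r j)
    {v : Fin (2 * n + 2) → ℂ} (hv : ∀ j, v j = r j) :
    3 ^ (n * (n + 1)) * (offDiagPF ω v * weylDenom v * ∏ k, v k) =
      (∏ k, v k) ^ (n + 1) * (oddPowMatrix v).det := by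
  obtain ⟨z, w, rfl⟩ : ∃ z w, v = (Fin.cons z w : Fin (2 * n + 2) → ℂ) :=
    ⟨_, _, (Fin.cons_self_tail v).symm⟩
  have hz0 : z ≠ 0 := by
    have := hv 0
    rw [Fin.cons_zero] at this
    rw [this]
    exact Complex.ofReal_ne_zero.2 (one_pos.trans (h1 0)).ne'
  have hw : ∀ j, w j = r j.succ := fun j => hv j.succ
  have hw0 : ∀ j, w j ≠ 0 := fun j => by
    rw [hw]
    exact Complex.ofReal_ne_zero.2 (one_pos.trans (h1 _)).ne'
  have hgen : ∀ i j, ω * w i ≠ w j := fun i j => by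
    rw [hw, hw]
    exact mul_ofReal_ne_ofReal (im_ne_zero_of_sq_add_add_one_eq_zero hω)
      (one_pos.trans (h1 _)).ne' _
  have key := offDiagPF_mul_weylDenom_cons hω (hr.comp (Fin.succ_injective _))
    (fun j => h1 j.succ) hw (c := 3 ^ (n * (n + 1)) * ∏ k, w k)
    (d := (∏ k, w k) ^ (n + 1)) ?_ hz0
  · rw [Fin.prod_univ_succ]
    simp only [Fin.cons_zero, Fin.cons_succ]
    linear_combination z * key
  · intro j
    have hω3 : ω ^ 3 = 1 := by linear_combination (ω - 1) * hω
    set σ : Equiv.Perm (Fin (2 * n + 1)) := Equiv.swap 0 j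
    have hσ : w ∘ σ = (Fin.cons (w j) fun k => w (σ k.succ) : Fin (2 * n + 1) → ℂ) := by
      funext i
      refine Fin.cases ?_ (fun i => rfl) i
      simp [σ]
    have hzy : ω * (ω ^ 2 * (w j)⁻¹ * w j) = 1 := by
      rw [inv_mul_cancel_right₀ (hw0 j)]
      linear_combination hω3
    have hx0 : ω ^ 2 * (w j)⁻¹ ≠ 0 := by
      intro h0
      rw [h0] at hzy
      simp at hzy
    have hrec := offDiagPF_mul_weylDenom_of_mul_eq_one hω hω1 three_ne_zero hzy
      (w := fun k => w (σ k.succ)) (fun k => hw0 _) (ih (fun k => r (σ k.succ).succ)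
        (hr.comp ((Fin.succ_injective _).comp (σ.injective.comp (Fin.succ_injective _))))
        (fun k => h1 _) _ fun k => hw _)
    rw [← hσ, offDiagPF_comp_perm hω hω1 _ _ hgen, weylDenom_cons_comp_perm,
      det_oddPowMatrix_cons_comp_perm] at hrec
    have hprod : w j * ∏ k : Fin (2 * n), w (σ k.succ) = ∏ k, w k := by
      rw [← Equiv.prod_comp σ w, Fin.prod_univ_succ]
      simp [σ]
    rw [hprod] at hrec
    have hsign : ((Equiv.Perm.sign σ : ℤ) : ℂ) ≠ 0 :=
      Int.cast_ne_zero.2 (Units.ne_zero _)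
    refine mul_left_cancel₀ (mul_ne_zero hsign hx0) ?_
    linear_combination hrec

theorem offDiagPF_mul_weylDenom {ω : ℂ} (hω : ω ^ 2 + ω + 1 = 0) (hω1 : ω ≠ 1) (n : ℕ)
    (r : Fin (2 * n) → ℝ) (hr : Function.Injective r) (h1 : ∀ j, 1 < r j)
    (w : Fin (2 * n) → ℂ) (hw : ∀ j, w j = r j) :
    3 ^ (n * (n - 1)) * (offDiagPF ω w * weylDenom w * ∏ k, w k) =
      (∏ k, w k) ^ n * (oddPowMatrix w).det := by
  induction n with
  | zero => simp [weylDenom, offDiagPF, trianglePF, triangleOp, onesOn]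
  | succ n ih =>
    have := offDiagPF_mul_weylDenom_succ hω hω1 ih hr h1 hw
    rwa [Nat.add_sub_cancel, Nat.mul_comm (n + 1) n]

end Interpolation

section Specialization

open Polynomial

variable {K : Type*} [Field K]

lemma exists_monic_oddPow_succ (K : Type*) [Field K] (j : ℕ) : ∃ p : K[X], p.Monic ∧
    p.natDegree = j ∧
    ∀ y : K, y ≠ 0 → oddPow y (j + 1) = (y - y⁻¹) * p.eval (y + y⁻¹) := by
  induction j using Nat.strong_induction_on with
  | _ j ih =>
    match j with
    | 0 => exact ⟨1, monic_one, natDegree_one, fun y _ => by simp [oddPow]⟩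
    | 1 =>
      refine ⟨X, monic_X, natDegree_X, fun y _ => ?_⟩
      simp only [oddPow, eval_X]
      ring
    | j + 2 =>
      obtain ⟨p, hp, hpd, hpe⟩ := ih j (by omega)
      obtain ⟨q, hq, hqd, hqe⟩ := ih (j + 1) (by omega)
      have hXq : (X * q).Monic := monic_X.mul hq
      have hXqd : (X * q).natDegree = j + 2 := by
        rw [monic_X.natDegree_mul hq, natDegree_X, hqd]
        ring
      have hlt : p.degree < (X * q).degree := by
        refine degree_lt_degree ?_
        omega
      refine ⟨X * q - p, hXq.sub_of_left hlt, ?_, fun y hy => ?_⟩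
      · rw [natDegree_sub_eq_left_of_natDegree_lt (by omega), hXqd]
      · rw [eval_sub, eval_mul, eval_X]
        have h1 := hpe y hy
        have h2 := hqe y hy
        simp only [oddPow, pow_succ] at h1 h2 ⊢
        linear_combination (y + y⁻¹) * h2 - h1 +
          (y⁻¹ * y⁻¹ ^ j - y * y ^ j) * mul_inv_cancel₀ hy

lemma det_oddPow_succ {N : ℕ} {y : Fin N → K} (hy : ∀ k, y k ≠ 0) :
    (Matrix.of fun k j : Fin N => oddPow (y k) (j + 1)).det = weylDenom y := by
  choose p hp hpd hpe using exists_monic_oddPow_succ K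
  rw [weylDenom, Matrix.det_eval_matrixOfPolynomials_eq_det_vandermonde _ (fun j : Fin N => p j)
    (fun j => hpd j) fun j => hp j, ← Matrix.det_mul_column]
  congr 1
  ext k j
  simp [hpe j (y k) (hy k)]

lemma det_oddPowMatrix_pow {N : ℕ} {t : K} (ht : t ≠ 0) :
    (oddPowMatrix fun j : Fin N => t ^ ((j : ℕ) + 1)).det =
      weylDenom fun k : Fin N => t ^ nonMultipleThree k := by
  rw [← Matrix.det_transpose, ← det_oddPow_succ fun k => pow_ne_zero _ ht]
  congr 1
  ext k j
  simp [oddPowMatrix, oddPow, ← pow_mul, mul_comm]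

/-- The Weyl denominator at powers of `t`, divided by its power of `t - 1`. -/
def weylQuot {N : ℕ} (b : Fin N → ℕ) (t : K) : K :=
  (∏ k, t⁻¹ ^ b k * ∑ m ∈ range (2 * b k), t ^ m) * ∏ i, ∏ j ∈ Ioi i,
    t⁻¹ ^ b j * ((∑ m ∈ range (b j + b i), t ^ m) * ∑ m ∈ range (b j - b i), t ^ m)

lemma weylDenom_pow {N : ℕ} {b : Fin N → ℕ} (hb : StrictMono b) {t : K} (ht : t ≠ 0) :
    weylDenom (fun k => t ^ b k) =
      (∏ _k : Fin N, (t - 1)) * (∏ i : Fin N, ∏ _j ∈ Ioi i, (t - 1) ^ 2) * weylQuot b t := by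
  have h1 : ∀ k, t ^ b k - (t ^ b k)⁻¹ =
      (t - 1) * (t⁻¹ ^ b k * ∑ m ∈ range (2 * b k), t ^ m) := fun k => by
    have hg := mul_geom_sum t (2 * b k)
    have hi : t ^ b k * t⁻¹ ^ b k = 1 := by rw [← mul_pow, mul_inv_cancel₀ ht, one_pow]
    rw [two_mul, pow_add] at hg
    rw [← inv_pow]
    rw [two_mul]
    linear_combination -t⁻¹ ^ b k * hg - t ^ b k * hi
  have h2 : ∀ i, ∀ j ∈ Ioi i, t ^ b j + (t ^ b j)⁻¹ - (t ^ b i + (t ^ b i)⁻¹) =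
      (t - 1) ^ 2 * (t⁻¹ ^ b j * ((∑ m ∈ range (b j + b i), t ^ m) *
        ∑ m ∈ range (b j - b i), t ^ m)) := fun i j hij => by
    obtain ⟨d, hd⟩ := Nat.exists_eq_add_of_le (hb.monotone (Finset.mem_Ioi.1 hij).le)
    have hg := mul_geom_sum t (b j + b i)
    have hg' := mul_geom_sum t (b j - b i)
    have hi : t ^ b i * t⁻¹ ^ b i = 1 := by rw [← mul_pow, mul_inv_cancel₀ ht, one_pow]
    have hi' : t ^ d * t⁻¹ ^ d = 1 := by rw [← mul_pow, mul_inv_cancel₀ ht, one_pow]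
    rw [← inv_pow, ← inv_pow]
    generalize (∑ m ∈ range (b j + b i), t ^ m) = G at *
    generalize (∑ m ∈ range (b j - b i), t ^ m) = H at *
    rw [hd, Nat.add_sub_cancel_left] at hg'
    rw [hd] at hg ⊢
    simp only [pow_add] at hg ⊢
    generalize t ^ b i = A at *
    generalize t⁻¹ ^ b i = A' at *
    generalize t ^ d = B at *
    generalize t⁻¹ ^ d = B' at *
    linear_combination -A' * B' * (t - 1) * H * hg - A' * B' * (A * B * A - 1) * hg' +
      (A * B - A) * (-1) * hi + A' * hi' - (A * B - A) * A * A' * hi' 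
  rw [weylDenom, Matrix.det_vandermonde, weylQuot, Finset.prod_congr rfl fun k _ => h1 k,
    Finset.prod_congr rfl fun i _ => Finset.prod_congr rfl (h2 i)]
  simp only [Finset.prod_mul_distrib]
  ring

/-- The value of `weylQuot b` at `1`. -/
def weylDim {N : ℕ} (b : Fin N → ℕ) : ℕ :=
  (∏ k, 2 * b k) * ∏ i, ∏ j ∈ Ioi i, (b j + b i) * (b j - b i)

lemma weylQuot_one {N : ℕ} (b : Fin N → ℕ) : weylQuot b (1 : K) = weylDim b := by
  simp [weylQuot, weylDim]

lemma continuousAt_weylQuot {N : ℕ} (b : Fin N → ℕ) : ContinuousAt (weylQuot b : ℂ → ℂ) 1 := by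
  have h : ContinuousAt (fun t : ℂ => t⁻¹) 1 := continuousAt_inv₀ one_ne_zero
  unfold weylQuot
  fun_prop

end Specialization

section Limit

open Filter Topology

variable {ι X : Type*} [DecidableEq ι] [TopologicalSpace X]

lemma continuous_crossOp {ω : ℂ} {u : X → ι → ℂ} (hu : Continuous u)
    {f : X → (ι → Bool) → ℂ} (hf : Continuous f) (i j : ι) :
    Continuous fun x => crossOp ω (u x) i j (f x) := by
  refine continuous_pi fun s => ?_
  simp only [crossOp_apply]
  split_ifs <;> fun_prop

lemma continuous_rowOp {ω : ℂ} {u : X → ι → ℂ} (hu : Continuous u)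
    {f : X → (ι → Bool) → ℂ} (hf : Continuous f) (i : ι) (l : List ι) :
    Continuous fun x => rowOp ω (u x) i l (f x) := by
  induction l with
  | nil => simpa [rowOp] using hf
  | cons j l ih =>
    simp only [rowOp_cons, Module.End.mul_apply]
    exact continuous_crossOp hu ih i j

lemma continuous_trianglePF (ω : ℂ) {u : X → ι → ℂ} (hu : Continuous u) (l : List ι) :
    Continuous fun x => trianglePF ω (u x) l := by
  have h : ∀ l' : List ι, Continuous fun x => triangleOp ω (u x) l' (onesOn ℂ l) := fun l' => by
    induction l' with
    | nil => simpa [triangleOp] using continuous_const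
    | cons i l' ih =>
      simp only [triangleOp, Module.End.mul_apply]
      exact continuous_rowOp hu ih i l'
  exact (continuous_apply _).comp (h l)

lemma strictMono_nonMultipleThree : StrictMono nonMultipleThree :=
  strictMono_nat_of_lt_succ fun k => by
    simp only [nonMultipleThree]
    omega

theorem offDiagPF_one_mul_weylDim {ω : ℂ} (hω : ω ^ 2 + ω + 1 = 0) (hω1 : ω ≠ 1) (n : ℕ) :
    3 ^ (n * (n - 1)) * (offDiagPF ω (fun _ : Fin (2 * n) => 1) *
      (weylDim fun k : Fin (2 * n) => (k : ℕ) + 1 : ℕ)) =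
      (weylDim fun k : Fin (2 * n) => nonMultipleThree k : ℕ) := by
  have hmono : StrictMono fun k : Fin (2 * n) => (k : ℕ) + 1 := fun i j hij =>
    Nat.add_lt_add_right hij 1
  have hmono' : StrictMono fun k : Fin (2 * n) => nonMultipleThree k := fun i j hij =>
    strictMono_nonMultipleThree hij
  let F : ℂ → ℂ := fun t => 3 ^ (n * (n - 1)) *
    (offDiagPF ω (fun j : Fin (2 * n) => t ^ ((j : ℕ) + 1)) *
      weylQuot (fun k : Fin (2 * n) => (k : ℕ) + 1) t * ∏ j : Fin (2 * n), t ^ ((j : ℕ) + 1))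
  let G : ℂ → ℂ := fun t => (∏ j : Fin (2 * n), t ^ ((j : ℕ) + 1)) ^ n *
    weylQuot (fun k : Fin (2 * n) => nonMultipleThree k) t
  have hPF : Continuous fun t : ℂ => offDiagPF ω (fun j : Fin (2 * n) => t ^ ((j : ℕ) + 1)) :=
    continuous_trianglePF ω (by fun_prop) _
  have hF : ContinuousAt F 1 := by
    have := continuousAt_weylQuot fun k : Fin (2 * n) => (k : ℕ) + 1
    have := hPF.continuousAt (x := 1)
    fun_prop
  have hG : ContinuousAt G 1 := by
    have := continuousAt_weylQuot fun k : Fin (2 * n) => nonMultipleThree k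
    fun_prop
  have heq : ∀ t : ℝ, 1 < t → F t = G t := fun t ht => by
    have ht0 : (t : ℂ) ≠ 0 := Complex.ofReal_ne_zero.2 (one_pos.trans ht).ne'
    have ht1 : (t : ℂ) - 1 ≠ 0 := sub_ne_zero.2 (Complex.ofReal_ne_one.2 ht.ne')
    have h := offDiagPF_mul_weylDenom hω hω1 n (fun j => t ^ ((j : ℕ) + 1))
      ((pow_right_injective₀ (one_pos.trans ht) ht.ne').comp hmono.injective)
      (fun j => one_lt_pow₀ ht (Nat.succ_ne_zero _)) (fun j => (t : ℂ) ^ ((j : ℕ) + 1))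
      fun j => by push_cast; rfl
    rw [weylDenom_pow hmono ht0, det_oddPowMatrix_pow ht0, weylDenom_pow hmono' ht0] at h
    have hD : (∏ _k : Fin (2 * n), ((t : ℂ) - 1)) *
        (∏ i : Fin (2 * n), ∏ _j ∈ Ioi i, ((t : ℂ) - 1) ^ 2) ≠ 0 :=
      mul_ne_zero (Finset.prod_ne_zero_iff.2 fun _ _ => ht1) (Finset.prod_ne_zero_iff.2 fun _ _ =>
        Finset.prod_ne_zero_iff.2 fun _ _ => pow_ne_zero _ ht1)
    refine mul_left_cancel₀ hD ?_
    linear_combination h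
  have hlim : Tendsto (fun t : ℝ => (t : ℂ)) (𝓝[>] 1) (𝓝 1) := by
    have := Complex.continuous_ofReal.tendsto 1
    rw [Complex.ofReal_one] at this
    exact this.mono_left nhdsWithin_le_nhds
  have h1 : F 1 = G 1 := tendsto_nhds_unique_of_eventuallyEq (hF.tendsto.comp hlim)
    (hG.tendsto.comp hlim) (eventually_nhdsWithin_of_forall heq)
  simpa [F, G, weylQuot_one] using h1

end Limit

section Product

lemma weylDim_eq_prod_range (b : ℕ → ℕ) (N : ℕ) :
    (weylDim fun k : Fin N => b k) =
      ∏ j ∈ range N, 2 * b j * ∏ i ∈ range j, (b j + b i) * (b j - b i) := by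
  have h : ∏ i : Fin N, ∏ j ∈ Ioi i, (b j + b i) * (b j - b i) =
      ∏ j : Fin N, ∏ i ∈ range j, (b j + b i) * (b j - b i) := by
    rw [Finset.prod_comm' (t' := univ) (s' := fun j => Iio j) (by simp)]
    refine Finset.prod_congr rfl fun j _ => ?_
    rw [← Nat.Iio_eq_range, ← Fin.map_valEmbedding_Iio, Finset.prod_map]
    rfl
  rw [weylDim, h, Finset.prod_range fun j => 2 * b j * ∏ i ∈ range j, (b j + b i) * (b j - b i),
    ← Finset.prod_mul_distrib]

lemma prod_range_two_mul (g : ℕ → ℕ) (m : ℕ) :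
    ∏ i ∈ range (2 * m), g i = ∏ p ∈ range m, g (2 * p) * g (2 * p + 1) := by
  induction m with
  | zero => simp
  | succ m ih =>
    rw [Nat.mul_succ, Finset.prod_range_succ, Finset.prod_range_succ, ih,
      Finset.prod_range_succ _ m, mul_assoc]

lemma factorial_mul_prod_range_three (c m : ℕ) :
    c.factorial * ∏ p ∈ range m, (c + 3 * p + 1) * (c + 3 * p + 2) * (c + 3 * p + 3) =
      (c + 3 * m).factorial := by
  induction m with
  | zero => simp
  | succ m ih =>
    rw [Finset.prod_range_succ, ← mul_assoc, ih,
      show c + 3 * (m + 1) = c + 3 * m + 1 + 1 + 1 by ring, Nat.factorial_succ,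
      Nat.factorial_succ, Nat.factorial_succ]
    ring

lemma factorial_mul_prod_range_succ (j : ℕ) :
    (j + 1) * ∏ i ∈ range j, ((j + 1) + (i + 1)) * ((j + 1) - (i + 1)) =
      (2 * j + 1).factorial := by
  have h1 : ∏ i ∈ range j, ((j + 1) - (i + 1)) = j.factorial := by
    rw [← Finset.prod_range_reflect, ← Finset.prod_range_add_one_eq_factorial]
    refine Finset.prod_congr rfl fun i hi => ?_
    have := Finset.mem_range.1 hi
    omega
  have h2 : (j + 1).factorial * ∏ i ∈ range j, ((j + 1) + (i + 1)) = (2 * j + 1).factorial := by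
    have := Nat.factorial_mul_ascFactorial (j + 1) j
    rw [Nat.ascFactorial_eq_prod_range] at this
    rw [show 2 * j + 1 = j + 1 + j by ring, ← this]
    congr 1
    exact Finset.prod_congr rfl fun i _ => by ring
  rw [Finset.prod_mul_distrib, h1, ← h2, Nat.factorial_succ]
  ring

lemma prod_range_even_mul_prod (m : ℕ) :
    (∏ i ∈ range (2 * m), (nonMultipleThree (2 * m) + nonMultipleThree i) *
      (nonMultipleThree (2 * m) - nonMultipleThree i)) * ∏ p ∈ range (2 * m), (3 * p + 1) =
      (6 * m).factorial := by
  have h1 := factorial_mul_prod_range_three (3 * m) m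
  have h2 := factorial_mul_prod_range_three 0 m
  have h3 : ∏ i ∈ range (2 * m), (nonMultipleThree (2 * m) + nonMultipleThree i) =
      ∏ p ∈ range m, (3 * m + 3 * p + 2) * (3 * m + 3 * p + 3) := by
    rw [prod_range_two_mul]
    refine Finset.prod_congr rfl fun p _ => ?_
    congr 1 <;> · simp only [nonMultipleThree]; omega
  have h4 : ∏ i ∈ range (2 * m), (nonMultipleThree (2 * m) - nonMultipleThree i) =
      ∏ p ∈ range m, (3 * p + 3) * (3 * p + 2) := by
    rw [prod_range_two_mul, ← Finset.prod_range_reflect]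
    refine Finset.prod_congr rfl fun p hp => ?_
    have := Finset.mem_range.1 hp
    congr 1 <;> · simp only [nonMultipleThree]; omega
  have h5 : ∏ p ∈ range (2 * m), (3 * p + 1) =
      (∏ p ∈ range m, (3 * p + 1)) * ∏ p ∈ range m, (3 * m + 3 * p + 1) := by
    rw [two_mul, Finset.prod_range_add]
    simp only [mul_add]
  rw [Finset.prod_mul_distrib, h3, h4, h5, show 6 * m = 3 * m + 3 * m by ring, ← h1]
  rw [Nat.zero_add] at h2
  rw [← h2]
  simp only [Nat.zero_add, Nat.factorial_zero, Finset.prod_mul_distrib]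
  ring

lemma prod_range_odd_mul_prod (m : ℕ) :
    (∏ i ∈ range (2 * m), (nonMultipleThree (2 * m + 1) + nonMultipleThree i) *
      (nonMultipleThree (2 * m + 1) - nonMultipleThree i)) *
      ∏ p ∈ range (2 * m + 1), (3 * p + 2) = (6 * m + 2).factorial := by
  have h1 := factorial_mul_prod_range_three (3 * m + 2) m
  have h2 := factorial_mul_prod_range_three 2 m
  have h3 : ∏ i ∈ range (2 * m), (nonMultipleThree (2 * m + 1) + nonMultipleThree i) =
      ∏ p ∈ range m, (3 * m + 2 + 3 * p + 1) * (3 * m + 2 + 3 * p + 2) := by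
    rw [prod_range_two_mul]
    refine Finset.prod_congr rfl fun p _ => ?_
    congr 1 <;> · simp only [nonMultipleThree]; omega
  have h4 : ∏ i ∈ range (2 * m), (nonMultipleThree (2 * m + 1) - nonMultipleThree i) =
      ∏ p ∈ range m, (2 + 3 * p + 2) * (2 + 3 * p + 1) := by
    rw [prod_range_two_mul, ← Finset.prod_range_reflect]
    refine Finset.prod_congr rfl fun p hp => ?_
    have := Finset.mem_range.1 hp
    congr 1 <;> · simp only [nonMultipleThree]; omega
  have h5 : ∏ p ∈ range (2 * m + 1), (3 * p + 2) =
      2 * (∏ p ∈ range m, (2 + 3 * p + 3)) * ∏ p ∈ range m, (3 * m + 2 + 3 * p + 3) := by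
    rw [Finset.prod_range_succ', two_mul, Finset.prod_range_add, mul_comm, ← mul_assoc]
    congr 1
    · congr 1
      exact Finset.prod_congr rfl fun p _ => by ring
    · exact Finset.prod_congr rfl fun p _ => by ring
  rw [Finset.prod_mul_distrib, h3, h4, h5, show 6 * m + 2 = 3 * m + 2 + 3 * m by ring, ← h1,
    show 3 * m + 2 = 2 + 3 * m by ring, ← h2]
  simp only [Finset.prod_mul_distrib, Nat.factorial_two]
  ring

lemma prod_range_mul_prod_range (k : ℕ) :
    (∏ p ∈ range k, (3 * p + 1)) * (∏ p ∈ range k, (3 * p + 2)) * (3 ^ k * k.factorial) =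
      (3 * k).factorial := by
  have h := factorial_mul_prod_range_three 0 k
  rw [Nat.zero_add] at h
  rw [← h, ← Finset.prod_range_add_one_eq_factorial]
  have h3 : 3 ^ k = ∏ _p ∈ range k, 3 := by simp
  rw [h3, ← Finset.prod_mul_distrib, ← Finset.prod_mul_distrib, ← Finset.prod_mul_distrib,
    Nat.factorial_zero, one_mul]
  exact Finset.prod_congr rfl fun p _ => by ring

lemma weylDim_nonMultipleThree_succ (m : ℕ) :
    (weylDim fun k : Fin (2 * (m + 1)) => nonMultipleThree k) =
      (weylDim fun k : Fin (2 * m) => nonMultipleThree k) *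
        (4 * (3 * m + 1) * (3 * m + 2) * (6 * m + 1).factorial *
          (3 ^ (2 * m + 1) * (2 * m + 1).factorial)) := by
  have h1 := prod_range_even_mul_prod m
  have h2 := prod_range_odd_mul_prod m
  have h3 := prod_range_mul_prod_range (2 * m + 1)
  have ha : nonMultipleThree (2 * m) = 3 * m + 1 := by simp only [nonMultipleThree]; omega
  have ha' : nonMultipleThree (2 * m + 1) = 3 * m + 2 := by simp only [nonMultipleThree]; omega
  rw [weylDim_eq_prod_range, weylDim_eq_prod_range, Nat.mul_succ, Finset.prod_range_succ,
    Finset.prod_range_succ, mul_assoc, Finset.prod_range_succ _ (2 * m)]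
  congr 1
  have hQ : 0 < (∏ p ∈ range (2 * m), (3 * p + 1)) * ∏ p ∈ range (2 * m + 1), (3 * p + 2) :=
    Nat.mul_pos (Finset.prod_pos fun p _ => Nat.succ_pos _)
      (Finset.prod_pos fun p _ => Nat.succ_pos _)
  refine Nat.eq_of_mul_eq_mul_right hQ ?_
  rw [Finset.prod_range_succ _ (2 * m), show 3 * (2 * m + 1) = 6 * m + 2 + 1 by ring,
    Nat.factorial_succ (6 * m + 2)] at h3
  rw [Nat.factorial_succ (6 * m)]
  have hsub : nonMultipleThree (2 * m + 1) - nonMultipleThree (2 * m) = 1 := by omega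
  have hadd : nonMultipleThree (2 * m + 1) + nonMultipleThree (2 * m) = 6 * m + 3 := by omega
  rw [hsub, hadd]
  generalize (∏ i ∈ range (2 * m), (nonMultipleThree (2 * m) + nonMultipleThree i) *
      (nonMultipleThree (2 * m) - nonMultipleThree i)) = P at *
  generalize (∏ i ∈ range (2 * m), (nonMultipleThree (2 * m + 1) + nonMultipleThree i) *
      (nonMultipleThree (2 * m + 1) - nonMultipleThree i)) = Q at *
  rw [ha, ha']
  generalize (∏ p ∈ range (2 * m), (3 * p + 1)) = A at *
  generalize (∏ p ∈ range (2 * m + 1), (3 * p + 2)) = B at *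
  generalize (6 * m).factorial = a at *
  generalize (6 * m + 2).factorial = b at *
  generalize 3 ^ (2 * m + 1) * (2 * m + 1).factorial = c at *
  zify at h1 h2 h3 ⊢
  linear_combination 4 * (3 * (m : ℤ) + 1) * (3 * m + 2) *
    ((6 * m + 3) * (Q * B * h1 + a * h2) - a * h3)

lemma weylDim_add_one_succ (m : ℕ) :
    (weylDim fun k : Fin (2 * (m + 1)) => (k : ℕ) + 1) =
      (weylDim fun k : Fin (2 * m) => (k : ℕ) + 1) *
        (4 * (4 * m + 1).factorial * (4 * m + 3).factorial) := by
  rw [weylDim_eq_prod_range (· + 1), weylDim_eq_prod_range (· + 1), Nat.mul_succ,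
    Finset.prod_range_succ, Finset.prod_range_succ, mul_assoc]
  congr 1
  rw [show 4 * m + 1 = 2 * (2 * m) + 1 by ring, show 4 * m + 3 = 2 * (2 * m + 1) + 1 by ring,
    ← factorial_mul_prod_range_succ, ← factorial_mul_prod_range_succ]
  ring

lemma prod_factorial_div_succ (m : ℕ) :
    (∏ i ∈ Icc 1 (m + 1), ((6 * i - 2).factorial : ℚ) / (2 * (m + 1) + 2 * i).factorial) *
      ((4 * m + 2).factorial * (4 * m + 4).factorial) =
    (∏ i ∈ Icc 1 m, ((6 * i - 2).factorial : ℚ) / (2 * m + 2 * i).factorial) *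
      ((6 * m + 4).factorial * (2 * m + 2).factorial) := by
  have hrange : ∀ k : ℕ, ∏ i ∈ Icc 1 k, ((2 * k + 2 * i).factorial : ℚ) =
      ∏ i ∈ range k, ((2 * k + 2 * i + 2).factorial : ℚ) := fun k => by
    rw [Finset.range_eq_Ico]
    exact (Finset.prod_Ico_add' (fun i => ((2 * k + 2 * i).factorial : ℚ)) 0 k 1).symm
  have hden : (∏ i ∈ Icc 1 (m + 1), ((2 * (m + 1) + 2 * i).factorial : ℚ)) *
      (2 * m + 2).factorial = (∏ i ∈ Icc 1 m, ((2 * m + 2 * i).factorial : ℚ)) *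
      ((4 * m + 2).factorial * (4 * m + 4).factorial) := by
    have h := Finset.prod_range_succ' (fun i => ((2 * m + 2 * i + 2).factorial : ℚ)) (m + 1)
    rw [Finset.prod_range_succ, Finset.prod_range_succ] at h
    rw [hrange, hrange]
    rw [show 2 * m + 2 * m + 2 = 4 * m + 2 by ring,
      show 2 * m + 2 * (m + 1) + 2 = 4 * m + 4 by ring] at h
    rw [← mul_assoc, h]
    congr 1
    refine Finset.prod_congr rfl fun i _ => ?_
    congr 2
    ring
  have hD : ∀ k : ℕ, ∏ i ∈ Icc 1 k, ((2 * k + 2 * i).factorial : ℚ) ≠ 0 := fun k =>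
    Finset.prod_ne_zero_iff.2 fun i _ => Nat.cast_ne_zero.2 (Nat.factorial_ne_zero _)
  have h1 := hD m
  have h2 := hD (m + 1)
  rw [Finset.prod_div_distrib, Finset.prod_div_distrib,
    Finset.prod_Icc_succ_top (Nat.le_add_left 1 m) fun i => ((6 * i - 2).factorial : ℚ),
    show 6 * (m + 1) - 2 = 6 * m + 4 by omega]
  rw [div_mul_eq_mul_div, div_mul_eq_mul_div, div_eq_div_iff h2 h1]
  linear_combination -(∏ i ∈ Icc 1 m, ((6 * i - 2).factorial : ℚ)) * (6 * m + 4).factorial * hden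

lemma prod_factorial_div_mul_weylDim (n : ℕ) :
    (∏ i ∈ Icc 1 n, ((6 * i - 2).factorial : ℚ) / (2 * n + 2 * i).factorial) *
      (3 ^ (n * (n - 1)) * (weylDim fun k : Fin (2 * n) => (k : ℕ) + 1 : ℕ)) =
      (weylDim fun k : Fin (2 * n) => nonMultipleThree k : ℕ) := by
  induction n with
  | zero => simp [weylDim]
  | succ m ih => 
    have h := prod_factorial_div_succ m
    rw [weylDim_nonMultipleThree_succ, weylDim_add_one_succ]
    rw [Nat.add_sub_cancel]
    have h3 : (3 : ℚ) ^ ((m + 1) * m) = 3 ^ (m * (m - 1)) * 3 ^ (2 * m) := by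
      rw [← pow_add]
      congr 1
      cases m with
      | zero => rfl
      | succ m => simp only [Nat.add_sub_cancel]; ring
    have h4 : (4 * m + 2).factorial = (4 * m + 2) * (4 * m + 1).factorial := Nat.factorial_succ _
    have h5 : (4 * m + 4).factorial = (4 * m + 4) * (4 * m + 3).factorial := Nat.factorial_succ _
    have h6 : (6 * m + 4).factorial =
        (6 * m + 4) * ((6 * m + 3) * ((6 * m + 2) * (6 * m + 1).factorial)) := by
      simp only [Nat.factorial_succ]
    have h7 : (2 * m + 2).factorial = (2 * m + 2) * (2 * m + 1).factorial := Nat.factorial_succ _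
    rw [h4, h5, h6, h7] at h
    rw [h3]
    push_cast at h ⊢
    rw [← ih]
    have h8 : ((4 : ℚ) * m + 2) * (4 * m + 4) ≠ 0 := by positivity
    refine mul_left_cancel₀ h8 ?_
    linear_combination 4 * (3 ^ (m * (m - 1)) * 3 ^ (2 * m) *
      (weylDim fun k : Fin (2 * m) => (k : ℕ) + 1 : ℕ)) * h

end Product

section Counting

variable {ι : Type*}

/-- The crossings of the triangle formed by the lines of `l`, row by row. -/
def triangleWord : List ι → List (Sym2 ι)
  | [] => []
  | i :: l => l.map (fun j => s(i, j)) ++ triangleWord l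

lemma mem_triangleWord {l : List ι} (hl : l.Nodup) {a b : ι} :
    s(a, b) ∈ triangleWord l ↔ a ≠ b ∧ a ∈ l ∧ b ∈ l := by
  induction l with
  | nil => simp [triangleWord]
  | cons i l ih =>
    rw [List.nodup_cons] at hl
    simp only [triangleWord, List.mem_append, ih hl.2, List.mem_map, List.mem_cons, Sym2.eq_iff]
    constructor
    · rintro (⟨j, hj, ⟨rfl, rfl⟩ | ⟨rfl, rfl⟩⟩ | h)
      · exact ⟨by rintro rfl; exact hl.1 hj, by simp [hj]⟩
      · exact ⟨by rintro rfl; exact hl.1 hj, by simp [hj]⟩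
      · tauto
    · rintro ⟨hab, rfl | ha, rfl | hb⟩
      · exact absurd rfl hab
      · exact Or.inl ⟨b, hb, by simp⟩
      · exact Or.inl ⟨a, ha, by simp⟩
      · tauto

variable [DecidableEq ι] [Fintype ι]

/-- The sum of the entries of `e` at the crossings of the line `k` that occur in `w`. -/
def lineSum (e : Sym2 ι → ℤ) (w : List (Sym2 ι)) (k : ι) : ℤ :=
  ∑ j with s(j, k) ∈ w, e s(j, k)

/-- Fillings `e` of the crossings in `w` by integers such that, starting with the labels `t` and
adding `e p` to the labels of both lines at every crossing `p`, all labels stay in `{0, 1}`, and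
all of them are `1` in the end. -/
def crossingFillings (t : ι → Bool) (w : List (Sym2 ι)) : Set (Sym2 ι → ℤ) :=
  {e | (∀ p, p ∉ w → e p = 0) ∧
    (∀ w', w' <+: w → ∀ k, (t k).toInt + lineSum e w' k = 0 ∨ (t k).toInt + lineSum e w' k = 1) ∧
    ∀ k, (t k).toInt + lineSum e w k = 1}

lemma lineSum_congr {e e' : Sym2 ι → ℤ} {w : List (Sym2 ι)} (h : ∀ p ∈ w, e p = e' p) (k : ι) :
    lineSum e w k = lineSum e' w k :=
  Finset.sum_congr rfl fun _ hj => h _ (Finset.mem_filter.1 hj).2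

lemma lineSum_cons {i j : ι} (hij : i ≠ j) {w : List (Sym2 ι)} (hw : s(i, j) ∉ w)
    (e : Sym2 ι → ℤ) (k : ι) :
    lineSum e (s(i, j) :: w) k = (if k = i ∨ k = j then e s(i, j) else 0) + lineSum e w k := by
  simp only [lineSum, List.mem_cons]
  rw [Finset.filter_or, Finset.sum_union]
  · congr 1
    by_cases hi : k = i
    · subst hi
      rw [if_pos (Or.inl rfl), Finset.sum_eq_single j]
      · rw [Sym2.eq_swap]
      · intro b hb hbj
        simp at hb
        simp_all
      · simp [Sym2.eq_swap]
    · by_cases hj : k = j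
      · subst hj
        rw [if_pos (Or.inr rfl), Finset.sum_eq_single i]
        · intro b hb hbj
          simp at hb
          simp_all
        · simp
      · rw [if_neg (by tauto)]
        refine Finset.sum_eq_zero fun b hb => ?_
        simp at hb
        tauto
  · rw [Finset.disjoint_filter]
    rintro b - hb
    rwa [hb]

lemma mem_crossingFillings_cons {i j : ι} (hij : i ≠ j) {w : List (Sym2 ι)} (hw : s(i, j) ∉ w)
    {t t' : ι → Bool} {e : Sym2 ι → ℤ}
    (ht : ∀ k, (t' k).toInt = (t k).toInt + if k = i ∨ k = j then e s(i, j) else 0) :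
    e ∈ crossingFillings t (s(i, j) :: w) ↔
      Function.update e s(i, j) 0 ∈ crossingFillings t' w := by
  have hup : ∀ p ∈ w, Function.update e s(i, j) 0 p = e p := fun p hp =>
    Function.update_of_ne (by rintro rfl; exact hw hp) _ _
  have hpre : ∀ w', w' <+: w → ∀ k, (t k).toInt + lineSum e (s(i, j) :: w') k =
      (t' k).toInt + lineSum (Function.update e s(i, j) 0) w' k := fun w' hw' k => by
    rw [lineSum_cons hij fun h => hw (hw'.subset h), ht,
      lineSum_congr fun p hp => hup p (hw'.subset hp)]
    ring
  refine and_congr ?_ (and_congr ?_ ?_)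
  · refine forall_congr' fun p => ?_
    by_cases hp : p = s(i, j)
    · subst hp
      simp
    · simp [hp]
  · constructor
    · intro h w' hw' k
      rw [← hpre w' hw']
      exact h _ (List.prefix_cons_inj _ |>.2 hw') k
    · intro h w' hw' k
      rcases List.prefix_cons_iff.1 hw' with rfl | ⟨w'', rfl, hw''⟩
      · cases t k <;> simp [lineSum]
      · rw [hpre w'' hw'']
        exact h _ hw'' k
  · exact forall_congr' fun k => by rw [hpre w List.prefix_rfl]

lemma toInt_add_mem_of_mem_crossingFillings {i j : ι} (hij : i ≠ j) {w : List (Sym2 ι)}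
    {t : ι → Bool} {e : Sym2 ι → ℤ} (he : e ∈ crossingFillings t (s(i, j) :: w)) :
    ((t i).toInt + e s(i, j) = 0 ∨ (t i).toInt + e s(i, j) = 1) ∧
      ((t j).toInt + e s(i, j) = 0 ∨ (t j).toInt + e s(i, j) = 1) := by
  have h := he.2.1 [s(i, j)] (by simp)
  have hs := lineSum_cons hij (w := []) (by simp) e
  have hi := h i
  have hj := h j
  rw [hs] at hi hj
  simpa [lineSum] using And.intro hi hj

lemma update_eq_self_of_mem_crossingFillings {p : Sym2 ι} {w : List (Sym2 ι)} (hp : p ∉ w)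
    {t : ι → Bool} {e : Sym2 ι → ℤ} (he : e ∈ crossingFillings t w) :
    Function.update e p 0 = e := by
  rw [← he.1 p hp, Function.update_eq_self]

lemma mem_crossingFillings_cons_of_eq_zero {i j : ι} (hij : i ≠ j) {w : List (Sym2 ι)}
    (hw : s(i, j) ∉ w) {t : ι → Bool} {e : Sym2 ι → ℤ} (he : e s(i, j) = 0) :
    e ∈ crossingFillings t (s(i, j) :: w) ↔ e ∈ crossingFillings t w := by
  rw [mem_crossingFillings_cons hij hw (t' := t) (by simp [he]),
    Function.update_eq_self_iff.2 he.symm]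

lemma crossingFillings_cons_of_ne {i j : ι} (hij : i ≠ j) {w : List (Sym2 ι)}
    (hw : s(i, j) ∉ w) {t : ι → Bool} (ht : t i ≠ t j) :
    crossingFillings t (s(i, j) :: w) = crossingFillings t w := by
  ext e
  constructor
  · intro he
    have h := toInt_add_mem_of_mem_crossingFillings hij he
    have h0 : e s(i, j) = 0 := by
      cases hi : t i <;> cases hj : t j <;> simp_all <;> omega
    exact (mem_crossingFillings_cons_of_eq_zero hij hw h0).1 he
  · intro he
    exact (mem_crossingFillings_cons_of_eq_zero hij hw (he.1 _ hw)).2 he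

lemma mem_crossingFillings_cons_of_ne_zero {i j : ι} (hij : i ≠ j) {w : List (Sym2 ι)}
    (hw : s(i, j) ∉ w) {t : ι → Bool} (ht : t i = t j) {e : Sym2 ι → ℤ}
    (he : e s(i, j) = if t i then -1 else 1) :
    e ∈ crossingFillings t (s(i, j) :: w) ↔
      Function.update e s(i, j) 0 ∈ crossingFillings (flipPair t i j) w := by
  refine mem_crossingFillings_cons hij hw fun k => ?_
  by_cases hi : k = i
  · subst hi
    rw [flipPair_left hij, he]
    cases t k <;> simp
  · by_cases hj : k = j
    · subst hj
      rw [flipPair_right, he, ht]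
      cases t k <;> simp
    · simp [flipPair_of_ne hi hj, hi, hj]

lemma crossingFillings_cons_of_eq {i j : ι} (hij : i ≠ j) {w : List (Sym2 ι)}
    (hw : s(i, j) ∉ w) {t : ι → Bool} (ht : t i = t j) :
    crossingFillings t (s(i, j) :: w) = crossingFillings t w ∪
      (fun e => Function.update e s(i, j) (if t i then -1 else 1)) ''
        crossingFillings (flipPair t i j) w := by
  ext e
  constructor
  · intro he
    by_cases h0 : e s(i, j) = 0
    · exact Or.inl ((mem_crossingFillings_cons_of_eq_zero hij hw h0).1 he)
    · have h := (toInt_add_mem_of_mem_crossingFillings hij he).1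
      have h1 : e s(i, j) = if t i then -1 else 1 := by
        cases hi : t i <;> simp_all
        omega
      refine Or.inr ⟨_, (mem_crossingFillings_cons_of_ne_zero hij hw ht h1).1 he, ?_⟩
      simp [← h1]
  · rintro (he | ⟨e, he, rfl⟩)
    · exact (mem_crossingFillings_cons_of_eq_zero hij hw (he.1 _ hw)).2 he
    · refine (mem_crossingFillings_cons_of_ne_zero hij hw ht (by simp)).2 ?_
      simpa [update_eq_self_of_mem_crossingFillings hw he] using he

/-- `f` counts the fillings of `w`, as a function of the initial labels. -/
def CountsFillings {K : Type*} [Field K] (f : (ι → Bool) → K) (w : List (Sym2 ι)) : Prop :=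
  ∀ t, (crossingFillings t w).Finite ∧ f t = (crossingFillings t w).ncard

lemma CountsFillings.crossOp {K : Type*} [Field K] {ω : K} (hω : ω ≠ 1)
    {f : (ι → Bool) → K} {w : List (Sym2 ι)} (h : CountsFillings f w) {i j : ι} (hij : i ≠ j)
    (hw : s(i, j) ∉ w) :
    CountsFillings (crossOp ω (fun _ => 1) i j f) (s(i, j) :: w) := by
  intro t
  have hω' : (ω - 1) * (ω - 1)⁻¹ = 1 := mul_inv_cancel₀ (sub_ne_zero.2 hω)
  rw [crossOp_apply]
  by_cases ht : t i = t j
  · have hinj : Set.InjOn (fun e : Sym2 ι → ℤ => Function.update e s(i, j) (if t i then -1 else 1))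
        (crossingFillings (flipPair t i j) w) := by
      intro e he e' he' hee
      have := congrArg (fun e : Sym2 ι → ℤ => Function.update e s(i, j) 0) hee
      simpa [update_eq_self_of_mem_crossingFillings hw he,
        update_eq_self_of_mem_crossingFillings hw he'] using this
    rw [crossingFillings_cons_of_eq hij hw ht]
    have hf := (h (flipPair t i j)).1.image
      fun e : Sym2 ι → ℤ => Function.update e s(i, j) (if t i then -1 else 1)
    refine ⟨(h t).1.union hf, ?_⟩
    rw [Set.ncard_union_eq _ (h t).1 hf, hinj.ncard_image, Nat.cast_add, ← (h t).2,
      ← (h _).2]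
    · simp [ht, hω']
    · rw [Set.disjoint_right]
      rintro _ ⟨e, -, rfl⟩ he
      have := he.1 _ hw
      cases hi : t i <;> simp [hi] at this
  · rw [crossingFillings_cons_of_ne hij hw ht]
    exact ⟨(h t).1, by simp [ht, hω', ← (h t).2]⟩

lemma countsFillings_onesOn {K : Type*} [Field K] {l : List ι} (hl : ∀ i, i ∈ l) :
    CountsFillings (onesOn K l) ([] : List (Sym2 ι)) := by
  intro t
  by_cases ht : ∀ i, t i
  · have : crossingFillings t [] = {0} := by
      ext e
      simp [crossingFillings, lineSum, ht, funext_iff]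
    rw [this]
    simp [onesOn, ht]
  · have : crossingFillings t [] = ∅ := by
      ext e
      simp only [crossingFillings, lineSum, Set.mem_ofPred_eq, Set.mem_empty_iff_false, iff_false]
      rintro ⟨-, -, h⟩
      refine ht fun i => ?_
      have := h i
      cases hi : t i <;> simp_all
    rw [this]
    simpa [onesOn, hl] using ht

lemma CountsFillings.rowOp {K : Type*} [Field K] {ω : K} (hω : ω ≠ 1)
    {f : (ι → Bool) → K} {w : List (Sym2 ι)} (h : CountsFillings f w) {i : ι} {l : List ι}
    (hl : (i :: l).Nodup) (hw : ∀ j, s(i, j) ∉ w) :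
    CountsFillings (rowOp ω (fun _ => 1) i l f) (l.map (fun j => s(i, j)) ++ w) := by
  induction l with
  | nil => simpa [_root_.rowOp] using h
  | cons j l ih =>
    rw [rowOp_cons]
    simp only [List.nodup_cons, List.mem_cons, not_or] at hl
    refine (ih (by simp; tauto)).crossOp hω hl.1.1 ?_
    simp only [List.mem_append, hw, or_false, List.mem_map, Sym2.eq_iff]
    rintro ⟨k, hk, ⟨-, rfl⟩ | ⟨rfl, rfl⟩⟩
    · exact hl.2.1 hk
    · exact hl.1.1 rfl

lemma CountsFillings.triangleOp {K : Type*} [Field K] {ω : K} (hω : ω ≠ 1)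
    {f : (ι → Bool) → K} (h : CountsFillings f []) {l : List ι} (hl : l.Nodup) :
    CountsFillings (triangleOp ω (fun _ => 1) l f) (triangleWord l) := by
  induction l with
  | nil => simpa [_root_.triangleOp, triangleWord] using h
  | cons i l ih =>
    have hl' := List.nodup_cons.1 hl
    refine (ih hl'.2).rowOp hω hl fun j => ?_
    rw [mem_triangleWord hl'.2]
    tauto

lemma offDiagPF_one_eq_ncard {K : Type*} [Field K] {ω : K} (hω : ω ≠ 1) (N : ℕ) :
    offDiagPF ω (fun _ : Fin N => 1) =
      (crossingFillings (fun _ => false) (triangleWord (List.finRange N))).ncard :=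
  ((countsFillings_onesOn fun i => List.mem_finRange i).triangleOp hω
    (List.nodup_finRange N) _).2

end Counting

section Bijection

lemma triangleWord_pairwise {ι : Type*} [LinearOrder ι] {l : List ι} (hl : l.Pairwise (· < ·)) :
    (triangleWord l).Pairwise fun p q => ∀ i j k, p = s(i, k) → q = s(j, k) → i < j := by
  induction l with
  | nil => simp [triangleWord]
  | cons a l ih =>
    rw [List.pairwise_cons] at hl
    rw [triangleWord, List.pairwise_append]
    refine ⟨List.pairwise_map.2 ?_, ih hl.2, ?_⟩
    · refine hl.2.imp_of_mem fun {b c} hb hc hbc i j k hp hq => ?_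
      have := hl.1 b hb
      have := hl.1 c hc
      rw [Sym2.eq_iff] at hp hq
      grind
    · intro p hp q hq i j k hpk hqk
      obtain ⟨b, hb, rfl⟩ := List.mem_map.1 hp
      rw [hqk, mem_triangleWord (hl.2.imp ne_of_lt)] at hq
      have := hl.1 j hq.2.1
      have := hl.1 k hq.2.2
      rw [Sym2.eq_iff] at hpk
      grind

variable {N : ℕ}

lemma mem_triangleWord_finRange {i j : Fin N} :
    s(i, j) ∈ triangleWord (List.finRange N) ↔ i ≠ j := by
  simp [mem_triangleWord (List.nodup_finRange N)]

lemma triangleWord_finRange_pairwise : (triangleWord (List.finRange N)).Pairwise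
    fun p q => ∀ i j k, p = s(i, k) → q = s(j, k) → i < j :=
  triangleWord_pairwise (List.pairwise_lt_finRange N)

lemma mem_prefix_triangleWord {w : List (Sym2 (Fin N))}
    (hw : w <+: triangleWord (List.finRange N)) (k : Fin N) :
    (∀ j, s(j, k) ∉ w) ∨ ∃ m, ∀ j, s(j, k) ∈ w ↔ j ≤ m ∧ j ≠ k := by
  rw [or_iff_not_imp_left]
  intro h
  push Not at h
  obtain ⟨j₀, hj₀⟩ := h
  have hne : ({j | s(j, k) ∈ w} : Finset (Fin N)).Nonempty := ⟨j₀, by simpa using hj₀⟩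
  refine ⟨max' _ hne, fun j => ⟨fun hj => ⟨le_max' _ j (by simpa using hj),
    mem_triangleWord_finRange.1 (hw.subset hj)⟩, fun hj => ?_⟩⟩
  have hm := max'_mem _ hne
  obtain ⟨w', hw'⟩ := hw
  have hp := triangleWord_finRange_pairwise (N := N)
  have hmem := mem_triangleWord_finRange.2 hj.2
  rw [← hw', List.mem_append] at hmem
  rw [← hw', List.pairwise_append] at hp
  exact hmem.resolve_right fun h =>
    (hp.2.2 _ (mem_filter.1 hm).2 _ h _ _ _ rfl rfl).not_ge hj.1

lemma exists_prefix_triangleWord (k m : Fin N) :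
    ∃ w, w <+: triangleWord (List.finRange N) ∧ ∀ j, s(j, k) ∈ w ↔ j ≤ m ∧ j ≠ k := by
  by_cases hne : ({j | j ≤ m ∧ j ≠ k} : Finset (Fin N)).Nonempty
  · obtain ⟨h₁, h₂⟩ := (mem_filter.1 (max'_mem _ hne)).2
    have hmax : ∀ j, j ≤ m → j ≠ k → j ≤ max' _ hne := fun j hj hjk =>
      le_max' _ j (by simp [hj, hjk])
    generalize max' _ hne = m' at h₁ h₂ hmax
    obtain ⟨a, b, hab⟩ := List.append_of_mem (mem_triangleWord_finRange.2 h₂)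
    have hp := triangleWord_finRange_pairwise (N := N)
    rw [hab, List.pairwise_append, List.pairwise_cons] at hp
    refine ⟨a ++ [s(m', k)], ⟨b, by simp [hab]⟩, fun j => ⟨fun hj => ?_, fun hj => ?_⟩⟩
    · have hjk : j ≠ k := by
        refine mem_triangleWord_finRange.1 ?_
        rw [hab]
        simp only [List.mem_append, List.mem_cons, List.not_mem_nil, or_false] at hj ⊢
        tauto
      refine ⟨?_, hjk⟩
      rw [List.mem_append, List.mem_singleton] at hj
      rcases hj with hj | hj
      · exact (hp.2.2 _ hj s(m', k) (by simp) _ _ _ rfl rfl).le.trans h₁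
      · rwa [Sym2.congr_left.1 hj]
    · have hmem := mem_triangleWord_finRange.2 hj.2
      rw [hab] at hmem
      have hb : s(j, k) ∉ b := fun h =>
        (hp.2.1.1 _ h _ _ _ rfl rfl).not_ge (hmax j hj.1 hj.2)
      simp only [List.mem_append, List.mem_cons, List.not_mem_nil, or_false] at hmem ⊢
      tauto
  · refine ⟨[], ⟨_, List.nil_append _⟩, fun j => ?_⟩
    simp only [List.not_mem_nil, false_iff]
    exact fun hj => hne ⟨j, by simpa using hj⟩

lemma mem_crossingFillings_triangleWord {e : Sym2 (Fin N) → ℤ} :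
    e ∈ crossingFillings (fun _ => false) (triangleWord (List.finRange N)) ↔
      (∀ i, e s(i, i) = 0) ∧
      (∀ k m, ∑ j with j ≤ m, e s(j, k) = 0 ∨ ∑ j with j ≤ m, e s(j, k) = 1) ∧
      ∀ k, ∑ j, e s(j, k) = 1 := by
  have hdiag : (∀ p, p ∉ triangleWord (List.finRange N) → e p = 0) ↔ ∀ i, e s(i, i) = 0 := by
    constructor
    · exact fun h i => h _ fun hi => mem_triangleWord_finRange.1 hi rfl
    · intro h p
      induction p with
      | _ i j =>
        intro hp
        rw [mem_triangleWord_finRange, not_not] at hp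
        rw [hp, h]
  rw [crossingFillings, Set.mem_ofPred_eq, hdiag]
  refine and_congr_right fun h => ?_
  have hsum : ∀ w : List (Sym2 (Fin N)), ∀ k (P : Fin N → Prop) [DecidablePred P],
      (∀ j, s(j, k) ∈ w ↔ P j ∧ j ≠ k) → lineSum e w k = ∑ j with P j, e s(j, k) := by
    intro w k P _ hP
    simp only [lineSum, hP]
    refine sum_subset (fun j => by simp +contextual) fun j hj hj' => ?_
    have : j = k := by simp_all
    rw [this, h]
  refine and_congr ⟨fun H k m => ?_, fun H w hw k => ?_⟩ (forall_congr' fun k => ?_)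
  · obtain ⟨w, hw, hwm⟩ := exists_prefix_triangleWord k m
    have := H w hw k
    rw [hsum w k (· ≤ m) hwm] at this
    simpa using this
  · rcases mem_prefix_triangleWord hw k with hk | ⟨m, hm⟩
    · simp [lineSum, hk]
    · rw [hsum w k (· ≤ m) hm]
      simpa using H k m
  · rw [hsum _ k (fun _ => True) (by simp [mem_triangleWord_finRange])]
    simp

lemma eq_of_sum_le_mem {f : Fin N → ℤ}
    (h : ∀ m, ∑ j with j ≤ m, f j = 0 ∨ ∑ j with j ≤ m, f j = 1) (m : Fin N) :
    f m = -1 ∨ f m = 0 ∨ f m = 1 := by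
  have hm : ∑ j with j ≤ m, f j = f m + ∑ j with j < m, f j := by
    rw [← sum_insert (by simp)]
    congr 1
    ext j
    simp [le_iff_eq_or_lt]
  have hlt : ∑ j with j < m, f j = 0 ∨ ∑ j with j < m, f j = 1 := by
    rcases m with ⟨_ | m, hmN⟩
    · left
      simp [Fin.lt_def]
    · have := h ⟨m, by omega⟩
      simpa only [Fin.lt_def, Fin.le_def, Nat.lt_succ_iff] using this
  have := h m
  omega

lemma card_isOSASMeven_eq_ncard : Nat.card {A : Matrix (Fin N) (Fin N) ℤ // IsOSASMeven A} =
    (crossingFillings (fun _ => false) (triangleWord (List.finRange N))).ncard := by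
  have hinj : Function.Injective
      fun (e : Sym2 (Fin N) → ℤ) => (Matrix.of fun i j => e s(i, j)) := by
    intro e e' h
    ext p
    induction p with
    | _ i j => exact congrFun (congrFun h i) j
  rw [← Set.ncard_image_of_injective _ hinj]
  refine (Nat.card_coe_set_eq {A : Matrix (Fin N) (Fin N) ℤ | IsOSASMeven A}).trans
    (congrArg Set.ncard ?_)
  ext A
  constructor
  · rintro ⟨⟨⟨-, -, hcol, -, hsum⟩, hsymm⟩, hdiag⟩
    exact ⟨Sym2.lift ⟨A, fun i j => hsymm.apply j i⟩,
      mem_crossingFillings_triangleWord.2 ⟨hdiag, hcol, hsum⟩, rfl⟩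
  · rintro ⟨e, he, rfl⟩
    obtain ⟨hdiag, hcol, hsum⟩ := mem_crossingFillings_triangleWord.1 he
    have hswap : ∀ i j : Fin N, e s(i, j) = e s(j, i) := fun i j => by rw [Sym2.eq_swap]
    refine ⟨⟨⟨fun i j => eq_of_sum_le_mem (hcol j) i, fun i k => ?_, hcol, fun i => ?_, hsum⟩,
      ?_⟩, hdiag⟩
    · simpa only [Matrix.of_apply, hswap i] using hcol i k
    · simpa only [Matrix.of_apply, hswap i] using hsum i
    · ext i j
      exact hswap j i

end Bijection

lemma weylDim_succ_ne_zero (N : ℕ) : (weylDim fun k : Fin N => (k : ℕ) + 1) ≠ 0 := by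
  refine mul_ne_zero (prod_ne_zero_iff.2 fun k _ => by simp)
    (prod_ne_zero_iff.2 fun i _ => prod_ne_zero_iff.2 fun j hj => ?_)
  have : (i : ℕ) < j := Fin.lt_def.1 (mem_Ioi.1 hj)
  exact mul_ne_zero (by simp) (by simp only; omega)

/-- The number of OSASMs of order 2n equals ∏_{i=1}^{n} (6i-2)!/(2n+2i)!. -/
theorem osasm_even_count (n : ℕ) :
    (Nat.card {A : Matrix (Fin (2*n)) (Fin (2*n)) ℤ // IsOSASMeven A} : ℚ) =
      ∏ i ∈ Finset.Icc 1 n, ((6*i-2).factorial : ℚ) / ((2*n+2*i).factorial : ℚ) := by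
  have hprim := Complex.isPrimitiveRoot_exp 3 (by norm_num)
  have hω := hprim.geom_sum_eq_zero (by norm_num)
  have hω1 := hprim.ne_one (by norm_num)
  generalize Complex.exp _ = ω at hω hω1
  have h := offDiagPF_one_mul_weylDim (ω := ω)
    (by simp only [sum_range_succ, sum_range_zero] at hω; linear_combination hω) hω1 n
  rw [offDiagPF_one_eq_ncard hω1, ← card_isOSASMeven_eq_ncard] at h
  have hq : (3 ^ (n * (n - 1)) *
      ((Nat.card {A : Matrix (Fin (2*n)) (Fin (2*n)) ℤ // IsOSASMeven A} : ℚ) *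
        (weylDim fun k : Fin (2 * n) => (k : ℕ) + 1 : ℕ))) =
      (weylDim fun k : Fin (2 * n) => nonMultipleThree k : ℕ) := by exact_mod_cast h
  have h0 : (3 : ℚ) ^ (n * (n - 1)) * (weylDim fun k : Fin (2 * n) => (k : ℕ) + 1 : ℕ) ≠ 0 :=
    mul_ne_zero (by positivity) (Nat.cast_ne_zero.2 (weylDim_succ_ne_zero _))
  refine mul_right_cancel₀ h0 ?_
  rw [prod_factorial_div_mul_weylDim, ← hq]
  ring
end

section
/- The generating function for OSASMs of even order satisfies the symmetry X^O_{2n}(r,t) = t^{2n+2} · X^O_{2n}(r,1/t), where X^O_{2n}(r,t) = ∑_{A ∈ OSASM(2n)} r^{R(A)} t^{T(A)}. -/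
open Finset

section

variable {S R : Type*} [CommRing R]

/-- The contribution of a six-vertex-model vertex with incoming horizontal state `h` and incoming
vertical state `x`, where `K` is the contribution of the outgoing states. -/
def vertexSum (a b c : R) (h x : Bool) (K : Bool → Bool → R) : R :=
  if h = x then a * K h x + c * K (!h) (!x) else b * K h x

/-- Partition function of one row of a six-vertex model. -/
def rowSum (a b : S → S → R) (c : R) (u : S) :
    Bool → List S → List Bool → (List Bool → R) → R
  | h, [], [], G => if h then G [] else 0
  | h, v :: vs, x :: xs, G =>
    vertexSum (a u v) (b u v) c h x fun h y => rowSum a b c u h vs xs fun ys => G (y :: ys)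
  | _, _, _, _ => 0

/-- Partition function of a six-vertex model on a triangle whose columns enter with the given
states: the state of the first column turns into the incoming horizontal state of the first row,
which crosses the other columns, and these enter the remaining triangle. -/
def triSum (a b : S → S → R) (c : R) : List S → List Bool → R
  | [], [] => 1
  | u :: us, x :: xs => rowSum a b c u x us xs (triSum a b c us)
  | _, _ => 0

theorem vertexSum_comm (a b c : R) (h x : Bool) (K : Bool → Bool → R) :
    vertexSum a b c h x K = vertexSum a b c x h fun x h => K h x := by
  cases h <;> cases x <;> simp [vertexSum]

theorem vertexSum_add (a b c : R) (h x : Bool) (K L : Bool → Bool → R) :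
    (vertexSum a b c h x fun h x => K h x + L h x) =
      vertexSum a b c h x K + vertexSum a b c h x L := by
  unfold vertexSum; split_ifs <;> ring

theorem vertexSum_smul (a b c : R) (h x : Bool) (k : R) (K : Bool → Bool → R) :
    (vertexSum a b c h x fun h x => k * K h x) = k * vertexSum a b c h x K := by
  unfold vertexSum; split_ifs <;> ring

section row
variable (a b : S → S → R) (c : R) (u : S)

theorem rowSum_nil (h : Bool) (G : List Bool → R) :
    rowSum a b c u h [] [] G = if h then G [] else 0 := by
  simp [rowSum]

theorem rowSum_cons (h : Bool) (v : S) (vs : List S) (x : Bool) (xs : List Bool)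
    (G : List Bool → R) :
    rowSum a b c u h (v :: vs) (x :: xs) G =
      vertexSum (a u v) (b u v) c h x fun h y =>
        rowSum a b c u h vs xs fun ys => G (y :: ys) := by
  rw [rowSum]

theorem rowSum_nil_cons (h : Bool) (x : Bool) (xs : List Bool) (G : List Bool → R) :
    rowSum a b c u h [] (x :: xs) G = 0 := by
  simp [rowSum]

theorem rowSum_cons_nil (h : Bool) (v : S) (vs : List S) (G : List Bool → R) :
    rowSum a b c u h (v :: vs) [] G = 0 := by
  simp [rowSum]

theorem rowSum_add (h : Bool) (vs : List S) (xs : List Bool) (G H : List Bool → R) :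
    rowSum a b c u h vs xs (fun ys => G ys + H ys) =
      rowSum a b c u h vs xs G + rowSum a b c u h vs xs H := by
  induction vs generalizing h xs G H with
  | nil => cases xs <;> cases h <;> simp [rowSum_nil, rowSum_nil_cons]
  | cons v vs ih =>
    cases xs with
    | nil => simp [rowSum_cons_nil]
    | cons x xs => simp only [rowSum_cons, ih, vertexSum_add]

theorem rowSum_smul (h : Bool) (vs : List S) (xs : List Bool) (k : R) (G : List Bool → R) :
    rowSum a b c u h vs xs (fun ys => k * G ys) = k * rowSum a b c u h vs xs G := by
  induction vs generalizing h xs G with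
  | nil => cases xs <;> cases h <;> simp [rowSum_nil, rowSum_nil_cons]
  | cons v vs ih =>
    cases xs with
    | nil => simp [rowSum_cons_nil]
    | cons x xs => simp only [rowSum_cons, ih, vertexSum_smul]

theorem rowSum_sub (h : Bool) (vs : List S) (xs : List Bool) (G H : List Bool → R) :
    rowSum a b c u h vs xs (fun ys => G ys - H ys) =
      rowSum a b c u h vs xs G - rowSum a b c u h vs xs H := by
  have := rowSum_add a b c u h vs xs (fun ys => G ys - H ys) H
  simp only [sub_add_cancel] at this
  exact eq_sub_of_add_eq this.symm

theorem rowSum_vertexSum (h : Bool) (vs : List S) (xs : List Bool) (a' b' c' : R) (k x : Bool)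
    (G : Bool → Bool → List Bool → R) :
    (rowSum a b c u h vs xs fun ys => vertexSum a' b' c' k x fun k x => G k x ys) =
      vertexSum a' b' c' k x fun k x => rowSum a b c u h vs xs fun ys => G k x ys := by
  unfold vertexSum
  split_ifs
  · rw [rowSum_add, rowSum_smul, rowSum_smul]
  · rw [rowSum_smul]

end row

theorem triSum_nil (a b : S → S → R) (c : R) : triSum a b c [] [] = 1 := by
  rw [triSum]

theorem triSum_cons (a b : S → S → R) (c : R) (u : S) (us : List S) (x : Bool) (xs : List Bool) :
    triSum a b c (u :: us) (x :: xs) = rowSum a b c u x us xs (triSum a b c us) := by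
  rw [triSum]

noncomputable section

/-- The difference of a real number and its inverse. -/
def brack (x : ℝ) : ℝ := x - x⁻¹

/-- The six-vertex weight of vertices with equal incoming states that are not exchanged. -/
def wa (q u v : ℝ) : ℝ := brack (q * u * v)

/-- The six-vertex weight of vertices with distinct incoming states. -/
def wb (q u v : ℝ) : ℝ := brack (q * u⁻¹ * v⁻¹)

/-- The six-vertex weight of vertices whose incoming states are equal and both change. -/
def wc (q : ℝ) : ℝ := brack (q ^ 2)

/-- The action on functions of two states of the R-matrix with spectral parameter `z`. -/
def braid (q z : ℝ) (x y : Bool) (G : Bool → Bool → ℝ) : ℝ :=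
  if x = y then brack (q ^ 2 * z) * G x y else wc q * G x y - brack z * G y x

end

section YangBaxter
variable {q u v w : ℝ}

theorem wa_comm (u v : ℝ) : wa q u v = wa q v u := by
  rw [wa, wa, mul_right_comm]

theorem wb_comm (u v : ℝ) : wb q u v = wb q v u := by
  rw [wb, wb, mul_right_comm]

theorem yang_baxter (hq : q ≠ 0) (hu : u ≠ 0) (hv : v ≠ 0) (hw : w ≠ 0)
    (X X' : Bool → Bool → Bool → ℝ)
    (hX : ∀ h x y, brack (q ^ 2 * (v / w)) * X h x y = braid q (v / w) x y (X' h))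
    (h x y : Bool) :
    brack (q ^ 2 * (v / w)) *
        (vertexSum (wa q u v) (wb q u v) (wc q) h x fun h x =>
          vertexSum (wa q u w) (wb q u w) (wc q) h y fun h y => X h x y) =
      braid q (v / w) x y fun x y =>
        vertexSum (wa q u w) (wb q u w) (wc q) h x fun h x =>
          vertexSum (wa q u v) (wb q u v) (wc q) h y fun h y => X' h x y := by
  have k1 := fun h => hX h true true
  have k2 := fun h => hX h true false
  have k3 := fun h => hX h false true
  have k4 := fun h => hX h false false
  simp only [braid, reduceCtorEq, if_true, if_false] at k1 k2 k3 k4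
  cases h <;> cases x <;> cases y <;>
    simp only [vertexSum, braid, reduceCtorEq, if_true, if_false, Bool.not_true,
      Bool.not_false]
  · linear_combination (norm := skip) wa q u v * wa q u w * k4 false +
      wa q u v * wc q * k3 true + wc q * wb q u w * k2 true
    simp only [wa, wb, wc, brack]; field_simp; ring
  · linear_combination (norm := skip) wa q u v * wb q u w * k3 false +
      wc q * wa q u w * k1 true + wc q * wc q * k2 false
    simp only [wa, wb, wc, brack]; field_simp; ring
  · linear_combination (norm := skip) wb q u v * wa q u w * k2 false + wb q u v * wc q * k1 true
    simp only [wa, wb, wc, brack]; field_simp; ring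
  · linear_combination wb q u v * wb q u w * k1 false
  · linear_combination wb q u v * wb q u w * k4 true
  · linear_combination (norm := skip) wb q u v * wa q u w * k3 true + wb q u v * wc q * k4 false
    simp only [wa, wb, wc, brack]; field_simp; ring
  · linear_combination (norm := skip) wa q u v * wb q u w * k2 true +
      wc q * wa q u w * k4 false + wc q * wc q * k3 true
    simp only [wa, wb, wc, brack]; field_simp; ring
  · linear_combination (norm := skip) wa q u v * wa q u w * k1 true +
      wa q u v * wc q * k2 false + wc q * wb q u w * k3 false
    simp only [wa, wb, wc, brack]; field_simp; ring

theorem rowSum_swap (hq : q ≠ 0) (hu : u ≠ 0) (hv : v ≠ 0) (hw : w ≠ 0)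
    (pre post : List ℝ) (xp : List Bool) (hl : xp.length = pre.length) (x y : Bool)
    (xs : List Bool) (h : Bool) (G G' : List Bool → ℝ)
    (hG : ∀ yp : List Bool, yp.length = pre.length → ∀ x y ys,
      brack (q ^ 2 * (v / w)) * G (yp ++ x :: y :: ys) =
        braid q (v / w) x y fun x y => G' (yp ++ x :: y :: ys)) :
    brack (q ^ 2 * (v / w)) *
        rowSum (wa q) (wb q) (wc q) u h (pre ++ v :: w :: post) (xp ++ x :: y :: xs) G =
      braid q (v / w) x y fun x y =>
        rowSum (wa q) (wb q) (wc q) u h (pre ++ w :: v :: post) (xp ++ x :: y :: xs) G' := by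
  induction pre generalizing xp h G G' with
  | nil =>
    obtain rfl := List.length_eq_zero_iff.1 hl
    have hG := hG [] rfl
    simp only [List.nil_append, rowSum_cons] at hG ⊢
    refine yang_baxter hq hu hv hw
      (fun h x y => rowSum _ _ _ u h post xs fun ys => G (x :: y :: ys))
      (fun h x y => rowSum _ _ _ u h post xs fun ys => G' (x :: y :: ys)) ?_ h x y
    intro h x y
    rw [← rowSum_smul]
    simp only [hG]
    unfold braid
    split_ifs
    · rw [rowSum_smul]
    · rw [rowSum_sub, rowSum_smul, rowSum_smul]
  | cons p pre ih =>
    match xp, hl with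
    | x0 :: xp, hl =>
      have key := fun h y0 => ih xp (by simpa using hl) h (fun ys => G (y0 :: ys))
        (fun ys => G' (y0 :: ys)) fun yp hyp x y ys => hG (y0 :: yp) (by simp [hyp]) x y ys
      simp only [List.cons_append, rowSum_cons]
      rw [← vertexSum_smul]
      simp only [key]
      unfold braid vertexSum
      split_ifs <;> ring

theorem rowSum_rowSum_swap (hq : q ≠ 0) (hv : v ≠ 0) (hw : w ≠ 0)
    (us : List ℝ) (hus : ∀ u ∈ us, u ≠ 0) (xs : List Bool) (h k : Bool) (G : List Bool → ℝ) :
    brack (q ^ 2 * (v / w)) *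
        rowSum (wa q) (wb q) (wc q) v h us xs
          (fun ys => rowSum (wa q) (wb q) (wc q) w k us ys G) =
      braid q (v / w) h k fun h k =>
        rowSum (wa q) (wb q) (wc q) w h us xs
          (fun ys => rowSum (wa q) (wb q) (wc q) v k us ys G) := by
  induction us generalizing xs h k G with
  | nil =>
    cases xs <;> cases h <;> cases k <;> simp [rowSum_nil, rowSum_nil_cons, braid]
  | cons u us ih =>
    cases xs with
    | nil => simp [rowSum_cons_nil, braid]
    | cons x xs =>
      have key : ∀ v w h k, rowSum (wa q) (wb q) (wc q) v h (u :: us) (x :: xs)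
          (fun ys => rowSum (wa q) (wb q) (wc q) w k (u :: us) ys G) =
            vertexSum (wa q u v) (wb q u v) (wc q) x h fun x h =>
              vertexSum (wa q u w) (wb q u w) (wc q) x k fun x k =>
                rowSum (wa q) (wb q) (wc q) v h us xs fun ys =>
                  rowSum (wa q) (wb q) (wc q) w k us ys fun ys => G (x :: ys) := by
        intro v w h k
        simp only [rowSum_cons, rowSum_vertexSum]
        rw [vertexSum_comm, wa_comm, wb_comm]
        congr! 3
        rw [vertexSum_comm, wa_comm, wb_comm]
      simp only [key]
      exact yang_baxter hq (hus u (by simp)) hv hw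
        (fun x h k => rowSum (wa q) (wb q) (wc q) v h us xs fun ys =>
          rowSum (wa q) (wb q) (wc q) w k us ys fun ys => G (x :: ys))
        (fun x h k => rowSum (wa q) (wb q) (wc q) w h us xs fun ys =>
          rowSum (wa q) (wb q) (wc q) v k us ys fun ys => G (x :: ys))
        (fun x h k => ih (fun u hu => hus u (by simp [hu])) xs h k _) x h k

theorem triSum_swap (hq : q ≠ 0) (hv : v ≠ 0) (hw : w ≠ 0)
    (pre post : List ℝ) (hpre : ∀ u ∈ pre, u ≠ 0) (hpost : ∀ u ∈ post, u ≠ 0)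
    (xp : List Bool) (hl : xp.length = pre.length) (x y : Bool) (xs : List Bool) :
    brack (q ^ 2 * (v / w)) *
        triSum (wa q) (wb q) (wc q) (pre ++ v :: w :: post) (xp ++ x :: y :: xs) =
      braid q (v / w) x y fun x y =>
        triSum (wa q) (wb q) (wc q) (pre ++ w :: v :: post) (xp ++ x :: y :: xs) := by
  induction pre generalizing xp x y xs with
  | nil =>
    obtain rfl := List.length_eq_zero_iff.1 hl
    have key := fun h k => rowSum_rowSum_swap (q := q) hq hv hw post hpost xs h k
      (triSum (wa q) (wb q) (wc q) post)
    simp only [List.nil_append, triSum_cons, rowSum_cons]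
    rw [wa_comm w v, wb_comm w v, ← vertexSum_smul]
    simp only [key]
    cases x <;> cases y <;> simp [vertexSum, braid] <;> ring
  | cons p pre ih =>
    match xp, hl with
    | x0 :: xp, hl =>
      simp only [List.cons_append, triSum_cons]
      exact rowSum_swap hq (hpre p (by simp)) hv hw pre post xp (by simpa using hl) x y xs x0 _ _
        fun yp hyp x y ys => ih (fun u hu => hpre u (by simp [hu])) yp hyp x y ys

end YangBaxter

section evaluation
variable (a b : S → S → R) (c : R)

theorem rowSum_congr (u : S) (h : Bool) (vs : List S) (xs : List Bool) {G G' : List Bool → R}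
    (hG : ∀ ys : List Bool, ys.length = vs.length → G ys = G' ys) :
    rowSum a b c u h vs xs G = rowSum a b c u h vs xs G' := by
  induction vs generalizing h xs G G' with
  | nil => cases xs <;> simp [rowSum_nil, rowSum_nil_cons, hG]
  | cons v vs ih =>
    cases xs with
    | nil => simp [rowSum_cons_nil]
    | cons x xs =>
      simp only [rowSum_cons]
      congr! 3 with h y
      exact ih h xs fun ys hys => hG _ (by simp [hys])

theorem rowSum_true_replicate (u : S) (vs : List S) (G : List Bool → R) :
    rowSum a b c u true vs (.replicate vs.length false) G =
      (vs.map (b u)).prod * G (.replicate vs.length false) := by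
  induction vs generalizing G with
  | nil => simp [rowSum_nil]
  | cons v vs ih =>
    simp [List.replicate_succ, rowSum_cons, vertexSum, ih, mul_assoc]

theorem rowSum_false_replicate_cons (u v : S) (vs : List S) (G : List Bool → R) :
    rowSum a b c u false (v :: vs) (.replicate (v :: vs).length false) G =
      a u v * rowSum a b c u false vs (.replicate vs.length false) (fun ys => G (false :: ys)) +
        c * (vs.map (b u)).prod * G (true :: .replicate vs.length false) := by
  simp [List.replicate_succ, rowSum_cons, vertexSum, rowSum_true_replicate, mul_assoc]

theorem triSum_replicate_of_wa_eq_zero {u v : S} (h : a u v = 0) (ws : List S) :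
    triSum a b c (u :: v :: ws) (.replicate (u :: v :: ws).length false) =
      c * (ws.map (b u)).prod * (ws.map (b v)).prod *
        triSum a b c ws (.replicate ws.length false) := by
  rw [List.length_cons, List.replicate_succ, triSum_cons, rowSum_false_replicate_cons, h,
    triSum_cons, rowSum_true_replicate]
  ring

theorem rowSum_append_true (v l : S) (h : Bool) (us : List S) (xs : List Bool)
    (hl : xs.length = us.length) (G : List Bool → R) :
    rowSum a b c v h (us ++ [l]) (xs ++ [true]) G =
      a v l * rowSum a b c v h us xs fun ys => G (ys ++ [true]) := by
  induction us generalizing h xs G with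
  | nil =>
    obtain rfl := List.length_eq_zero_iff.1 hl
    cases h <;> simp [rowSum_cons, rowSum_nil, vertexSum]
  | cons u us ih =>
    match xs, hl with
    | x :: xs, hl =>
      simp only [List.cons_append, rowSum_cons, ih _ xs (by simpa using hl), vertexSum_smul]

theorem triSum_append_true (l : S) (us : List S) (xs : List Bool) (hl : xs.length = us.length) :
    triSum a b c (us ++ [l]) (xs ++ [true]) = (us.map (a · l)).prod * triSum a b c us xs := by
  induction us generalizing xs with
  | nil =>
    obtain rfl := List.length_eq_zero_iff.1 hl
    simp [triSum_cons, triSum_nil, rowSum_nil]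
  | cons u us ih =>
    match xs, hl with
    | x :: xs, hl =>
      have hl : xs.length = us.length := by simpa using hl
      rw [List.cons_append, List.cons_append, triSum_cons, rowSum_append_true _ _ _ _ _ _ _ _ hl,
        rowSum_congr a b c u x us xs fun ys hys => ih ys hys, rowSum_smul, triSum_cons]
      simp [mul_assoc]

theorem rowSum_false_replicate_append {u l : S} (h : b u l = 0) (vs : List S) (G : List Bool → R) :
    rowSum a b c u false (vs ++ [l]) (.replicate (vs ++ [l]).length false) G =
      (vs.map (a u)).prod * c * G (.replicate vs.length false ++ [true]) := by
  induction vs generalizing G with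
  | nil => simp [rowSum_cons, rowSum_nil, vertexSum]
  | cons v vs ih =>
    rw [List.cons_append, rowSum_false_replicate_cons, ih]
    simp [h, List.replicate_succ, mul_assoc]

theorem triSum_replicate_of_wb_eq_zero {u l : S} (h : b u l = 0) (vs : List S) :
    triSum a b c (u :: (vs ++ [l])) (.replicate (u :: (vs ++ [l])).length false) =
      c * (vs.map (a u)).prod * (vs.map (a · l)).prod *
        triSum a b c vs (.replicate vs.length false) := by
  rw [List.length_cons, List.replicate_succ, triSum_cons, rowSum_false_replicate_append a b c h,
    triSum_append_true _ _ _ _ _ _ (by simp)]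
  ring

end evaluation

open Polynomial in
theorem exists_polynomial_prod (b : ℝ → ℝ → ℝ) (g : ℝ → ℝ)
    (hb : ∀ v, ∃ α β, ∀ u ≠ 0, u * b (g u) v = α + β * u ^ 2) (vs : List ℝ) :
    ∃ p : ℝ[X], p.degree < (vs.length + 1 : ℕ) ∧
      ∀ u ≠ 0, u ^ vs.length * (vs.map (b (g u))).prod = p.eval (u ^ 2) := by
  induction vs with
  | nil => exact ⟨1, by simp, by simp⟩
  | cons v vs ih =>
    obtain ⟨p, hp, h⟩ := ih
    obtain ⟨α, β, hv⟩ := hb v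
    refine ⟨C α * p + C β * (X * p), ?_, fun u hu => ?_⟩
    · rw [degree_lt_iff_coeff_zero] at hp ⊢
      intro n hn
      obtain ⟨n, rfl⟩ : ∃ k, n = k + 1 := ⟨n - 1, by simp at hn; omega⟩
      simp only [List.length_cons] at hn
      simp [hp n (by omega), hp (n + 1) (by omega)]
    · simp only [List.length_cons, List.map_cons, List.prod_cons, eval_add, eval_mul, eval_C,
        eval_X, ← h u hu]
      linear_combination (u ^ vs.length * (vs.map (b (g u))).prod) * hv u hu

open Polynomial in
theorem exists_polynomial_rowSum (a b : ℝ → ℝ → ℝ) (c : ℝ) (g : ℝ → ℝ)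
    (ha : ∀ v, ∃ α β, ∀ u ≠ 0, u * a (g u) v = α + β * u ^ 2)
    (hb : ∀ v, ∃ α β, ∀ u ≠ 0, u * b (g u) v = α + β * u ^ 2)
    (vs : List ℝ) (G : List Bool → ℝ) :
    ∃ p : ℝ[X], p.degree < (vs.length : ℕ) ∧ ∀ u ≠ 0,
      u ^ vs.length * rowSum a b c (g u) false vs (.replicate vs.length false) G =
        u * p.eval (u ^ 2) := by
  induction vs generalizing G with
  | nil => exact ⟨0, by simp, by simp [rowSum_nil]⟩
  | cons v vs ih =>
    obtain ⟨p, hp, h⟩ := ih fun ys => G (false :: ys)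
    obtain ⟨p', hp', h'⟩ := exists_polynomial_prod b g hb vs
    obtain ⟨α, β, hv⟩ := ha v
    refine ⟨C α * p + C β * (X * p) + C (c * G (true :: .replicate vs.length false)) * p', ?_,
      fun u hu => ?_⟩
    · rw [degree_lt_iff_coeff_zero] at hp hp' ⊢
      intro n hn
      obtain ⟨n, rfl⟩ : ∃ k, n = k + 1 := ⟨n - 1, by simp at hn; omega⟩
      simp only [List.length_cons] at hn
      simp only [coeff_add, coeff_C_mul, coeff_X_mul, hp n (by omega), hp (n + 1) (by omega),
        hp' (n + 1) (by omega), mul_zero, add_zero]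
    · rw [rowSum_false_replicate_cons]
      simp only [List.length_cons, eval_add, eval_mul, eval_C, eval_X, ← h' u hu]
      linear_combination (α + β * u ^ 2) * h u hu +
        (u ^ vs.length * rowSum a b c (g u) false vs (.replicate vs.length false)
          fun ys => G (false :: ys)) * hv u hu

/-- The entries of `l` are positive with pairwise ratios less than `q`. -/
def RatioLT (q : ℝ) (l : List ℝ) : Prop := ∀ u ∈ l, 0 < u ∧ ∀ v ∈ l, u < q * v

theorem RatioLT.mono {q : ℝ} {l l' : List ℝ} (h : RatioLT q l) (hl : l' ⊆ l) : RatioLT q l' :=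
  fun u hu => ⟨(h u (hl hu)).1, fun v hv => (h u (hl hu)).2 v (hl hv)⟩

theorem RatioLT.map_inv {q : ℝ} {l : List ℝ} (h : RatioLT q l) :
    RatioLT q (l.map (·⁻¹)) := by
  intro _ hu'
  obtain ⟨u, hu, rfl⟩ := List.mem_map.1 hu'
  have hu0 := (h u hu).1
  refine ⟨inv_pos.2 hu0, fun _ hv' => ?_⟩
  obtain ⟨v, hv, rfl⟩ := List.mem_map.1 hv'
  have hv0 := (h v hv).1
  have := (h v hv).2 u hu
  rw [← div_eq_mul_inv, lt_div_iff₀ hv0, inv_mul_lt_iff₀ hu0]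
  linarith

theorem brack_pos {x : ℝ} (hx : 1 < x) : 0 < brack x := by
  have := inv_lt_one_of_one_lt₀ hx
  unfold brack; linarith

theorem triSum_perm {q : ℝ} (hq : 1 < q) {l l' : List ℝ} (hl : l.Perm l') (hc : RatioLT q l)
    (pre : List ℝ) (hpre : ∀ u ∈ pre, u ≠ 0) :
    triSum (wa q) (wb q) (wc q) (pre ++ l) (.replicate (pre ++ l).length false) =
      triSum (wa q) (wb q) (wc q) (pre ++ l') (.replicate (pre ++ l').length false) := by
  induction hl generalizing pre with
  | nil => rfl
  | cons x hl ih =>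
    have := ih (hc.mono (by simp)) (pre ++ [x]) (by
      simp only [List.mem_append, List.mem_singleton]
      rintro u (hu | rfl)
      · exact hpre u hu
      · exact (hc u (by simp)).1.ne')
    simpa using this
  | swap x y l =>
    have hx := (hc x (by simp)).1
    have hy := (hc y (by simp)).1
    have hxy := (hc x (by simp)).2 y (by simp)
    have hb : 0 < brack (q ^ 2 * (y / x)) := by
      apply brack_pos
      rw [← mul_div_assoc, one_lt_div hx]
      nlinarith [mul_pos (sub_pos.2 hq) hy]
    have key := triSum_swap (q := q) (by positivity) hy.ne' hx.ne' pre l hpre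
      (fun u hu => (hc u (by simp [hu])).1.ne') (.replicate pre.length false) (by simp)
      false false (.replicate l.length false)
    have := mul_left_cancel₀ hb.ne' (key.trans (by rw [braid, if_pos rfl]))
    have hr : ∀ x y : ℝ, List.replicate (pre ++ x :: y :: l).length false =
        .replicate pre.length false ++ false :: false :: .replicate l.length false := by
      intro x y
      rw [List.length_append, List.replicate_add]
      rfl
    rwa [hr, hr]
  | trans h₁ h₂ ih₁ ih₂ =>
    exact (ih₁ hc pre hpre).trans (ih₂ (hc.mono h₁.symm.subset) pre hpre)

open Polynomial in
theorem triSum_cons_inv {q : ℝ} (hq : 1 < q) (vs : List ℝ) (hnd : vs.Nodup) (hc : RatioLT q vs)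
    (ih : ∀ ws : List ℝ, ws.length + 1 = vs.length → ws.Nodup → RatioLT q ws →
      triSum (wa q) (wb q) (wc q) ws (.replicate ws.length false) =
        triSum (wa q) (wb q) (wc q) (ws.map (·⁻¹)) (.replicate ws.length false))
    (u : ℝ) (hu : u ≠ 0) :
    triSum (wa q) (wb q) (wc q) (u :: vs) (.replicate (u :: vs).length false) =
      triSum (wa q) (wb q) (wc q) (u⁻¹ :: vs.map (·⁻¹)) (.replicate (u :: vs).length false) := by
  have hq0 : 0 < q := by linarith
  obtain ⟨f, hf, hf'⟩ := exists_polynomial_rowSum (wa q) (wb q) (wc q) id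
    (fun v => ⟨-(q⁻¹ * v⁻¹), q * v, fun u hu => by
      simp only [id, wa, brack, mul_inv]
      linear_combination (-q⁻¹ * v⁻¹) * mul_inv_cancel₀ hu⟩)
    (fun v => ⟨q * v⁻¹, -(q⁻¹ * v), fun u hu => by
      simp only [id, wb, brack, mul_inv, inv_inv]
      linear_combination (q * v⁻¹) * mul_inv_cancel₀ hu⟩)
    vs (triSum (wa q) (wb q) (wc q) vs)
  obtain ⟨g, hg, hg'⟩ := exists_polynomial_rowSum (wa q) (wb q) (wc q) (·⁻¹)
    (fun v => ⟨q * v, -(q⁻¹ * v⁻¹), fun u hu => by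
      simp only [wa, brack, mul_inv, inv_inv]
      linear_combination (q * v) * mul_inv_cancel₀ hu⟩)
    (fun v => ⟨-(q⁻¹ * v), q * v⁻¹, fun u hu => by
      simp only [wb, brack, mul_inv, inv_inv]
      linear_combination (-q⁻¹ * v) * mul_inv_cancel₀ hu⟩)
    (vs.map (·⁻¹)) (triSum (wa q) (wb q) (wc q) (vs.map (·⁻¹)))
  simp only [List.length_map, id] at hf' hg' hg
  have hZ : ∀ u (vs : List ℝ),
      triSum (wa q) (wb q) (wc q) (u :: vs) (.replicate (vs.length + 1) false) =
        rowSum (wa q) (wb q) (wc q) u false vs (.replicate vs.length false)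
          (triSum (wa q) (wb q) (wc q) vs) := by
    intro u vs
    rw [List.replicate_succ, triSum_cons]
  have hZ' := fun u => hZ u (vs.map (·⁻¹))
  simp only [List.length_map] at hZ'
  simp only [← hZ, ← hZ'] at hf' hg'
  suffices hfg : f = g by
    have h := (hf' u hu).trans (hfg ▸ (hg' u hu).symm)
    exact mul_left_cancel₀ (pow_ne_zero _ hu) h
  have hcard : (vs.toFinset.image fun v => ((q * v)⁻¹) ^ 2).card = vs.length := by
    rw [Finset.card_image_of_injOn, List.toFinset_card_of_nodup hnd]
    intro v hv w hw hvw
    have hv0 := (hc v (by simpa using hv)).1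
    have hw0 := (hc w (by simpa using hw)).1
    have := (pow_left_inj₀ (by positivity) (by positivity) two_ne_zero).1 hvw
    exact mul_left_cancel₀ hq0.ne' (inv_injective this)
  refine eq_of_degrees_lt_of_eval_finset_eq _ (hcard ▸ hf) (hcard ▸ hg) ?_
  intro U hU
  obtain ⟨v, hv, rfl⟩ := Finset.mem_image.1 hU
  have hv : v ∈ vs := by simpa using hv
  have hv0 := (hc v hv).1
  have hu : (q * v)⁻¹ ≠ 0 := by positivity
  have key : triSum (wa q) (wb q) (wc q) ((q * v)⁻¹ :: vs) (.replicate (vs.length + 1) false) =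
      triSum (wa q) (wb q) (wc q) ((q * v)⁻¹⁻¹ :: vs.map (·⁻¹))
        (.replicate (vs.length + 1) false) := by
    have hp : vs.Perm (v :: vs.erase v) := List.perm_cons_erase hv
    have hlen : (vs.erase v).length + 1 = vs.length := by
      rw [hp.length_eq]; rfl
    have h1 := triSum_perm hq hp hc [(q * v)⁻¹] (by simpa using hu)
    have h2 := triSum_perm hq ((hp.trans (List.perm_append_singleton v _).symm).map (·⁻¹))
      hc.map_inv [(q * v)⁻¹⁻¹]
      (by simpa [and_comm] using hu)
    simp only [List.singleton_append, List.map_append, List.map_cons, List.map_nil] at h1 h2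
    rw [triSum_replicate_of_wa_eq_zero] at h1
    · rw [triSum_replicate_of_wb_eq_zero] at h2
      · simp only [List.length_cons, List.length_map] at h1 h2
        rw [h1, h2, ih _ hlen (hnd.erase v) (hc.mono List.erase_subset)]
        simp only [List.map_map]
        congr! 4
        ext w
        simp [wa, wb, mul_right_comm]
      · rw [wb, show q * (q * v)⁻¹⁻¹⁻¹ * v⁻¹⁻¹ = 1 by field_simp, brack, inv_one, sub_self]
    · rw [wa, show q * (q * v)⁻¹ * v = 1 by field_simp, brack, inv_one, sub_self]
  have := hf' _ hu
  rw [key, hg' _ hu] at this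
  exact (mul_left_cancel₀ hu this).symm

theorem triSum_map_inv {q : ℝ} (hq : 1 < q) (k : ℕ) (vs : List ℝ) (hk : vs.length = 2 * k)
    (hnd : vs.Nodup) (hc : RatioLT q vs) :
    triSum (wa q) (wb q) (wc q) vs (.replicate vs.length false) =
      triSum (wa q) (wb q) (wc q) (vs.map (·⁻¹)) (.replicate vs.length false) := by
  induction k generalizing vs with
  | zero =>
    obtain rfl := List.length_eq_zero_iff.1 hk
    rfl
  | succ k ih =>
    match vs, hk with
    | u :: vs, hk =>
      exact triSum_cons_inv hq vs hnd.of_cons (hc.mono (by simp))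
        (fun ws hws => ih ws (by simp at hk; omega)) u (hc u (by simp)).1.ne'

theorem continuousAt_brack {f : ℝ → ℝ} {x : ℝ} (hf : ContinuousAt f x) (h : f x ≠ 0) :
    ContinuousAt (fun y => brack (f y)) x :=
  hf.sub (hf.inv₀ h)

theorem continuousAt_rowSum {q : ℝ} (hq : q ≠ 0) {x : ℝ} {f : ℝ → ℝ} (hf : ContinuousAt f x)
    (hf0 : f x ≠ 0) (gs : List (ℝ → ℝ)) (hgs : ∀ g ∈ gs, ContinuousAt g x ∧ g x ≠ 0) (h : Bool)
    (xs : List Bool) (G : ℝ → List Bool → ℝ) (hG : ∀ ys, ContinuousAt (fun y => G y ys) x) :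
    ContinuousAt (fun y => rowSum (wa q) (wb q) (wc q) (f y) h (gs.map (· y)) xs (G y)) x := by
  induction gs generalizing h xs G with
  | nil =>
    cases xs with
    | nil => cases h <;> simp [rowSum_nil, continuousAt_const, hG]
    | cons => simp [rowSum_nil_cons, continuousAt_const]
  | cons g gs ih =>
    cases xs with
    | nil => simp [rowSum_cons_nil, continuousAt_const]
    | cons x' xs =>
      obtain ⟨hg, hg0⟩ := hgs g (by simp)
      have ih := fun h y => ih (fun g hg => hgs g (by simp [hg])) h xs (fun z ys => G z (y :: ys))
        fun ys => hG _
      have ha : ContinuousAt (fun y => wa q (f y) (g y)) x :=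
        continuousAt_brack ((continuousAt_const.mul hf).mul hg)
          (mul_ne_zero (mul_ne_zero hq hf0) hg0)
      have hb : ContinuousAt (fun y => wb q (f y) (g y)) x :=
        continuousAt_brack ((continuousAt_const.mul (hf.inv₀ hf0)).mul (hg.inv₀ hg0))
          (mul_ne_zero (mul_ne_zero hq (inv_ne_zero hf0)) (inv_ne_zero hg0))
      simp only [List.map_cons, rowSum_cons, vertexSum]
      split_ifs
      · exact (ha.mul (ih _ _)).add (continuousAt_const.mul (ih _ _))
      · exact hb.mul (ih _ _)

theorem continuousAt_triSum {q : ℝ} (hq : q ≠ 0) {x : ℝ} (gs : List (ℝ → ℝ))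
    (hgs : ∀ g ∈ gs, ContinuousAt g x ∧ g x ≠ 0) (xs : List Bool) :
    ContinuousAt (fun y => triSum (wa q) (wb q) (wc q) (gs.map (· y)) xs) x := by
  induction gs generalizing xs with
  | nil => exact continuousAt_const
  | cons g gs ih =>
    cases xs with
    | nil => exact continuousAt_const
    | cons x' xs =>
      have hgs' : ∀ g ∈ gs, ContinuousAt g x ∧ g x ≠ 0 := fun g hg => hgs g (by simp [hg])
      simp only [List.map_cons, triSum_cons]
      exact continuousAt_rowSum hq (hgs g (by simp)).1 (hgs g (by simp)).2 gs hgs' x' xs _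
        (ih hgs')

open Topology in
theorem triSum_cons_replicate_one_inv {q : ℝ} (hq : 1 < q) (k : ℕ) {u : ℝ} (hu : u ≠ 0) :
    triSum (wa q) (wb q) (wc q) (u :: .replicate (2 * k + 1) 1) (.replicate (2 * k + 2) false) =
      triSum (wa q) (wb q) (wc q) (u⁻¹ :: .replicate (2 * k + 1) 1)
        (.replicate (2 * k + 2) false) := by
  have hq0 : q ≠ 0 := by positivity
  set gs : List (ℝ → ℝ) :=
    (List.range (2 * k + 1)).map fun (j : ℕ) (ε : ℝ) => 1 + (j : ℝ) * ε with hgs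
  have hgs0 : gs.map (· 0) = .replicate (2 * k + 1) 1 := by
    rw [hgs, List.map_map]
    apply List.eq_replicate_iff.2
    simp
  have hgsc : ∀ g ∈ gs, ContinuousAt g 0 ∧ g 0 ≠ 0 := by
    intro g hg
    obtain ⟨j, -, rfl⟩ := List.mem_map.1 hg
    exact ⟨by fun_prop, by simp⟩
  have h1 := continuousAt_triSum hq0 (x := 0) ((fun _ => u) :: gs)
    (by simpa [hu, continuousAt_const] using hgsc) (.replicate (2 * k + 2) false)
  have h2 := continuousAt_triSum hq0 (x := 0) ((fun _ => u⁻¹) :: gs.map fun g ε => (g ε)⁻¹)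
    (by
      simp only [List.mem_cons, List.mem_map, forall_eq_or_imp, forall_exists_index, and_imp,
        forall_apply_eq_imp_iff₂]
      exact ⟨⟨continuousAt_const, inv_ne_zero hu⟩,
        fun g hg => ⟨(hgsc g hg).1.inv₀ (hgsc g hg).2, inv_ne_zero (hgsc g hg).2⟩⟩)
    (.replicate (2 * k + 2) false)
  have hev : ∀ᶠ ε : ℝ in 𝓝[>] 0, 0 < ε ∧ (2 * k + 1 : ℕ) * ε < q - 1 := by
    refine eventually_mem_nhdsWithin.and (Filter.Eventually.filter_mono nhdsWithin_le_nhds ?_)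
    refine (ContinuousAt.eventually_lt (f := fun ε : ℝ => ((2 * k + 1 : ℕ) : ℝ) * ε) ?_
      (continuousAt_const (y := q - 1)) ?_)
    · fun_prop
    · simpa using hq
  have heq : ∀ᶠ ε : ℝ in 𝓝[>] 0,
      triSum (wa q) (wb q) (wc q) (((fun _ => u) :: gs).map (· ε)) (.replicate (2 * k + 2) false) =
      triSum (wa q) (wb q) (wc q) (((fun _ => u⁻¹) :: gs.map fun g ε => (g ε)⁻¹).map (· ε))
        (.replicate (2 * k + 2) false) := by
    filter_upwards [hev] with ε hε
    obtain ⟨hε, hεq⟩ := hε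
    have hlen : (gs.map (· ε)).length = 2 * k + 1 := by simp [gs]
    have hnd : (gs.map (· ε)).Nodup := by
      rw [hgs, List.map_map]
      refine List.nodup_range.map fun i j hij => ?_
      simpa [hε.ne'] using hij
    have hc : RatioLT q (gs.map (· ε)) := by
      have hbd : ∀ u ∈ gs.map (· ε), 1 ≤ u ∧ u < q := by
        intro u hu
        simp only [hgs, List.map_map, List.mem_map, List.mem_range, Function.comp] at hu
        obtain ⟨j, hj, rfl⟩ := hu
        have hj : (j : ℝ) ≤ (2 * k + 1 : ℕ) := by exact_mod_cast hj.le
        have := mul_le_mul_of_nonneg_right hj hε.le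
        constructor
        · have : 0 ≤ (j : ℝ) * ε := by positivity
          linarith
        · linarith
      intro u hu
      refine ⟨by linarith [(hbd u hu).1], fun v hv => ?_⟩
      have := (hbd u hu).2
      have := (hbd v hv).1
      nlinarith
    have := triSum_cons_inv hq _ hnd hc (fun ws hws hnd hc =>
      triSum_map_inv hq k ws (by omega) hnd hc) u hu
    rw [List.length_cons, hlen] at this
    simpa [Function.comp_def] using this
  have h1' := h1.tendsto.mono_left (nhdsWithin_le_nhds (s := Set.Ioi 0))
  have h2' := h2.tendsto.mono_left (nhdsWithin_le_nhds (s := Set.Ioi 0))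
  have := tendsto_nhds_unique (h1'.congr' heq) h2'
  have hgs0' : (gs.map fun g ε => (g ε)⁻¹).map (· 0) = .replicate (2 * k + 1) 1 := by
    apply List.eq_replicate_iff.2
    simp [gs]
  rwa [List.map_cons, List.map_cons, hgs0, hgs0'] at this

theorem rowSum_replicate_scale {S' : Type*} {a b : S → S → R} {a' b' : S' → S' → R} {c c' s : R}
    {u v : S} {u' v' : S'} (ha : a u v = s * a' u' v') (hb : b u v = s * b' u' v')
    (hc : c = s * c') (h : Bool) (m : ℕ) (xs : List Bool) (G : List Bool → R) :
    rowSum a b c u h (.replicate m v) xs G =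
      s ^ m * rowSum a' b' c' u' h (.replicate m v') xs G := by
  induction m generalizing h xs G with
  | zero => cases xs <;> simp [rowSum_nil, rowSum_nil_cons]
  | succ m ih =>
    cases xs with
    | nil => simp [List.replicate_succ, rowSum_cons_nil]
    | cons x xs =>
      simp only [List.replicate_succ, rowSum_cons, ih, vertexSum_smul]
      rw [ha, hb, hc]
      unfold vertexSum
      split_ifs <;> ring

theorem triSum_replicate_scale {S' : Type*} {a b : S → S → R} {a' b' : S' → S' → R} {c c' s : R}
    {v : S} {v' : S'} (ha : a v v = s * a' v' v') (hb : b v v = s * b' v' v')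
    (hc : c = s * c') (m : ℕ) (xs : List Bool) :
    triSum a b c (.replicate m v) xs =
      s ^ m.choose 2 * triSum a' b' c' (.replicate m v') xs := by
  induction m generalizing xs with
  | zero => cases xs <;> simp [triSum]
  | succ m ih =>
    cases xs with
    | nil => simp [triSum, List.replicate_succ]
    | cons x xs =>
      simp only [List.replicate_succ, triSum_cons]
      rw [rowSum_replicate_scale ha hb hc, funext ih, rowSum_smul, Nat.choose_succ_succ,
        Nat.choose_one_right]
      ring

theorem rowSum_false_replicate (a b : S → S → R) (c : R) (u v : S) (m : ℕ) (G : List Bool → R) :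
    rowSum a b c u false (.replicate m v) (.replicate m false) G =
      ∑ j ∈ range m, a u v ^ j * c * b u v ^ (m - 1 - j) *
        G (.replicate j false ++ true :: .replicate (m - 1 - j) false) := by
  induction m generalizing G with
  | zero => simp [rowSum_nil]
  | succ m ih =>
    have := rowSum_false_replicate_cons a b c u v (.replicate m v) G
    simp only [List.length_replicate, ← List.replicate_succ, ih,
      List.map_replicate, List.prod_replicate] at this
    rw [this, sum_range_succ', mul_sum]
    congr 1
    · refine sum_congr rfl fun j hj => ?_
      have : m + 1 - 1 - (j + 1) = m - 1 - j := by omega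
      rw [this, List.replicate_succ, List.cons_append]
      ring
    · simp

theorem map_rowSum {R' : Type*} [CommRing R'] (f : R →+* R') (a b : S → S → R) (c : R) (u : S)
    (h : Bool) (vs : List S) (xs : List Bool) (G : List Bool → R) :
    f (rowSum a b c u h vs xs G) = rowSum (fun u v => f (a u v)) (fun u v => f (b u v)) (f c) u h
      vs xs fun ys => f (G ys) := by
  induction vs generalizing h xs G with
  | nil => cases xs <;> cases h <;> simp [rowSum_nil, rowSum_nil_cons]
  | cons v vs ih =>
    cases xs with
    | nil => simp [rowSum_cons_nil]
    | cons x xs =>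
      simp only [rowSum_cons, vertexSum, ← ih]
      split_ifs <;> simp

theorem map_triSum {R' : Type*} [CommRing R'] (f : R →+* R') (a b : S → S → R) (c : R)
    (us : List S) (xs : List Bool) :
    f (triSum a b c us xs) =
      triSum (fun u v => f (a u v)) (fun u v => f (b u v)) (f c) us xs := by
  induction us generalizing xs with
  | nil => cases xs <;> simp [triSum]
  | cons u us ih =>
    cases xs with
    | nil => simp [triSum]
    | cons x xs => simp only [triSum_cons, map_rowSum, ih]

/-- The row partition function `rowSum` in which only the changes of state carry a weight. -/
def unitRowSum (r : R) (h : Bool) (xs : List Bool) (G : List Bool → R) : R :=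
  rowSum (fun _ _ => 1) (fun _ _ => 1) r () h (.replicate xs.length ()) xs G

/-- The triangle partition function `triSum` in which only the changes of state carry a weight. -/
def unitTriSum (r : R) (xs : List Bool) : R :=
  triSum (fun _ _ => 1) (fun _ _ => 1) r (.replicate xs.length ()) xs

/-- The list of length `m` whose only entry `true` is that at position `j`. -/
def oneHot (m j : ℕ) : List Bool := .replicate j false ++ true :: .replicate (m - 1 - j) false

theorem length_oneHot {m j : ℕ} (hj : j < m) : (oneHot m j).length = m := by
  simp [oneHot]; omega

theorem map_unitTriSum {R' : Type*} [CommRing R'] (f : R →+* R') (r : R) (xs : List Bool) :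
    f (unitTriSum r xs) = unitTriSum (f r) xs := by
  simp [unitTriSum, map_triSum]

theorem sum_unitTriSum_oneHot_symm {q : ℝ} (hq : 1 < q) (k : ℕ) {t : ℝ} (ht : 0 < t) :
    ∑ j ∈ range (2 * k + 1), unitTriSum (q + q⁻¹) (oneHot (2 * k + 1) j) * t ^ j =
      ∑ j ∈ range (2 * k + 1), unitTriSum (q + q⁻¹) (oneHot (2 * k + 1) j) * t ^ (2 * k - j) := by
  have hq0 : 0 < q := by linarith
  set u : ℝ := √((1 + t * q ^ 2) / (t + q ^ 2)) with hu_def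
  have hu : 0 < u := by positivity
  have hu2 : u ^ 2 * (t + q ^ 2) = 1 + t * q ^ 2 := by
    rw [hu_def, Real.sq_sqrt (by positivity), div_mul_cancel₀ _ (by positivity)]
  set s := brack q with hs_def
  have hs : 0 < s := brack_pos hq
  have hwa : wa q 1 1 = s * 1 := by simp [wa, hs_def]
  have hwb : wb q 1 1 = s * 1 := by simp [wb, hs_def]
  have hwc : wc q = s * (q + q⁻¹) := by
    rw [wc, hs_def, brack, brack]
    field_simp
    ring
  have hab : wa q u 1 = t * wb q u 1 := by
    simp only [wa, wb, brack]
    field_simp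
    linear_combination hu2
  have hb : wb q u 1 ≠ 0 := by
    intro h0
    simp only [wb, brack] at h0
    field_simp at h0
    have : u ^ 2 = q ^ 2 := by linarith
    rw [this] at hu2
    nlinarith [one_lt_pow₀ hq (n := 4) (by norm_num)]
  have hinv : ∀ u, wa q u⁻¹ 1 = wb q u 1 := by simp [wa, wb]
  have key := triSum_cons_replicate_one_inv hq k hu.ne'
  rw [show 2 * k + 2 = (2 * k + 1) + 1 from rfl, List.replicate_succ (n := 2 * k + 1) (a := false),
    triSum_cons, triSum_cons, rowSum_false_replicate, rowSum_false_replicate] at key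
  have hscale : ∀ j ∈ range (2 * k + 1), triSum (wa q) (wb q) (wc q) (.replicate (2 * k + 1) 1)
      (.replicate j false ++ true :: .replicate (2 * k + 1 - 1 - j) false) =
        s ^ (2 * k + 1).choose 2 * unitTriSum (q + q⁻¹) (oneHot (2 * k + 1) j) := by
    intro j hj
    rw [unitTriSum, length_oneHot (by simpa using hj)]
    exact triSum_replicate_scale hwa hwb hwc _ _
  have hA : wc q * wb q u 1 ^ (2 * k) * s ^ (2 * k + 1).choose 2 ≠ 0 := by
    rw [hwc]
    positivity
  apply mul_left_cancel₀ hA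
  rw [mul_sum, mul_sum]
  have hinv' : wb q u⁻¹ 1 = wa q u 1 := by simpa using (hinv u⁻¹).symm
  convert key using 1 <;> refine sum_congr rfl fun j hj => ?_
  · obtain ⟨i, hi⟩ : ∃ i, 2 * k = i + j := ⟨2 * k - j, by simp at hj; omega⟩
    rw [hscale j hj, hab, show 2 * k + 1 - 1 - j = i by omega, hi]
    ring
  · obtain ⟨i, hi⟩ : ∃ i, 2 * k = i + j := ⟨2 * k - j, by simp at hj; omega⟩
    rw [hscale j hj, hinv, hinv', hab, show 2 * k + 1 - 1 - j = i by omega,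
      show 2 * k - j = i by omega, hi]
    ring

open Polynomial in
theorem unitTriSum_oneHot_symm_of_real {q : ℝ} (hq : 1 < q) (k : ℕ) {j : ℕ} (hj : j < 2 * k + 1) :
    unitTriSum (q + q⁻¹) (oneHot (2 * k + 1) j) =
      unitTriSum (q + q⁻¹) (oneHot (2 * k + 1) (2 * k - j)) := by
  set f : ℕ → ℝ := fun j => unitTriSum (q + q⁻¹) (oneHot (2 * k + 1) j)
  have h : ∑ j ∈ range (2 * k + 1), C (f j) * X ^ j =
      ∑ j ∈ range (2 * k + 1), C (f (2 * k - j)) * X ^ j := by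
    apply eq_of_infinite_eval_eq
    refine (Set.Ioi_infinite (0 : ℝ)).mono fun t ht => ?_
    have := sum_unitTriSum_oneHot_symm hq k ht
    rw [← sum_range_reflect (fun j => _ * t ^ (2 * k - j))] at this
    simp only [Set.mem_ofPred_eq, eval_finsetSum, eval_mul, eval_C, eval_pow, eval_X]
    rw [this]
    refine sum_congr rfl fun j hj => ?_
    rw [show 2 * k + 1 - 1 - j = 2 * k - j by omega,
      show 2 * k - (2 * k - j) = j by simp at hj; omega]
  have := congrArg (coeff · j) h
  simpa [finsetSum_coeff, coeff_X_pow, hj, Nat.lt_succ_iff] using this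

open Polynomial in
theorem unitTriSum_oneHot_symm (r : R) (k : ℕ) {j : ℕ} (hj : j < 2 * k + 1) :
    unitTriSum r (oneHot (2 * k + 1) j) = unitTriSum r (oneHot (2 * k + 1) (2 * k - j)) := by
  have hX : unitTriSum (X : ℤ[X]) (oneHot (2 * k + 1) j) =
      unitTriSum X (oneHot (2 * k + 1) (2 * k - j)) := by
    apply map_injective (Int.castRingHom ℝ) Int.cast_injective
    apply eq_of_infinite_eval_eq
    refine (Set.Ioi_infinite (2 : ℝ)).mono fun r hr => ?_
    have hr : 2 < r := hr
    have hsq : 0 ≤ r ^ 2 - 4 := by nlinarith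
    have h0 := Real.sqrt_nonneg (r ^ 2 - 4)
    set q : ℝ := (r + √(r ^ 2 - 4)) / 2 with hq
    have hqr : q + q⁻¹ = r := by
      have hq0 : q ≠ 0 := by positivity
      have := Real.sq_sqrt hsq
      field_simp
      rw [hq]
      linear_combination this / 4
    have h1 : 1 < q := by linarith
    have := unitTriSum_oneHot_symm_of_real h1 k hj
    rw [hqr] at this
    have hev (xs : List Bool) : eval r (map (Int.castRingHom ℝ) (unitTriSum X xs)) =
        unitTriSum r xs := by
      rw [← coe_evalRingHom, ← coe_mapRingHom, map_unitTriSum, map_unitTriSum]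
      simp
    simpa [hev] using this
  simpa [map_unitTriSum] using congrArg (eval₂RingHom (Int.castRingHom R) r) hX

theorem unitRowSum_nil (r : R) (h : Bool) (G : List Bool → R) :
    unitRowSum r h [] G = if h then G [] else 0 := by
  rw [unitRowSum, List.length_nil, List.replicate_zero, rowSum_nil]

theorem unitRowSum_cons (r : R) (h x : Bool) (xs : List Bool) (G : List Bool → R) :
    unitRowSum r h (x :: xs) G =
      vertexSum 1 1 r h x fun h y => unitRowSum r h xs fun ys => G (y :: ys) := by
  simp only [unitRowSum, List.length_cons, List.replicate_succ, rowSum_cons]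

theorem unitTriSum_cons (r : R) (x : Bool) (xs : List Bool) :
    unitTriSum r (x :: xs) = unitRowSum r x xs (unitTriSum r) := by
  rw [unitTriSum, unitRowSum, List.length_cons, List.replicate_succ, triSum_cons]
  refine rowSum_congr _ _ _ _ _ _ _ fun ys hys => ?_
  simp [unitTriSum, hys]

/-- The integers `e` are the remaining entries of a row of an alternating sign matrix whose
previous entries sum to `h`. -/
def IsAltRow {N : ℕ} (h : ℤ) (e : Fin N → ℤ) : Prop :=
  (∀ k, h + ∑ j with j ≤ k, e j = 0 ∨ h + ∑ j with j ≤ k, e j = 1) ∧ h + ∑ j, e j = 1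

theorem isAltRow_zero {h : ℤ} {e : Fin 0 → ℤ} : IsAltRow h e ↔ h = 1 := by
  simp [IsAltRow]

theorem isAltRow_succ {N : ℕ} {h : ℤ} {e : Fin (N + 1) → ℤ} :
    IsAltRow h e ↔
      (h + e 0 = 0 ∨ h + e 0 = 1) ∧ IsAltRow (h + e 0) fun j => e j.succ := by
  simp [IsAltRow, Fin.forall_fin_succ, sum_filter, Fin.sum_univ_succ, add_assoc, and_assoc]

theorem IsAltRow.entry {N : ℕ} {h : ℤ} {e : Fin N → ℤ} (he : IsAltRow h e) (hh : h = 0 ∨ h = 1)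
    (k : Fin N) : e k = -1 ∨ e k = 0 ∨ e k = 1 := by
  induction N generalizing h with
  | zero => exact k.elim0
  | succ N ih =>
    obtain ⟨h0, h1⟩ := isAltRow_succ.1 he
    cases k using Fin.cases with
    | zero => omega
    | succ k => exact ih h1 h0 k

open Classical in
theorem unitRowSum_ofFn (r : R) {N : ℕ} (h : Bool) (x : Fin N → Bool) (G : List Bool → R) :
    unitRowSum r h (List.ofFn x) G =
      ∑ y : Fin N → Bool with IsAltRow h.toInt fun j => (y j).toInt - (x j).toInt,
        r ^ (∑ j, ((y j).toInt - (x j).toInt).natAbs) * G (List.ofFn y) := by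
  induction N generalizing h G with
  | zero => cases h <;> simp [unitRowSum_nil, isAltRow_zero]
  | succ N ih =>
    rw [List.ofFn_succ, unitRowSum_cons, sum_filter, ← (Fin.consEquiv fun _ => Bool).sum_comp,
      Fintype.sum_prod_type, Fintype.sum_bool]
    simp only [ih, Fin.consEquiv_apply, isAltRow_succ, Fin.cons_zero, Fin.cons_succ,
      List.ofFn_succ, Fin.sum_univ_succ, pow_add, ← sum_filter]
    cases h <;> cases x 0 <;> simp [vertexSum, mul_sum, mul_assoc, add_comm] <;> rfl

/-- The symmetric matrix with zero top left entry, whose first row continues with `e`, and whose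
remaining entries are those of `B`. -/
def border {N : ℕ} (e : Fin N → ℤ) (B : Matrix (Fin N) (Fin N) ℤ) :
    Matrix (Fin (N + 1)) (Fin (N + 1)) ℤ :=
  Matrix.of (Fin.cons (Fin.cons 0 e) fun i => Fin.cons (e i) (B i))

section border
variable {N : ℕ} (e : Fin N → ℤ) (B : Matrix (Fin N) (Fin N) ℤ)

@[simp] theorem border_zero_zero : border e B 0 0 = 0 := rfl
@[simp] theorem border_zero_succ (j : Fin N) : border e B 0 j.succ = e j := rfl
@[simp] theorem border_succ_zero (i : Fin N) : border e B i.succ 0 = e i := rfl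
@[simp] theorem border_succ_succ (i j : Fin N) : border e B i.succ j.succ = B i j := rfl

theorem Rstat_border : Rstat (border e B) = ∑ j, (e j).natAbs + Rstat B := by
  simp [Rstat, sum_filter, Fintype.sum_prod_type, Fin.sum_univ_succ]

theorem Tstat_border : Tstat (border e B) = ∑ j : Fin N, (j + 2) * (e j).natAbs := by
  simp [Tstat, sum_filter, Fintype.sum_prod_type, Fin.sum_univ_succ]

end border

open Classical in
/-- The symmetric matrices with zero diagonal whose row `i`, after previous entries with sum
`x i`, satisfies the conditions on the rows of an alternating sign matrix. -/
noncomputable def truncatedOSASM : (N : ℕ) → (Fin N → Bool) → Finset (Matrix (Fin N) (Fin N) ℤ)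
  | 0, _ => {0}
  | N + 1, x => (Finset.sigma {y : Fin N → Bool |
      IsAltRow (x 0).toInt fun j => (y j).toInt - (x j.succ).toInt} (truncatedOSASM N)).image
        fun p => border (fun j => (p.1 j).toInt - (x j.succ).toInt) p.2

theorem mem_truncatedOSASM {N : ℕ} {x : Fin N → Bool} {B : Matrix (Fin N) (Fin N) ℤ} :
    B ∈ truncatedOSASM N x ↔
      B.IsSymm ∧ (∀ i, B i i = 0) ∧ ∀ i, IsAltRow (x i).toInt (B i) := by
  induction N with
  | zero => simp [truncatedOSASM, Matrix.IsSymm, eq_iff_true_of_subsingleton]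
  | succ N ih =>
    simp only [truncatedOSASM, mem_image, mem_sigma, mem_filter_univ, ih, Matrix.IsSymm.ext_iff,
      isAltRow_succ, Fin.forall_fin_succ]
    constructor
    · rintro ⟨⟨y, B⟩, ⟨hy, hs, h0, hB⟩, rfl⟩
      simp only [border_zero_zero, border_zero_succ, border_succ_zero, border_succ_succ,
        add_zero, add_sub_cancel]
      refine ⟨⟨⟨trivial, fun _ => trivial⟩, fun i => ⟨trivial, hs i⟩⟩, ⟨trivial, h0⟩,
        ⟨by cases x 0 <;> simp, hy⟩, fun i => ⟨by cases y i <;> simp, hB i⟩⟩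
    · rintro ⟨⟨⟨-, hs0⟩, hs⟩, ⟨h00, h0⟩, ⟨-, hB0⟩, hB⟩
      have hy (j : Fin N) : (decide ((x j.succ).toInt + B j.succ 0 = 1)).toInt =
          (x j.succ).toInt + B j.succ 0 := by
        rcases (hB j).1 with h | h <;> simp [h]
      refine ⟨⟨fun j => decide ((x j.succ).toInt + B j.succ 0 = 1), B.submatrix Fin.succ Fin.succ⟩,
        ⟨?_, fun i => (hs i).2, h0, fun i => ?_⟩, ?_⟩
      · simpa [hy, h00, ← hs0] using hB0
      · rw [hy]
        exact (hB i).2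
      · ext i j
        cases i using Fin.cases <;> cases j using Fin.cases <;> simp [hy, h00, ← hs0]

open Classical in
theorem sum_truncatedOSASM {N : ℕ} (x : Fin (N + 1) → Bool)
    (f : Matrix (Fin (N + 1)) (Fin (N + 1)) ℤ → R) :
    ∑ B ∈ truncatedOSASM (N + 1) x, f B =
      ∑ y : Fin N → Bool with IsAltRow (x 0).toInt fun j => (y j).toInt - (x j.succ).toInt,
        ∑ B ∈ truncatedOSASM N y, f (border (fun j => (y j).toInt - (x j.succ).toInt) B) := by
  rw [truncatedOSASM, sum_image, sum_sigma]
  rintro ⟨y, B⟩ - ⟨y', B'⟩ - h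
  have hy : y = y' := by
    funext j
    have := congrFun (congrFun h 0) j.succ
    simp only [border_zero_succ, sub_left_inj] at this
    revert this
    cases y j <;> cases y' j <;> simp
  have hB : B = B' := by
    ext i j
    exact congrFun (congrFun h i.succ) j.succ
  rw [hy, hB]

theorem unitTriSum_ofFn (r : R) {N : ℕ} (x : Fin N → Bool) :
    unitTriSum r (List.ofFn x) = ∑ B ∈ truncatedOSASM N x, r ^ Rstat B := by
  induction N with
  | zero => simp [unitTriSum, triSum_nil, truncatedOSASM, Rstat]
  | succ N ih =>
    rw [List.ofFn_succ, unitTriSum_cons, unitRowSum_ofFn, sum_truncatedOSASM]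
    simp only [ih, Rstat_border, pow_add, mul_sum]

theorem mem_truncatedOSASM_false {N : ℕ} {A : Matrix (Fin N) (Fin N) ℤ} :
    A ∈ truncatedOSASM N (fun _ => false) ↔ IsOSASMeven A := by
  rw [mem_truncatedOSASM]
  constructor
  · rintro ⟨hs, h0, hA⟩
    have hs' := hs.apply
    have hA' := fun i => (hA i).1
    have hA'' := fun i => (hA i).2
    simp only [Bool.toInt_false, zero_add] at hA' hA''
    refine ⟨⟨⟨fun i j => (hA i).entry (by simp) j, hA', ?_, hA'', ?_⟩, hs⟩, h0⟩
    · simpa only [hs'] using hA'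
    · simpa only [hs'] using hA''
  · rintro ⟨⟨⟨-, hA, -, hA', -⟩, hs⟩, h0⟩
    exact ⟨hs, h0, fun i => ⟨by simpa using hA i, by simpa using hA' i⟩⟩

/-- The sum of the positions of the entries `true` of a list, where positions are counted
from `k`. -/
def posSum : ℕ → List Bool → ℕ
  | _, [] => 0
  | k, b :: l => (if b then k else 0) + posSum (k + 1) l

theorem posSum_ofFn {N : ℕ} (k : ℕ) (y : Fin N → Bool) :
    posSum k (List.ofFn y) = ∑ j : Fin N, (j + k) * (y j).toInt.natAbs := by
  induction N generalizing k with
  | zero => simp [posSum]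
  | succ N ih =>
    rw [List.ofFn_succ, posSum, ih, Fin.sum_univ_succ]
    congr 1
    · cases y 0 <;> simp
    · simp [add_assoc, add_comm 1]

theorem posSum_replicate_false (k m : ℕ) : posSum k (.replicate m false) = 0 := by
  induction m generalizing k with
  | zero => rfl
  | succ m ih => simp [List.replicate_succ, posSum, ih]

theorem posSum_oneHot (k m j : ℕ) : posSum k (oneHot m j) = k + j := by
  rw [oneHot]
  generalize m - 1 - j = i
  induction j generalizing k with
  | zero => simp [posSum, posSum_replicate_false]
  | succ j ih => simp [List.replicate_succ, posSum, ih, add_assoc, add_comm 1]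

theorem finsum_isOSASMeven (m : ℕ) (r t : R) :
    ∑ᶠ A ∈ {A : Matrix (Fin (m + 1)) (Fin (m + 1)) ℤ | IsOSASMeven A}, r ^ Rstat A * t ^ Tstat A =
      ∑ j ∈ range m, r * t ^ (j + 2) * unitTriSum r (oneHot m j) := by
  have : {A : Matrix (Fin (m + 1)) (Fin (m + 1)) ℤ | IsOSASMeven A} =
      truncatedOSASM (m + 1) fun _ => false := by
    ext A
    exact mem_truncatedOSASM_false.symm
  rw [this, finsum_mem_coe_finset, sum_truncatedOSASM]
  have h := unitRowSum_ofFn r false (fun _ : Fin m => false) fun l =>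
    t ^ posSum 2 l * unitTriSum r l
  rw [List.ofFn_const, unitRowSum, List.length_replicate, rowSum_false_replicate] at h
  trans
  · convert h.symm using 2 with y
    simp only [Rstat_border, Tstat_border, unitTriSum_ofFn, posSum_ofFn, mul_sum, Bool.toInt_false,
      sub_zero]
    refine sum_congr rfl fun B _ => ?_
    ring
  · refine sum_congr rfl fun j _ => ?_
    rw [← oneHot, posSum_oneHot]
    ring

end

/-- The symmetry X^O_{2n}(r,t) = t^{2n+2} · X^O_{2n}(r,1/t) of the even-order OSASM
generating function, where X^O_{2n}(r,t) = ∑_{A ∈ OSASM(2n)} r^{R(A)} t^{T(A)}. -/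
theorem osasm_even_gf_symmetry (n : ℕ) (hn : 1 ≤ n) (r t : ℚ) (ht : t ≠ 0) :
    (∑ᶠ A ∈ {A : Matrix (Fin (2*n)) (Fin (2*n)) ℤ | IsOSASMeven A},
        r ^ Rstat A * t ^ Tstat A) =
      t ^ (2*n+2) *
        ∑ᶠ A ∈ {A : Matrix (Fin (2*n)) (Fin (2*n)) ℤ | IsOSASMeven A},
          r ^ Rstat A * (t⁻¹) ^ Tstat A := by
  obtain ⟨k, rfl⟩ : ∃ k, n = k + 1 := ⟨n - 1, by omega⟩
  rw [show 2 * (k + 1) = (2 * k + 1) + 1 by ring, finsum_isOSASMeven, finsum_isOSASMeven,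
    ← sum_range_reflect, mul_sum]
  refine sum_congr rfl fun j hj => ?_
  have hj : j < 2 * k + 1 := by simpa using hj
  obtain ⟨i, hi⟩ : ∃ i, 2 * k = i + j := ⟨2 * k - j, by omega⟩
  rw [unitTriSum_oneHot_symm r k hj, show 2 * k + 1 - 1 - j = 2 * k - j by omega,
    show 2 * k - j = i by omega, hi, inv_pow]
  field_simp
  ring
end
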